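/- There exists a constant C > 0 such that for every integer n > 1 and every r ∈ (0,1], ∫_{ℙ¹} | A_{n,r}(λ) − ν(n)·log d − ((d−1)/d)·ν(n)·g_I(λ) | dω(λ) ≤ (2 log d)·σ₁(n) + C·σ₀(n), where A_{n,r}(λ) := (1/n)·Σ_{z : Φ_n(λ,z)=0} log max{ r, |(f_λ^n)′(z)| } and the sum is over the roots of Φ_n(λ,·) counted with multiplicity. -/

import Mathlib

open MeasureTheory Real Polynomial

/- STATEMENT 17:
There exists a constant C > 0 such that for every n > 1 and every r ∈ (0,1],
∫_{ℙ¹} |A_{n,r}(λ) − ν(n)·log d − ((d−1)/d)·ν(n)·g_I(λ)| dω(λ)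
  ≤ (2 log d)·σ₁(n) + C·σ₀(n),
where A_{n,r}(λ) := (1/n)·Σ_{z : Φ_n(λ,z)=0} log max{r, |(f_λ^n)′(z)|}, the sum over the
roots of Φ_n(λ,·) with multiplicity. The dynatomic polynomial Φ_n ∈ ℤ[λ,z] is encoded as
Φ : (ℂ[λ])[z] satisfying the defining product identity and, for each λ, monic in z of
degree ν(n); ω is the normalized Fubini–Study measure. -/

noncomputable def fc (d : ℕ) (lam z : ℂ) : ℂ := z ^ d + lam

noncomputable def nu (d n : ℕ) : ℤ :=
  ∑ m ∈ n.divisors, ArithmeticFunction.moebius (n / m) * (d : ℤ) ^ m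

namespace S17

open MeasureTheory Real Polynomial

/-- multiplier along `n` steps -/
noncomputable def mul (d n : ℕ) (lam z : ℂ) : ℂ :=
  ∏ j ∈ Finset.range n, ((d : ℂ) * ((fc d lam)^[j] z) ^ (d - 1))

lemma fc_hasDerivAt (d : ℕ) (lam z : ℂ) : HasDerivAt (fc d lam) ((d : ℂ) * z ^ (d - 1)) z := by
  unfold fc
  simpa using (hasDerivAt_pow d z).add_const lam

lemma iter_hasDerivAt (d n : ℕ) (lam z : ℂ) :
    HasDerivAt ((fc d lam)^[n]) (mul d n lam z) z := by
  induction n with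
  | zero => simpa [mul] using hasDerivAt_id z
  | succ n ih =>
    rw [Function.iterate_succ', mul, Finset.prod_range_succ, mul_comm]
    exact (fc_hasDerivAt d lam _).comp z ih

lemma mul_eq_deriv (d n : ℕ) (lam z : ℂ) : deriv ((fc d lam)^[n]) z = mul d n lam z :=
  (iter_hasDerivAt d n lam z).deriv

lemma mul_add' (d m n : ℕ) (lam z : ℂ) :
    mul d (m + n) lam z = mul d m lam z * mul d n lam ((fc d lam)^[m] z) := by
  unfold mul
  rw [Finset.prod_range_add]
  congr 1
  refine Finset.prod_congr rfl fun j _ => ?_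
  rw [add_comm m j, Function.iterate_add_apply]

lemma mul_zero' (d : ℕ) (lam z : ℂ) : mul d 0 lam z = 1 := by simp [mul]

lemma mul_one' (d : ℕ) (lam z : ℂ) : mul d 1 lam z = (d : ℂ) * z ^ (d - 1) := by simp [mul]

lemma mul_shift (d n : ℕ) (lam z : ℂ) (h : (fc d lam)^[n] z = z) :
    mul d n lam (fc d lam z) = mul d n lam z := by
  have h1 := mul_add' d 1 n lam z
  have h2 := mul_add' d n 1 lam z
  rw [h, add_comm n 1, h1] at h2
  simp only [Function.iterate_one] at h2
  by_cases h0 : mul d 1 lam z = 0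
  · -- then z = 0 and d z^(d-1) = 0: both multipliers vanish
    rcases Nat.eq_zero_or_pos n with rfl | hn
    · simp [mul]
    have a1 : mul d n lam z = 0 := by
      obtain ⟨k, rfl⟩ := Nat.exists_eq_add_of_le hn
      rw [mul_add', h0, zero_mul]
    have a2 : mul d n lam (fc d lam z) = 0 := by
      obtain ⟨k, rfl⟩ := Nat.exists_eq_add_of_le' hn
      rw [mul_add', ← Function.iterate_succ_apply, h, h0, mul_zero]
    rw [a1, a2]
  · rw [mul_comm] at h2
    exact mul_right_cancel₀ h0 h2

lemma mul_shift_iter (d n j : ℕ) (lam z : ℂ) (h : (fc d lam)^[n] z = z) :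
    mul d n lam ((fc d lam)^[j] z) = mul d n lam z := by
  induction j with
  | zero => rfl
  | succ j ih =>
    rw [Function.iterate_succ_apply', mul_shift, ih]
    rw [← Function.iterate_add_apply, add_comm, Function.iterate_add_apply, h]

lemma mul_mul_period (d n j : ℕ) (lam z : ℂ) (h : (fc d lam)^[n] z = z) :
    mul d (n * j) lam z = mul d n lam z ^ j := by
  induction j with
  | zero => simp [mul]
  | succ j ih =>
    rw [Nat.mul_succ, mul_add', ih, pow_succ]
    congr 1
    have : (fc d lam)^[n * j] z = z := by
      rw [Function.iterate_mul]
      exact Function.iterate_fixed h j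
    rw [this]

lemma contDiff_iter (d n : ℕ) : ContDiff ℂ ⊤ (fun p : ℂ × ℂ => (fc d p.1)^[n] p.2) := by
  induction n with
  | zero => simpa using contDiff_snd
  | succ n ih =>
    simp only [Function.iterate_succ_apply']
    unfold fc at ih ⊢
    exact (ih.pow d).add contDiff_fst

lemma contDiff_mul (d n : ℕ) : ContDiff ℂ ⊤ (fun p : ℂ × ℂ => mul d n p.1 p.2) := by
  unfold mul
  exact contDiff_prod fun j _ => contDiff_const.mul ((contDiff_iter d j).pow (d - 1))

lemma continuous_iter (d n : ℕ) : Continuous (fun p : ℂ × ℂ => (fc d p.1)^[n] p.2) :=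
  (contDiff_iter d n).continuous

lemma continuous_mul' (d n : ℕ) : Continuous (fun p : ℂ × ℂ => mul d n p.1 p.2) :=
  (contDiff_mul d n).continuous

lemma continuous_fc (d : ℕ) (lam : ℂ) : Continuous (fc d lam) := by
  unfold fc; fun_prop

lemma continuous_fc_iter (d n : ℕ) (lam : ℂ) : Continuous ((fc d lam)^[n]) :=
  (continuous_fc d lam).iterate n

/-- complex change of variables -/
lemma lintegral_cov {s : Set ℂ} (hs : MeasurableSet s) {f f' : ℂ → ℂ}
    (hf : ∀ x ∈ s, HasDerivAt f (f' x) x) (hinj : Set.InjOn f s) (g : ℂ → ENNReal) :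
    ∫⁻ x in f '' s, g x = ∫⁻ x in s, ENNReal.ofReal (‖f' x‖ ^ 2) * g (f x) := by
  have key := lintegral_image_eq_lintegral_abs_det_fderiv_mul volume hs
    (f' := fun x => ((ContinuousLinearMap.toSpanSingleton ℂ (f' x)).restrictScalars ℝ))
    (fun x hx => ((hf x hx).hasFDerivAt.restrictScalars ℝ).hasFDerivWithinAt) hinj g
  rw [key]
  refine lintegral_congr fun x => ?_
  congr 2
  have h2 : (((ContinuousLinearMap.toSpanSingleton ℂ (f' x)).restrictScalars ℝ : ℂ →L[ℝ] ℂ) :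
      ℂ →ₗ[ℝ] ℂ) = ((LinearMap.toSpanSingleton ℂ ℂ (f' x)).restrictScalars ℝ) := rfl
  rw [ContinuousLinearMap.det, h2, LinearMap.det_restrictScalars]
  simp [Algebra.norm_complex_apply, Complex.normSq_eq_norm_sq]

end S17

namespace S17

open MeasureTheory Real Polynomial

/-- the primitive root of unity -/
noncomputable def om (d : ℕ) : ℂ := Complex.exp (2 * π * Complex.I / d)

lemma om_prim {d : ℕ} (hd : d ≠ 0) : IsPrimitiveRoot (om d) d := Complex.isPrimitiveRoot_exp d hd

def sector (d : ℕ) : Set ℂ := {y | y ≠ 0 ∧ -(π / d) < y.arg ∧ y.arg ≤ π / d}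

lemma sector_meas (d : ℕ) : MeasurableSet (sector d) := by
  unfold sector
  refine (measurableSet_singleton (0 : ℂ)).compl.inter ?_
  exact (measurableSet_lt measurable_const Complex.measurable_arg).inter
    (measurableSet_le Complex.measurable_arg measurable_const)

lemma sector_inj {d : ℕ} (hd : d ≠ 0) {x y : ℂ} (hx : x ∈ sector d) (hy : y ∈ sector d)
    (h : x ^ d = y ^ d) : x = y := by
  rw [← Complex.pow_cpow_nat_inv hd hx.2.1 hx.2.2, h, Complex.pow_cpow_nat_inv hd hy.2.1 hy.2.2]

lemma sector_surj {d : ℕ} (hd : d ≠ 0) {z : ℂ} (hz : z ≠ 0) : ∃ y ∈ sector d, y ^ d = z := by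
  have hdp : (0 : ℝ) < d := by exact_mod_cast Nat.pos_of_ne_zero hd
  refine ⟨z ^ ((d : ℂ)⁻¹), ⟨?_, ?_⟩, Complex.cpow_nat_inv_pow z hd⟩
  · simp [Complex.cpow_eq_zero_iff, hz]
  · have him : (Complex.log z * (d : ℂ)⁻¹).im = z.arg / d := by
      rw [← Complex.ofReal_natCast, ← Complex.ofReal_inv, Complex.im_mul_ofReal, Complex.log_im]
      rfl
    have h1 : z.arg / d ∈ Set.Ioc (-π) π := by
      have h1d : (1 : ℝ) ≤ d := by exact_mod_cast Nat.one_le_iff_ne_zero.mpr hd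
      constructor
      · rw [lt_div_iff₀ hdp]
        nlinarith [Complex.neg_pi_lt_arg z, Real.pi_pos]
      · rw [div_le_iff₀ hdp]
        nlinarith [Complex.arg_le_pi z, Real.pi_pos]
    have harg : (z ^ ((d : ℂ)⁻¹)).arg = z.arg / d := by
      rw [Complex.cpow_def_of_ne_zero hz, Complex.arg_exp, him]
      exact (toIocMod_eq_self _).mpr (by simpa [two_mul] using h1)
    rw [harg]
    constructor
    · rw [← neg_div]
      exact div_lt_div_of_pos_right (Complex.neg_pi_lt_arg z) hdp
    · exact div_le_div_of_nonneg_right (Complex.arg_le_pi z) hdp.le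

lemma om_pow_pow {d : ℕ} (hd : d ≠ 0) (j : ℕ) : (om d ^ j) ^ d = 1 := by
  rw [← pow_mul, mul_comm, pow_mul, (om_prim hd).pow_eq_one, one_pow]

lemma om_ne {d : ℕ} (hd : d ≠ 0) (j : ℕ) : om d ^ j ≠ 0 :=
  pow_ne_zero _ ((om_prim hd).ne_zero hd)

lemma om_norm {d : ℕ} (hd : d ≠ 0) (j : ℕ) : ‖om d ^ j‖ = 1 := by
  rw [norm_pow, (om_prim hd).norm'_eq_one hd, one_pow]

lemma fc_om {d : ℕ} (hd : d ≠ 0) (j : ℕ) (lam y : ℂ) : fc d lam (om d ^ j * y) = fc d lam y := by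
  unfold fc; rw [mul_pow, om_pow_pow hd, one_mul]

lemma pow_push {d : ℕ} (hd : d ≠ 0) (lam : ℂ) {V : Set ℂ} (hV : MeasurableSet V) (q : ℂ → ℂ)
    (hq : Measurable q)
    (hid : ∀ y : ℂ, y ≠ 0 → fc d lam y ∈ V →
      ‖(d : ℂ) * y ^ (d - 1)‖ ^ 2 * ‖q (fc d lam y)‖ ≤
        ∑ j ∈ Finset.range d, ‖q (om d ^ j * y)‖) :
    ∫⁻ z in V, ‖q z‖ₑ ≤ ∫⁻ z in fc d lam ⁻¹' V, ‖q z‖ₑ := by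
  have hfm : Measurable (fc d lam) := (continuous_fc d lam).measurable
  set S : Set ℂ := sector d ∩ fc d lam ⁻¹' V with hS
  have hSm : MeasurableSet S := (sector_meas d).inter (hfm hV)
  have himg : V ⊆ fc d lam '' S ∪ {lam} := by
    intro z hz
    by_cases h : z = lam
    · right; exact h
    · left
      obtain ⟨y, hy, hyz⟩ := sector_surj hd (sub_ne_zero.mpr h)
      have : fc d lam y = z := by unfold fc; rw [hyz]; ring
      exact ⟨y, ⟨hy, by simpa [this] using hz⟩, this⟩
  have hinj : Set.InjOn (fc d lam) S := by
    intro x hx y hy h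
    exact sector_inj hd hx.1 hy.1 (by unfold fc at h; exact add_right_cancel h)
  have h1 : ∫⁻ z in V, ‖q z‖ₑ ≤ ∫⁻ z in fc d lam '' S, ‖q z‖ₑ := by
    have : V ≤ᵐ[volume] (fc d lam '' S : Set ℂ) := by
      have hn : ∀ᵐ z : ℂ, z ∉ ({lam} : Set ℂ) := by
        rw [ae_iff]; simp
      filter_upwards [hn] with z hz hzV
      exact (himg hzV).resolve_right hz
    exact lintegral_mono' (Measure.restrict_mono_ae this) le_rfl
  have h2 := lintegral_cov hSm (f' := fun y => (d : ℂ) * y ^ (d - 1))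
    (fun x _ => fc_hasDerivAt d lam x) hinj (fun z => ‖q z‖ₑ)
  have h3 : ∫⁻ y in S, ENNReal.ofReal (‖(d : ℂ) * y ^ (d - 1)‖ ^ 2) * ‖q (fc d lam y)‖ₑ
      ≤ ∫⁻ y in S, ∑ j ∈ Finset.range d, ‖q (om d ^ j * y)‖ₑ := by
    refine setLIntegral_mono' hSm fun y hy => ?_
    have := hid y hy.1.1 hy.2
    rw [← ofReal_norm_eq_enorm, ← ENNReal.ofReal_mul (by positivity)]
    simp_rw [← ofReal_norm_eq_enorm]
    rw [← ENNReal.ofReal_sum_of_nonneg (fun _ _ => norm_nonneg _)]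
    exact ENNReal.ofReal_le_ofReal this
  have h4 : ∫⁻ y in S, ∑ j ∈ Finset.range d, ‖q (om d ^ j * y)‖ₑ
      = ∑ j ∈ Finset.range d, ∫⁻ y in S, ‖q (om d ^ j * y)‖ₑ := by
    refine lintegral_finsetSum _ fun j _ => ?_
    exact (hq.comp (measurable_const_mul _)).enorm
  have himm : ∀ j, MeasurableSet ((fun y => om d ^ j * y) '' S) := by
    intro j
    exact (MeasurableEquiv.mulLeft₀ (om d ^ j) (om_ne hd j)).measurableEmbedding.measurableSet_image' hSm
  have h5 : ∀ j, ∫⁻ y in S, ‖q (om d ^ j * y)‖ₑ =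
      ∫⁻ y in (fun y => om d ^ j * y) '' S, ‖q y‖ₑ := by
    intro j
    rw [lintegral_cov hSm (f := fun y => om d ^ j * y) (f' := fun y => om d ^ j)
      (fun x _ => by simpa using (hasDerivAt_id x).const_mul (om d ^ j))
      (fun x _ y _ h => mul_left_cancel₀ (om_ne hd j) h)]
    simp [om_norm hd, -norm_pow]
  have h6 : ∑ j ∈ Finset.range d, ∫⁻ y in (fun y => om d ^ j * y) '' S, ‖q y‖ₑ
      = ∫⁻ y in ⋃ j ∈ Finset.range d, (fun y => om d ^ j * y) '' S, ‖q y‖ₑ := by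
    symm
    refine lintegral_biUnion_finset ?_ (fun j _ => himm j) _
    intro i hi j hj hij
    rw [Function.onFun, Set.disjoint_left]
    rintro z ⟨x, hx, rfl⟩ ⟨y, hy, hxy⟩
    apply hij
    simp only at hxy
    have hp : x ^ d = y ^ d := by
      have := congrArg (· ^ d) hxy
      simp only [mul_pow, om_pow_pow hd, one_mul] at this
      exact this.symm
    have hxy' := sector_inj hd hx.1 hy.1 hp
    subst hxy'
    have := mul_right_cancel₀ hx.1.1 hxy
    exact ((om_prim hd).pow_inj (Finset.mem_range.mp hj) (Finset.mem_range.mp hi) this).symm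
  calc _ ≤ _ := h1
    _ = _ := h2
    _ ≤ _ := h3
    _ = _ := h4
    _ = _ := Finset.sum_congr rfl fun j _ => h5 j
    _ = _ := h6
    _ ≤ _ := by
      refine lintegral_mono_set ?_
      intro z hz
      simp only [Set.mem_iUnion] at hz
      obtain ⟨j, _, y, hy, rfl⟩ := hz
      simp only [Set.mem_preimage, fc_om hd]
      exact hy.2

end S17

namespace S17

open MeasureTheory Real Polynomial Filter Topology

lemma shrink_aux {f : ℂ → ℂ} {f' a : ℂ} (hf : HasDerivAt f f' a) {c1 c2 : ℝ} (hc1 : 0 < c1)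
    (h : ‖f'‖ * c1 < c2) :
    ∀ᶠ s in 𝓝[>] (0 : ℝ), ∀ z, ‖z - a‖ ≤ s * c1 → ‖f z - f a‖ < s * c2 := by
  have hL : ‖f'‖ < c2 / c1 := by rwa [lt_div_iff₀ hc1]
  obtain ⟨L, hL1, hL2⟩ := exists_between hL
  have hL2' : L * c1 < c2 := by rwa [lt_div_iff₀ hc1] at hL2
  have h1 : ∀ᶠ z in 𝓝 a, ‖f z - f a‖ ≤ L * ‖z - a‖ := by
    have hlo := hf.hasFDerivAt.isLittleO
    filter_upwards [hlo.def (sub_pos.2 hL1)] with z hz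
    have : f z - f a = (f z - f a - (z - a) * f') + (z - a) * f' := by ring
    rw [this]
    refine (norm_add_le _ _).trans ?_
    have e : (ContinuousLinearMap.toSpanSingleton ℂ f') (z - a) = (z - a) * f' := by simp
    rw [e] at hz
    rw [norm_mul (z - a)]
    nlinarith
  rw [Metric.eventually_nhds_iff] at h1
  obtain ⟨δ, hδ, h1⟩ := h1
  have h2 : ∀ᶠ s in 𝓝[>] (0 : ℝ), s < δ / c1 :=
    nhdsWithin_le_nhds (eventually_lt_nhds (by positivity))
  filter_upwards [h2, self_mem_nhdsWithin] with s hs hs0 z hz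
  have hs0 : 0 < s := hs0
  have : ‖z - a‖ < δ := by
    rw [lt_div_iff₀ hc1] at hs; exact hz.trans_lt hs
  have h3 := h1 (y := z) (by rwa [dist_eq_norm])
  have hLn : 0 ≤ L := (norm_nonneg _).trans hL1.le
  nlinarith [mul_le_mul_of_nonneg_left hz hLn, mul_lt_mul_of_pos_left hL2' hs0]

lemma escape_aux {d : ℕ} (hd : 2 ≤ d) (lam : ℂ) {R : ℝ} (hR : 2 + ‖lam‖ ≤ R) (z : ℂ) (hz : R ≤ ‖z‖) :
    R ≤ ‖fc d lam z‖ := by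
  unfold fc
  have h1 : ‖z‖ ^ d - ‖lam‖ ≤ ‖z ^ d + lam‖ := by
    have := norm_sub_norm_le (z ^ d) (-lam)
    rwa [norm_neg, norm_pow, sub_neg_eq_add] at this
  have hz1 : 1 ≤ ‖z‖ := by linarith [norm_nonneg lam]
  have h2 : ‖z‖ ^ 2 ≤ ‖z‖ ^ d := pow_le_pow_right₀ hz1 hd
  nlinarith [norm_nonneg lam]

lemma contraction {d : ℕ} (hd : 2 ≤ d) (lam : ℂ) (Z : Finset ℂ)
    (hZ : ∀ a ∈ Z, fc d lam a ∈ Z) (N : ℕ) (hN : 0 < N)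
    (hw : ∀ a ∈ Z, ‖mul d N lam a‖ < 1)
    (q : ℂ → ℂ) (hq : Measurable q) (hqc : ∀ z ∉ Z, ContinuousAt q z)
    (hid : ∀ y : ℂ, y ≠ 0 → fc d lam y ∉ Z →
      ∑ j ∈ Finset.range d, (om d ^ j) ^ 2 * q (om d ^ j * y) =
        ((d : ℂ) * y ^ (d - 1)) ^ 2 * q (fc d lam y))
    (a0 : ℂ) (ha0 : a0 ∈ Z) (hinf : Tendsto (fun z => ‖q z‖) (𝓝[≠] a0) atTop) : False := by
  have hd0 : d ≠ 0 := by omega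
  set f := fc d lam with hf
  set ρ : ℂ → ℝ := fun a => ∑ j ∈ Finset.range N, ‖mul d j lam a‖ with hρ
  have hρ1 : ∀ a, 1 ≤ ρ a := by
    intro a
    have := Finset.single_le_sum (f := fun j => ‖mul d j lam a‖) (s := Finset.range N)
      (fun _ _ => norm_nonneg _) (Finset.mem_range.2 hN)
    simpa [mul_zero'] using this
  set c : ℂ → ℝ := fun a => 1 / ρ a with hc
  have hcp : ∀ a, 0 < c a := fun a => by have := hρ1 a; simp only [hc]; positivity
  have hcc : ∀ a ∈ Z, ‖(d : ℂ) * a ^ (d - 1)‖ * c a < c (f a) := by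
    intro a ha
    have h1 : ‖(d : ℂ) * a ^ (d - 1)‖ * ρ (f a) < ρ a := by
      have e : ‖(d : ℂ) * a ^ (d - 1)‖ * ρ (f a) = ∑ j ∈ Finset.range N, ‖mul d (j + 1) lam a‖ := by
        rw [hρ, Finset.mul_sum]
        refine Finset.sum_congr rfl fun j _ => ?_
        rw [add_comm j 1, mul_add', mul_one', norm_mul ((d : ℂ) * a ^ (d - 1))]; rfl
      have e2 := Finset.sum_range_succ' (fun j => ‖mul d j lam a‖) N
      rw [Finset.sum_range_succ] at e2
      rw [e]
      have := hw a ha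
      simp only [mul_zero', norm_one] at e2
      simp only [hρ]
      linarith
    simp only [hc]
    have p1 := hρ1 a
    have p2 := hρ1 (f a)
    rw [mul_one_div, div_lt_div_iff₀ (by linarith) (by linarith)]
    linarith
  have hex : ∀ a ∈ Z, ∃ c1, c a < c1 ∧ ‖(d : ℂ) * a ^ (d - 1)‖ * c1 < c (f a) := by
    intro a ha
    have ht : Tendsto (fun x : ℝ => ‖(d : ℂ) * a ^ (d - 1)‖ * x) (𝓝[>] (c a))
        (𝓝 (‖(d : ℂ) * a ^ (d - 1)‖ * c a)) :=
      ((continuous_const.mul continuous_id).tendsto _).mono_left nhdsWithin_le_nhds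
    obtain ⟨x, hx, hx2⟩ := ((ht.eventually (eventually_lt_nhds (hcc a ha))).and
      self_mem_nhdsWithin).exists
    exact ⟨x, hx2, hx⟩
  choose! c1 hc1 hc1' using hex
  -- small s
  have ev1 : ∀ᶠ s in 𝓝[>] (0 : ℝ), ∀ a ∈ Z, ∀ z, ‖z - a‖ ≤ s * c1 a → ‖f z - f a‖ < s * c (f a) := by
    rw [Finset.eventually_all]
    intro a ha
    exact shrink_aux (fc_hasDerivAt d lam a) ((hcp a).trans (hc1 a ha)) (hc1' a ha)
  have hten : ∀ K : ℝ, Tendsto (fun s : ℝ => s * K) (𝓝[>] 0) (𝓝 0) := by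
    intro K
    have : Tendsto (fun s : ℝ => s * K) (𝓝 0) (𝓝 (0 * K)) := tendsto_id.mul_const K
    rw [zero_mul] at this
    exact this.mono_left nhdsWithin_le_nhds
  have ev2 : ∀ᶠ s in 𝓝[>] (0 : ℝ), ∀ a ∈ Z, a ≠ a0 → s * (c a + c1 a0) < ‖a - a0‖ := by
    rw [Finset.eventually_all]
    intro a ha
    by_cases h : a = a0
    · simp [h]
    · filter_upwards [(hten (c a + c1 a0)).eventually
        (eventually_lt_nhds (norm_pos_iff.2 (sub_ne_zero.2 h)))] with s hs _ using hs
  have ev3 : ∀ᶠ s in 𝓝[>] (0 : ℝ), ∀ z, z ≠ a0 → ‖z - a0‖ < s * c1 a0 → 0 < ‖q z‖ := by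
    have h1 := hinf.eventually (eventually_gt_atTop 0)
    rw [eventually_nhdsWithin_iff, Metric.eventually_nhds_iff] at h1
    obtain ⟨δ, hδ, h1⟩ := h1
    filter_upwards [(hten (c1 a0)).eventually (eventually_lt_nhds hδ)] with s hs z hz hz2
    exact h1 (y := z) (by rw [dist_eq_norm]; linarith) hz
  have ev4 : ∀ᶠ s in 𝓝[>] (0 : ℝ), s * c1 a0 < 1 :=
    (hten _).eventually (eventually_lt_nhds one_pos)
  obtain ⟨s, hs1, hs2, hs3, hs4, hs0⟩ :=
    (ev1.and (ev2.and (ev3.and (ev4.and self_mem_nhdsWithin)))).exists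
  have hs0 : 0 < s := hs0
  set R : ℝ := 2 + ‖lam‖ + ‖a0‖ with hR
  set V : Set ℂ := {z | ‖z‖ < R ∧ ∀ a ∈ Z, s * c a < ‖z - a‖} with hV
  have hVo : IsOpen V := by
    have : V = {z | ‖z‖ < R} ∩ ⋂ a ∈ Z, {z | s * c a < ‖z - a‖} := by
      ext z; simp [hV]
    rw [this]
    refine (isOpen_lt continuous_norm continuous_const).inter ?_
    exact isOpen_biInter_finset fun a _ =>
      isOpen_lt continuous_const (continuous_id.sub continuous_const).norm
  have hVZ : ∀ z ∈ V, z ∉ Z := by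
    intro z hz hzZ
    have := hz.2 z hzZ
    rw [sub_self, norm_zero] at this
    nlinarith [hcp z]
  have hsub : f ⁻¹' V ⊆ V := by
    intro z hz
    refine ⟨?_, fun a ha => ?_⟩
    · by_contra h
      have := escape_aux hd lam (R := R) (by linarith [norm_nonneg a0]) z (not_lt.1 h)
      exact absurd hz.1 (not_lt.2 this)
    · by_contra h
      have h1 := hs1 a ha z ((not_lt.1 h).trans (by nlinarith [hc1 a ha]))
      have h2 := hz.2 _ (hZ a ha)
      linarith
  set W : Set ℂ := {z | s * c a0 < ‖z - a0‖ ∧ ‖z - a0‖ < s * c1 a0} with hW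
  have hWo : IsOpen W :=
    (isOpen_lt continuous_const (continuous_id.sub continuous_const).norm).inter
      (isOpen_lt (continuous_id.sub continuous_const).norm continuous_const)
  have hWne : W.Nonempty := by
    obtain ⟨x, hx1, hx2⟩ := exists_between (hc1 a0 ha0)
    have hx0 : 0 < x := (hcp a0).trans hx1
    refine ⟨a0 + ((s * x : ℝ) : ℂ), ?_⟩
    have : ‖a0 + ((s * x : ℝ) : ℂ) - a0‖ = s * x := by
      rw [add_sub_cancel_left, Complex.norm_real, Real.norm_of_nonneg (by positivity)]
    simp only [hW, Set.mem_ofPred_eq, this]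
    exact ⟨by nlinarith, by nlinarith⟩
  have hWV : W ⊆ V := by
    intro z hz
    refine ⟨?_, fun a ha => ?_⟩
    · have := norm_le_norm_add_norm_sub' z a0
      have := hz.2
      linarith [norm_nonneg lam]
    · by_cases h : a = a0
      · rw [h]; exact hz.1
      · have h2 := hs2 a ha h
        have h3 : ‖a - a0‖ ≤ ‖z - a‖ + ‖z - a0‖ := by
          have : a - a0 = (z - a0) - (z - a) := by ring
          rw [this]; linarith [norm_sub_le (z - a0) (z - a)]
        have := hz.2
        nlinarith
  have hWf : ∀ z ∈ W, z ∉ f ⁻¹' V := by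
    intro z hz hz2
    have h1 := hs1 a0 ha0 z hz.2.le
    have h2 := hz2.2 _ (hZ a0 ha0)
    linarith
  have hWq : ∀ z ∈ W, ‖q z‖ₑ ≠ 0 := by
    intro z hz
    have hne : z ≠ a0 := by
      rintro rfl
      have := hz.1
      rw [sub_self, norm_zero] at this
      nlinarith [hcp z]
    have := hs3 z hne hz.2
    simpa using this
  -- integrals
  have key := pow_push hd0 lam hVo.measurableSet q hq (by
    intro y hy hyV
    have h := hid y hy (hVZ _ hyV)
    have h2 := congrArg norm h
    rw [norm_mul, norm_pow] at h2
    rw [← h2]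
    refine (norm_sum_le _ _).trans (Finset.sum_le_sum fun j _ => ?_)
    rw [norm_mul, norm_pow, om_norm hd0, one_pow, one_mul])
  have hfin : ∫⁻ z in V, ‖q z‖ₑ ≠ ⊤ := by
    set Kc : Set ℂ := {z | ‖z‖ ≤ R ∧ ∀ a ∈ Z, s * c a ≤ ‖z - a‖} with hK
    have hKc : IsCompact Kc := by
      have : Kc = Metric.closedBall 0 R ∩ ⋂ a ∈ Z, {z | s * c a ≤ ‖z - a‖} := by
        ext z; simp [hK]
      rw [this]
      refine (isCompact_closedBall 0 R).inter_right ?_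
      exact isClosed_biInter fun a _ =>
        isClosed_le continuous_const (continuous_id.sub continuous_const).norm
    have hcont : ContinuousOn q Kc := by
      intro z hz
      refine (hqc z fun hzZ => ?_).continuousWithinAt
      have := hz.2 z hzZ
      rw [sub_self, norm_zero] at this
      nlinarith [hcp z]
    have hIntg := (hcont.integrableOn_compact (μ := volume) hKc)
    have := hIntg.mono_set (s := V) (fun z hz => ⟨hz.1.le, fun a ha => (hz.2 a ha).le⟩)
    exact this.2.ne
  have hdiff : ∫⁻ z in V, ‖q z‖ₑ ≥ (∫⁻ z in f ⁻¹' V, ‖q z‖ₑ) + ∫⁻ z in W, ‖q z‖ₑ := by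
    rw [← lintegral_union hWo.measurableSet]
    · exact lintegral_mono_set (Set.union_subset hsub hWV)
    · rw [Set.disjoint_left]
      intro z hz hzW
      exact hWf z hzW hz
  have hpos : 0 < ∫⁻ z in W, ‖q z‖ₑ := by
    rw [setLIntegral_pos_iff hq.enorm]
    have : (Function.support fun z => ‖q z‖ₑ) ∩ W = W := by
      ext z; simp only [Set.mem_inter_iff, Function.mem_support]
      exact ⟨fun h => h.2, fun h => ⟨hWq z h, h⟩⟩
    rw [this]
    exact hWo.measure_pos volume hWne
  have hfin2 : ∫⁻ z in f ⁻¹' V, ‖q z‖ₑ ≠ ⊤ := ne_top_of_le_ne_top hfin (lintegral_mono_set hsub)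
  have : ∫⁻ z in f ⁻¹' V, ‖q z‖ₑ < (∫⁻ z in f ⁻¹' V, ‖q z‖ₑ) + ∫⁻ z in W, ‖q z‖ₑ :=
    ENNReal.lt_add_right hfin2 hpos.ne'
  exact absurd key (not_le.2 (this.trans_le hdiff))

end S17

namespace S17

open MeasureTheory Real Polynomial Filter Topology

lemma om_sum {d : ℕ} (hd : d ≠ 0) (k : ℕ) :
    ∑ j ∈ Finset.range d, (om d ^ j) ^ k = if d ∣ k then (d : ℂ) else 0 := by
  have h1 : ∀ j, (om d ^ j) ^ k = (om d ^ k) ^ j := fun j => by rw [← pow_mul, ← pow_mul, mul_comm]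
  simp only [h1]
  split_ifs with h
  · rw [((om_prim hd).pow_eq_one_iff_dvd k).2 h]; simp
  · have hne : om d ^ k ≠ 1 := fun h' => h (((om_prim hd).pow_eq_one_iff_dvd k).1 h')
    rw [geom_sum_eq hne, ← pow_mul, mul_comm, pow_mul, (om_prim hd).pow_eq_one, one_pow]
    simp

lemma T1 {d : ℕ} (hd : 2 ≤ d) {y a : ℂ} (h : y ^ d ≠ a ^ d) :
    ∑ j ∈ Finset.range d, (om d ^ j) ^ 2 * (1 / (om d ^ j * y - a)) =
      d * a * y ^ (d - 2) / (y ^ d - a ^ d) := by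
  have hd0 : d ≠ 0 := by omega
  have hne : y ^ d - a ^ d ≠ 0 := sub_ne_zero.2 h
  have h1 : ∀ j ∈ Finset.range d, (om d ^ j) ^ 2 * (1 / (om d ^ j * y - a)) =
      ∑ i ∈ Finset.range d, (om d ^ j) ^ (i + 2) * (y ^ i * a ^ (d - 1 - i) / (y ^ d - a ^ d)) := by
    intro j _
    have g := (Commute.all (om d ^ j * y) a).geom_sum₂_mul d
    rw [mul_pow, om_pow_pow hd0, one_mul] at g
    have hz : om d ^ j * y - a ≠ 0 := fun h0 => by rw [h0, mul_zero] at g; exact hne g.symm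
    have : 1 / (om d ^ j * y - a) = (∑ i ∈ Finset.range d, (om d ^ j * y) ^ i * a ^ (d - 1 - i)) /
        (y ^ d - a ^ d) := by
      rw [div_eq_div_iff hz hne, one_mul, ← g]
    rw [this, Finset.sum_div, Finset.mul_sum]
    refine Finset.sum_congr rfl fun i _ => ?_
    rw [mul_pow]; ring
  rw [Finset.sum_congr rfl h1, Finset.sum_comm]
  simp only [← Finset.sum_mul, om_sum hd0]
  rw [Finset.sum_eq_single (d - 2)]
  · have e1 : d - 2 + 2 = d := by omega
    have e2 : d - 1 - (d - 2) = 1 := by omega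
    rw [e1, e2, if_pos dvd_rfl]; ring
  · intro i hi hne
    rw [if_neg, zero_mul]
    rintro ⟨c, hc⟩
    rw [Finset.mem_range] at hi
    have : c ≠ 0 := by rintro rfl; omega
    have : c ≠ 1 := by rintro rfl; omega
    have : 2 ≤ c := by omega
    have : d * 2 ≤ d * c := Nat.mul_le_mul_left d this
    omega
  · intro h; exact absurd (Finset.mem_range.2 (by omega)) h

lemma T2 {d : ℕ} (hd : 2 ≤ d) {y a : ℂ} (h : y ^ d ≠ a ^ d) :
    ∑ j ∈ Finset.range d, (om d ^ j) ^ 2 * (1 / (om d ^ j * y - a) ^ 2) =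
      d * y ^ (d - 2) * (y ^ d + (d - 1) * a ^ d) / (y ^ d - a ^ d) ^ 2 := by
  have hd0 : d ≠ 0 := by omega
  have hne : y ^ d - a ^ d ≠ 0 := sub_ne_zero.2 h
  have hz : ∀ j, om d ^ j * y - a ≠ 0 := by
    intro j h0
    apply h
    rw [← sub_eq_zero.1 h0, mul_pow, om_pow_pow hd0, one_mul]
  have hL : HasDerivAt (fun a => ∑ j ∈ Finset.range d, (om d ^ j) ^ 2 * (1 / (om d ^ j * y - a)))
      (∑ j ∈ Finset.range d, (om d ^ j) ^ 2 * (1 / (om d ^ j * y - a) ^ 2)) a := by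
    apply HasDerivAt.fun_sum
    intro j _
    apply HasDerivAt.const_mul
    have h1 : HasDerivAt (fun a => om d ^ j * y - a) (-1) a := by
      simpa using (hasDerivAt_id a).const_sub (om d ^ j * y)
    have h2 := h1.fun_inv (hz j)
    simp only [one_div]
    rw [neg_neg, one_div] at h2
    exact h2
  have hR : HasDerivAt (fun a => d * a * y ^ (d - 2) / (y ^ d - a ^ d))
      (d * y ^ (d - 2) * (y ^ d + (d - 1) * a ^ d) / (y ^ d - a ^ d) ^ 2) a := by
    have h1 : HasDerivAt (fun a : ℂ => d * a * y ^ (d - 2)) (d * 1 * y ^ (d - 2)) a :=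
      ((hasDerivAt_id a).const_mul (d : ℂ)).mul_const _
    have h2 : HasDerivAt (fun a : ℂ => y ^ d - a ^ d) (-(d * a ^ (d - 1))) a := by
      simpa using (hasDerivAt_pow d a).const_sub (y ^ d)
    refine (h1.fun_div h2 hne).congr_deriv ?_
    have : a ^ d = a ^ (d - 1) * a := by rw [← pow_succ]; congr 1; omega
    rw [this]; ring
  refine hL.unique (hR.congr_of_eventuallyEq ?_)
  have hev : ∀ᶠ b in 𝓝 a, y ^ d ≠ b ^ d :=
    ((continuous_pow d).continuousAt.eventually_ne (g := fun b : ℂ => b ^ d) h.symm).mono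
      fun b hb => hb.symm
  filter_upwards [hev] with b hb
  exact T1 hd hb

lemma T1' {d : ℕ} (hd : 2 ≤ d) (lam : ℂ) {y a : ℂ} (hy : y ≠ 0) (ha : a ≠ 0)
    (h : fc d lam y ≠ fc d lam a) :
    ∑ j ∈ Finset.range d, (om d ^ j) ^ 2 * (1 / (om d ^ j * y - a)) =
      ((d : ℂ) * y ^ (d - 1)) ^ 2 * ((1 / (d * a ^ (d - 1))) *
        (1 / (fc d lam y - fc d lam a) - 1 / (fc d lam y - lam))) := by
  have h' : y ^ d ≠ a ^ d := fun h0 => h (by unfold fc; rw [h0])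
  rw [T1 hd h']
  have hne : y ^ d - a ^ d ≠ 0 := sub_ne_zero.2 h'
  have hdc : (d : ℂ) ≠ 0 := by exact_mod_cast (by omega : d ≠ 0)
  have e1 : fc d lam y - fc d lam a = y ^ d - a ^ d := by unfold fc; ring
  have e2 : fc d lam y - lam = y ^ d := by unfold fc; ring
  rw [e1, e2]
  obtain ⟨k, rfl⟩ : ∃ k, d = k + 2 := ⟨d - 2, by omega⟩
  simp only [Nat.add_sub_cancel, show k + 2 - 1 = k + 1 by omega]
  field_simp
  ring

lemma T2' {d : ℕ} (hd : 2 ≤ d) (lam : ℂ) {y a : ℂ} (hy : y ≠ 0) (ha : a ≠ 0)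
    (h : fc d lam y ≠ fc d lam a) :
    ∑ j ∈ Finset.range d, (om d ^ j) ^ 2 * (1 / (om d ^ j * y - a) ^ 2) =
      ((d : ℂ) * y ^ (d - 1)) ^ 2 * (1 / (fc d lam y - fc d lam a) ^ 2 -
        ((d - 1) / a) / (d * a ^ (d - 1)) *
        (1 / (fc d lam y - fc d lam a) - 1 / (fc d lam y - lam))) := by
  have h' : y ^ d ≠ a ^ d := fun h0 => h (by unfold fc; rw [h0])
  rw [T2 hd h']
  have hne : y ^ d - a ^ d ≠ 0 := sub_ne_zero.2 h'
  have hdc : (d : ℂ) ≠ 0 := by exact_mod_cast (by omega : d ≠ 0)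
  have e1 : fc d lam y - fc d lam a = y ^ d - a ^ d := by unfold fc; ring
  have e2 : fc d lam y - lam = y ^ d := by unfold fc; ring
  rw [e1, e2]
  obtain ⟨k, rfl⟩ : ∃ k, d = k + 2 := ⟨d - 2, by omega⟩
  simp only [Nat.add_sub_cancel, show k + 2 - 1 = k + 1 by omega]
  field_simp
  ring

/-- the polar part along a cycle -/
noncomputable def Acyc (d : ℕ) (lam : ℂ) (n : ℕ) (z : ℂ) (β : ℕ → ℂ) (x : ℂ) : ℂ :=
  ∑ i ∈ Finset.range n, (1 / (x - (fc d lam)^[i] z) ^ 2 + β i * (1 / (x - (fc d lam)^[i] z)))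

noncomputable def beta (d : ℕ) (lam : ℂ) (n : ℕ) (z : ℂ) (i : ℕ) : ℂ :=
  ((∑ j ∈ Finset.range n, ((d - 1) / (fc d lam)^[j] z) * mul d j lam z) / (1 - mul d n lam z) -
    ∑ j ∈ Finset.range i, ((d - 1) / (fc d lam)^[j] z) * mul d j lam z) / mul d i lam z

lemma mul_ne_of_ne {d n : ℕ} {lam z : ℂ} (hw : mul d n lam z ≠ 0) {i : ℕ} (hi : i ≤ n) :
    mul d i lam z ≠ 0 := by
  obtain ⟨k, rfl⟩ := Nat.exists_eq_add_of_le hi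
  rw [mul_add'] at hw
  exact left_ne_zero_of_mul hw

lemma iter_ne_of_ne {d n : ℕ} (hd : 2 ≤ d) {lam z : ℂ} (hw : mul d n lam z ≠ 0) {i : ℕ} (hi : i < n) :
    (fc d lam)^[i] z ≠ 0 := by
  intro h
  have := mul_ne_of_ne hw (Nat.succ_le_of_lt hi)
  rw [Nat.succ_eq_add_one, mul_add', mul_one', h, zero_pow (by omega), mul_zero, mul_zero] at this
  exact this rfl

lemma mul_succ' (d n : ℕ) (lam z : ℂ) :
    mul d (n + 1) lam z = mul d n lam z * (d * ((fc d lam)^[n] z) ^ (d - 1)) := by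
  rw [mul_add', mul_one']

lemma beta_succ {d n : ℕ} (hd : 2 ≤ d) {lam z : ℂ} (hw : mul d n lam z ≠ 0) {i : ℕ} (hi : i < n) :
    beta d lam n z (i + 1) = (beta d lam n z i - (d - 1) / (fc d lam)^[i] z) /
      (d * ((fc d lam)^[i] z) ^ (d - 1)) := by
  have h1 := mul_ne_of_ne hw hi.le
  have h2 := mul_ne_of_ne hw (Nat.succ_le_of_lt hi)
  have h4 := iter_ne_of_ne hd hw hi
  rw [Nat.succ_eq_add_one, mul_succ'] at h2
  have h3 := right_ne_zero_of_mul h2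
  unfold beta
  rw [Finset.sum_range_succ, mul_succ']
  generalize (∑ j ∈ Finset.range n, ((d - 1) / (fc d lam)^[j] z) * mul d j lam z) / (1 - mul d n lam z) = G
  generalize ∑ j ∈ Finset.range i, ((d - 1) / (fc d lam)^[j] z) * mul d j lam z = S
  generalize (d : ℂ) * ((fc d lam)^[i] z) ^ (d - 1) = D at *
  field_simp
  ring

lemma beta_per {d n : ℕ} {lam z : ℂ} (hw : mul d n lam z ≠ 0) (hw1 : mul d n lam z ≠ 1) :
    beta d lam n z n = beta d lam n z 0 := by
  unfold beta
  have : 1 - mul d n lam z ≠ 0 := sub_ne_zero.2 hw1.symm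
  simp only [Finset.range_zero, Finset.sum_empty, mul_zero']
  field_simp
  ring

lemma sum_shift {n : ℕ} (g : ℕ → ℂ) (h : g n = g 0) :
    ∑ i ∈ Finset.range n, g (i + 1) = ∑ i ∈ Finset.range n, g i := by
  have e2 := Finset.sum_range_succ' g n
  rw [Finset.sum_range_succ, h] at e2
  exact (add_right_cancel e2).symm

lemma Acyc_id {d n : ℕ} (hd : 2 ≤ d) {lam z : ℂ} (hz : (fc d lam)^[n] z = z)
    (hw : mul d n lam z ≠ 0) (hw1 : mul d n lam z ≠ 1) {y : ℂ} (hy : y ≠ 0)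
    (hfy : ∀ i, fc d lam y ≠ (fc d lam)^[i] z) :
    ∑ j ∈ Finset.range d, (om d ^ j) ^ 2 * Acyc d lam n z (beta d lam n z) (om d ^ j * y) =
      ((d : ℂ) * y ^ (d - 1)) ^ 2 * (Acyc d lam n z (beta d lam n z) (fc d lam y) -
        (∑ i ∈ Finset.range n, beta d lam n z i) * (1 / (fc d lam y - lam))) := by
  unfold Acyc
  simp only [Finset.mul_sum]
  rw [Finset.sum_comm]
  have h1 : ∀ i ∈ Finset.range n, ∑ j ∈ Finset.range d, (om d ^ j) ^ 2 *
      (1 / (om d ^ j * y - (fc d lam)^[i] z) ^ 2 +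
        beta d lam n z i * (1 / (om d ^ j * y - (fc d lam)^[i] z))) =
      ((d : ℂ) * y ^ (d - 1)) ^ 2 * ((1 / (fc d lam y - (fc d lam)^[i + 1] z) ^ 2 +
        beta d lam n z (i + 1) * (1 / (fc d lam y - (fc d lam)^[i + 1] z))) -
        beta d lam n z (i + 1) * (1 / (fc d lam y - lam))) := by
    intro i hi
    have hi := Finset.mem_range.1 hi
    have ha := iter_ne_of_ne hd hw hi
    have hne : fc d lam y ≠ fc d lam ((fc d lam)^[i] z) := by
      have := hfy (i + 1); rwa [Function.iterate_succ_apply'] at this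
    have a1 := T1' hd lam hy ha hne
    have a2 := T2' hd lam hy ha hne
    simp only [mul_add, Finset.sum_add_distrib]
    rw [a2]
    have : ∀ j, (om d ^ j) ^ 2 * (beta d lam n z i * (1 / (om d ^ j * y - (fc d lam)^[i] z))) =
      beta d lam n z i * ((om d ^ j) ^ 2 * (1 / (om d ^ j * y - (fc d lam)^[i] z))) :=
      fun j => by ring
    simp only [this, ← Finset.mul_sum]
    rw [a1, beta_succ hd hw hi, Function.iterate_succ_apply']
    ring
  rw [Finset.sum_congr rfl h1, ← Finset.mul_sum, Finset.sum_sub_distrib]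
  rw [sum_shift (fun i => 1 / (fc d lam y - (fc d lam)^[i] z) ^ 2 +
        beta d lam n z i * (1 / (fc d lam y - (fc d lam)^[i] z))) (by
          simp only [beta_per hw hw1, hz, Function.iterate_zero, id]),
    sum_shift (fun i => beta d lam n z i * (1 / (fc d lam y - lam))) (by
          simp only [beta_per hw hw1]), Finset.sum_mul]

end S17

namespace S17

open MeasureTheory Real Polynomial Filter Topology

def Att (d n : ℕ) (lam z : ℂ) : Prop :=
  0 < n ∧ Function.minimalPeriod (fc d lam) z = n ∧ ‖mul d n lam z‖ < 1

lemma Att.per {d n : ℕ} {lam z : ℂ} (h : Att d n lam z) : (fc d lam)^[n] z = z := by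
  have := Function.isPeriodicPt_minimalPeriod (fc d lam) z
  rw [h.2.1] at this; exact this

noncomputable def Zc (d n : ℕ) (lam z : ℂ) : Finset ℂ :=
  (Finset.range n).image fun i => (fc d lam)^[i] z

lemma mem_Zc {d n : ℕ} {lam z : ℂ} (hn : 0 < n) (hz : (fc d lam)^[n] z = z) {x : ℂ} :
    x ∈ Zc d n lam z ↔ ∃ i, (fc d lam)^[i] z = x := by
  unfold Zc
  rw [Finset.mem_image]
  constructor
  · rintro ⟨i, _, h⟩; exact ⟨i, h⟩
  · rintro ⟨i, h⟩
    refine ⟨i % n, Finset.mem_range.2 (Nat.mod_lt _ hn), ?_⟩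
    rw [← h]
    exact (show Function.IsPeriodicPt (fc d lam) n z from hz).iterate_mod_apply i

lemma Acyc_meas (d n : ℕ) (lam z : ℂ) (β : ℕ → ℂ) : Measurable (Acyc d lam n z β) := by
  unfold Acyc
  fun_prop

lemma Acyc_cont {d n : ℕ} {lam z : ℂ} {β : ℕ → ℂ} {x : ℂ} (hx : ∀ i, (fc d lam)^[i] z ≠ x) :
    ContinuousAt (Acyc d lam n z β) x := by
  unfold Acyc
  have h : ∀ i, x - (fc d lam)^[i] z ≠ 0 := fun i => sub_ne_zero.2 (hx i).symm
  refine tendsto_finset_sum _ fun i _ => ?_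
  have h1 : ContinuousAt (fun x => x - (fc d lam)^[i] z) x := by fun_prop
  refine ContinuousAt.add (ContinuousAt.div continuousAt_const (h1.pow 2) (pow_ne_zero 2 (h i)))
    (continuousAt_const.mul (ContinuousAt.div continuousAt_const h1 (h i)))

lemma Acyc_lim {d n : ℕ} {lam z : ℂ} {β : ℕ → ℂ} (a : ℂ) :
    Tendsto (fun x => (x - a) ^ 2 * Acyc d lam n z β x) (𝓝[≠] a)
      (𝓝 (∑ i ∈ Finset.range n, if (fc d lam)^[i] z = a then 1 else 0)) := by
  unfold Acyc
  simp only [Finset.mul_sum]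
  refine tendsto_finset_sum _ fun i _ => ?_
  split_ifs with h
  · rw [h]
    have h1 : Tendsto (fun x => 1 + β i * (x - a)) (𝓝[≠] a) (𝓝 (1 + β i * (a - a))) := by
      apply Tendsto.mono_left _ nhdsWithin_le_nhds
      apply Continuous.tendsto
      fun_prop
    rw [sub_self, mul_zero, add_zero] at h1
    refine h1.congr' ?_
    filter_upwards [self_mem_nhdsWithin] with x hx
    have : x - a ≠ 0 := sub_ne_zero.2 hx
    field_simp
  · have h0 : a - (fc d lam)^[i] z ≠ 0 := sub_ne_zero.2 (Ne.symm h)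
    have h1 : ContinuousAt (fun x => x - (fc d lam)^[i] z) a := by fun_prop
    have h2 : ContinuousAt (fun x => (x - a) ^ 2 * (1 / (x - (fc d lam)^[i] z) ^ 2 +
        β i * (1 / (x - (fc d lam)^[i] z)))) a := by
      refine ContinuousAt.mul (by fun_prop) ?_
      exact ContinuousAt.add (ContinuousAt.div continuousAt_const (h1.pow 2) (pow_ne_zero 2 h0))
        (continuousAt_const.mul (ContinuousAt.div continuousAt_const h1 h0))
    have h3 := h2.tendsto
    rw [sub_self, zero_pow (by norm_num), zero_mul] at h3
    exact h3.mono_left nhdsWithin_le_nhds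

lemma blowup {q : ℂ → ℂ} {a c : ℂ} (hc : c ≠ 0)
    (h : Tendsto (fun x => (x - a) ^ 2 * q x) (𝓝[≠] a) (𝓝 c)) :
    Tendsto (fun x => ‖q x‖) (𝓝[≠] a) atTop := by
  have h1 : Tendsto (fun x => ‖(x - a) ^ 2‖⁻¹) (𝓝[≠] a) atTop := by
    apply Tendsto.inv_tendsto_nhdsGT_zero
    rw [tendsto_nhdsWithin_iff]
    constructor
    · have : Tendsto (fun x => ‖(x - a) ^ 2‖) (𝓝 a) (𝓝 ‖(a - a) ^ 2‖) :=
        Continuous.tendsto (by fun_prop) a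
      simp only [sub_self, ne_eq, OfNat.ofNat_ne_zero, not_false_eq_true, zero_pow, norm_zero] at this
      exact this.mono_left nhdsWithin_le_nhds
    · filter_upwards [self_mem_nhdsWithin] with x hx
      have : x - a ≠ 0 := sub_ne_zero.2 hx
      exact norm_pos_iff.2 (pow_ne_zero 2 this)
  have h2 := h.norm.pos_mul_atTop (norm_pos_iff.2 hc) h1
  refine h2.congr' ?_
  filter_upwards [self_mem_nhdsWithin] with x hx
  have : x - a ≠ 0 := sub_ne_zero.2 hx
  have : ‖(x - a) ^ 2‖ ≠ 0 := norm_ne_zero_iff.2 (pow_ne_zero 2 this)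
  rw [norm_mul]
  field_simp

lemma Att.count {d n : ℕ} {lam z : ℂ} (h : Att d n lam z) :
    (∑ i ∈ Finset.range n, if (fc d lam)^[i] z = z then (1 : ℂ) else 0) = 1 := by
  rw [Finset.sum_eq_single 0]
  · simp
  · intro i hi h0
    rw [if_neg]
    intro h1
    have : Function.IsPeriodicPt (fc d lam) i z := h1
    have := this.minimalPeriod_le (Nat.pos_of_ne_zero h0)
    rw [h.2.1] at this
    exact absurd (Finset.mem_range.1 hi) (not_lt.2 this)
  · intro h0; exact absurd (Finset.mem_range.2 h.1) h0

lemma Att.ne_one {d n : ℕ} {lam z : ℂ} (h : Att d n lam z) : mul d n lam z ≠ 1 := by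
  intro h1; have := h.2.2; rw [h1] at this; simp at this

lemma Att.orbit {d n : ℕ} {lam z : ℂ} (h : Att d n lam z) (i : ℕ) :
    Att d n lam ((fc d lam)^[i] z) := by
  refine ⟨h.1, ?_, ?_⟩
  · rw [Function.minimalPeriod_apply_iterate, h.2.1]
    rw [Function.mem_periodicPts]
    exact ⟨n, h.1, h.per⟩
  · rw [mul_shift_iter _ _ _ _ _ h.per]; exact h.2.2

lemma Att.beta_sum_ne {d n : ℕ} (hd : 2 ≤ d) {lam z : ℂ} (h : Att d n lam z)
    (hw : mul d n lam z ≠ 0) : ∑ i ∈ Finset.range n, beta d lam n z i ≠ 0 := by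
  intro h0
  refine contraction hd lam (Zc d n lam z) ?_ n h.1 ?_ (Acyc d lam n z (beta d lam n z))
    (Acyc_meas _ _ _ _ _) ?_ ?_ z ?_ ?_
  · intro a ha
    rw [mem_Zc h.1 h.per] at ha ⊢
    obtain ⟨i, rfl⟩ := ha
    exact ⟨i + 1, Function.iterate_succ_apply' _ _ _⟩
  · intro a ha
    rw [mem_Zc h.1 h.per] at ha
    obtain ⟨i, rfl⟩ := ha
    exact (h.orbit i).2.2
  · intro x hx
    rw [mem_Zc h.1 h.per, not_exists] at hx
    exact Acyc_cont hx
  · intro y hy hfy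
    rw [mem_Zc h.1 h.per, not_exists] at hfy
    rw [Acyc_id hd h.per hw h.ne_one hy (fun i => Ne.symm (hfy i)), h0, zero_mul, sub_zero]
  · rw [mem_Zc h.1 h.per]; exact ⟨0, rfl⟩
  · apply blowup one_ne_zero
    rw [← h.count]
    exact Acyc_lim z

lemma Att.unique_nz {d n1 n2 : ℕ} (hd : 2 ≤ d) {lam z1 z2 : ℂ} (h1 : Att d n1 lam z1)
    (h2 : Att d n2 lam z2) (hw1 : mul d n1 lam z1 ≠ 0) (hw2 : mul d n2 lam z2 ≠ 0) :
    ∃ i, (fc d lam)^[i] z2 = z1 := by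
  by_contra hcon
  push Not at hcon
  set B1 := ∑ i ∈ Finset.range n1, beta d lam n1 z1 i with hB1
  set B2 := ∑ i ∈ Finset.range n2, beta d lam n2 z2 i with hB2
  have hB2ne : B2 ≠ 0 := h2.beta_sum_ne hd hw2
  refine contraction hd lam (Zc d n1 lam z1 ∪ Zc d n2 lam z2) ?_ (n1 * n2)
    (Nat.mul_pos h1.1 h2.1) ?_
    (fun x => B2 * Acyc d lam n1 z1 (beta d lam n1 z1) x - B1 * Acyc d lam n2 z2 (beta d lam n2 z2) x)
    (((Acyc_meas _ _ _ _ _).const_mul _).sub ((Acyc_meas _ _ _ _ _).const_mul _)) ?_ ?_ z1 ?_ ?_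
  · intro a ha
    rw [Finset.mem_union, mem_Zc h1.1 h1.per, mem_Zc h2.1 h2.per] at ha ⊢
    rcases ha with ⟨i, rfl⟩ | ⟨i, rfl⟩
    · exact Or.inl ⟨i + 1, Function.iterate_succ_apply' _ _ _⟩
    · exact Or.inr ⟨i + 1, Function.iterate_succ_apply' _ _ _⟩
  · intro a ha
    rw [Finset.mem_union, mem_Zc h1.1 h1.per, mem_Zc h2.1 h2.per] at ha
    rcases ha with ⟨i, rfl⟩ | ⟨i, rfl⟩
    · rw [mul_mul_period _ _ _ _ _ (h1.orbit i).per, norm_pow]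
      exact pow_lt_one₀ (norm_nonneg _) (h1.orbit i).2.2 h2.1.ne'
    · rw [mul_comm n1 n2, mul_mul_period _ _ _ _ _ (h2.orbit i).per, norm_pow]
      exact pow_lt_one₀ (norm_nonneg _) (h2.orbit i).2.2 h1.1.ne'
  · intro x hx
    rw [Finset.mem_union, not_or, mem_Zc h1.1 h1.per, mem_Zc h2.1 h2.per, not_exists, not_exists] at hx
    exact (continuousAt_const.mul (Acyc_cont hx.1)).sub (continuousAt_const.mul (Acyc_cont hx.2))
  · intro y hy hfy
    rw [Finset.mem_union, not_or, mem_Zc h1.1 h1.per, mem_Zc h2.1 h2.per, not_exists, not_exists] at hfy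
    have e1 := Acyc_id hd h1.per hw1 h1.ne_one hy (fun i => Ne.symm (hfy.1 i))
    have e2 := Acyc_id hd h2.per hw2 h2.ne_one hy (fun i => Ne.symm (hfy.2 i))
    rw [← hB1] at e1
    rw [← hB2] at e2
    have e3 : ∀ j, (om d ^ j) ^ 2 * (B2 * Acyc d lam n1 z1 (beta d lam n1 z1) (om d ^ j * y) -
        B1 * Acyc d lam n2 z2 (beta d lam n2 z2) (om d ^ j * y)) =
        B2 * ((om d ^ j) ^ 2 * Acyc d lam n1 z1 (beta d lam n1 z1) (om d ^ j * y)) -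
        B1 * ((om d ^ j) ^ 2 * Acyc d lam n2 z2 (beta d lam n2 z2) (om d ^ j * y)) := fun j => by ring
    simp only [e3]
    rw [Finset.sum_sub_distrib, ← Finset.mul_sum, ← Finset.mul_sum, e1, e2]
    ring
  · rw [Finset.mem_union, mem_Zc h1.1 h1.per]; exact Or.inl ⟨0, rfl⟩
  · apply blowup hB2ne
    have l1 := Acyc_lim (d := d) (n := n1) (lam := lam) (z := z1) (β := beta d lam n1 z1) z1
    have l2 := Acyc_lim (d := d) (n := n2) (lam := lam) (z := z2) (β := beta d lam n2 z2) z1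
    rw [h1.count] at l1
    rw [Finset.sum_eq_zero (fun i _ => if_neg (hcon i))] at l2
    have := (l1.const_mul B2).sub (l2.const_mul B1)
    rw [mul_one, mul_zero, sub_zero] at this
    refine this.congr fun x => ?_
    ring

end S17

namespace S17

open MeasureTheory Real Polynomial Filter Topology

noncomputable def FpZ (d : ℕ) : ℕ → ℤ[X]
  | 0 => 0
  | n + 1 => FpZ d n ^ d + X

lemma FpZ_eval (d n : ℕ) (l : ℂ) : aeval l (FpZ d n) = (fc d l)^[n] 0 := by
  induction n with
  | zero => simp [FpZ]
  | succ n ih => rw [Function.iterate_succ_apply', FpZ, map_add, map_pow, ih, aeval_X]; rfl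

lemma FpZ_monic {d : ℕ} (hd : 2 ≤ d) (n : ℕ) :
    (FpZ d (n + 1)).Monic ∧ (FpZ d (n + 1)).natDegree = d ^ n := by
  induction n with
  | zero => simp [FpZ, zero_pow (show d ≠ 0 by omega), monic_X]
  | succ n ih =>
    rw [FpZ]
    have h1 : (FpZ d (n + 1) ^ d).Monic := ih.1.pow d
    have h2 : (FpZ d (n + 1) ^ d).natDegree = d ^ (n + 1) := by
      rw [ih.1.natDegree_pow, ih.2, pow_succ, mul_comm]
    have h3 : (X : ℤ[X]).degree < (FpZ d (n + 1) ^ d).degree := by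
      rw [degree_X, degree_eq_natDegree h1.ne_zero, h2]
      have : 1 < d ^ (n + 1) := Nat.one_lt_pow (by omega) (by omega)
      exact_mod_cast this
    refine ⟨h1.add_of_left h3, ?_⟩
    rw [natDegree_add_eq_left_of_degree_lt h3, h2]

lemma F_ne_eventually {d : ℕ} (hd : 2 ≤ d) {n : ℕ} (hn : 0 < n) (l0 : ℂ) :
    ∀ᶠ l in 𝓝[≠] l0, (fc d l)^[n] 0 ≠ 0 := by
  obtain ⟨m, rfl⟩ : ∃ m, n = m + 1 := ⟨n - 1, by omega⟩
  have hne : (FpZ d (m + 1)).map (algebraMap ℤ ℂ) ≠ 0 := ((FpZ_monic hd m).1.map _).ne_zero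
  have hfin := ((FpZ d (m + 1)).map (algebraMap ℤ ℂ)).roots.toFinset.finite_toSet
  have h1 := (hfin.subset (Set.diff_subset (t := {l0}))).isClosed.isOpen_compl.mem_nhds
    (x := l0) (by simp)
  filter_upwards [nhdsWithin_le_nhds h1, self_mem_nhdsWithin] with l hl hl0 h0
  apply hl
  refine ⟨?_, hl0⟩
  simp only [Finset.mem_coe, Multiset.mem_toFinset]
  rw [mem_roots hne, IsRoot, eval_map_algebraMap, FpZ_eval, h0]

/-- derivative recursion of `F_n` -/
noncomputable def dF (d : ℕ) (l : ℂ) : ℕ → ℂ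
  | 0 => 0
  | n + 1 => d * ((fc d l)^[n] 0) ^ (d - 1) * dF d l n + 1

lemma F_hasDerivAt (d n : ℕ) (l : ℂ) : HasDerivAt (fun l => (fc d l)^[n] 0) (dF d l n) l := by
  induction n with
  | zero => simpa [dF] using hasDerivAt_const l (0 : ℂ)
  | succ n ih =>
    simp only [Function.iterate_succ_apply']
    unfold fc at ih ⊢
    exact (ih.pow d).add (hasDerivAt_id l)

lemma not_integral_inv {d : ℕ} (hd : 2 ≤ d) : ¬ IsIntegral ℤ (-(1 / d) : ℂ) := by
  intro h
  have h2 : IsIntegral ℤ ((1 / d : ℚ)) := by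
    have h3 : (algebraMap ℚ ℂ) (1 / d) = -(-(1 / d)) := by simp
    have := h.neg
    rw [← h3] at this
    exact (isIntegral_algebraMap_iff (algebraMap ℚ ℂ).injective).1 this
  obtain ⟨k, hk⟩ := IsIntegrallyClosed.isIntegral_iff.1 h2
  have hd0 : (d : ℚ) ≠ 0 := by exact_mod_cast (by omega : d ≠ 0)
  rw [eq_div_iff hd0] at hk
  have : k * (d : ℤ) = 1 := by
    have h5 : ((k : ℚ)) * d = 1 := by simpa using hk
    exact_mod_cast h5
  have h6 : (d : ℤ) ∣ 1 := ⟨k, by linarith⟩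
  have h7 := Int.le_of_dvd one_pos h6
  omega

lemma gleason {d : ℕ} (hd : 2 ≤ d) {n : ℕ} (hn : 0 < n) {l : ℂ} (h : (fc d l)^[n] 0 = 0) :
    dF d l n ≠ 0 := by
  intro h0
  obtain ⟨m, rfl⟩ : ∃ m, n = m + 1 := ⟨n - 1, by omega⟩
  have hl : IsIntegral ℤ l := ⟨FpZ d (m + 1), (FpZ_monic hd m).1, by
    have := FpZ_eval d (m + 1) l
    rw [aeval_def] at this; rw [this, h]⟩
  have hF : ∀ k, IsIntegral ℤ ((fc d l)^[k] 0) := by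
    intro k
    induction k with
    | zero => exact isIntegral_zero
    | succ k ih => rw [Function.iterate_succ_apply']; exact (ih.pow d).add hl
  have hD : ∀ k, IsIntegral ℤ (dF d l k) := by
    intro k
    induction k with
    | zero => exact isIntegral_zero
    | succ k ih =>
      refine IsIntegral.add (IsIntegral.mul (IsIntegral.mul ?_ ((hF k).pow _)) ih) isIntegral_one
      exact_mod_cast isIntegral_algebraMap (R := ℤ) (A := ℂ) (x := (d : ℤ))
  have h1 : ((fc d l)^[m] 0) ^ (d - 1) * dF d l m = -(1 / d) := by
    have hd0 : (d : ℂ) ≠ 0 := by exact_mod_cast (by omega : d ≠ 0)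
    rw [dF] at h0
    field_simp
    linear_combination h0
  exact not_integral_inv hd (h1 ▸ ((hF m).pow _).mul (hD m))

lemma ift {d n : ℕ} {l0 z : ℂ} (hz : (fc d l0)^[n] z = z) (hw : mul d n l0 z ≠ 1) :
    ∃ ψ : ℂ → ℂ, ψ l0 = z ∧ (∀ᶠ l in 𝓝 l0, DifferentiableAt ℂ ψ l) ∧
      (∀ᶠ l in 𝓝 l0, (fc d l)^[n] (ψ l) = ψ l) ∧
      (∀ᶠ v in 𝓝 (l0, z), (fc d v.1)^[n] v.2 = v.2 → v.2 = ψ v.1) := by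
  set G : ℂ × ℂ → ℂ := fun p => (fc d p.1)^[n] p.2 - p.2 with hG
  have hc : ContDiff ℂ ⊤ G := (contDiff_iter d n).sub contDiff_snd
  have hca : ContDiffAt ℂ ⊤ G (l0, z) := hc.contDiffAt
  have hG0 : G (l0, z) = 0 := by simp [hG, hz]
  have hinv : (fderiv ℂ G (l0, z) ∘L .inr ℂ ℂ ℂ).IsInvertible := by
    have hd1 : HasDerivAt (fun y => G (l0, y)) (mul d n l0 z - 1) z :=
      (iter_hasDerivAt d n l0 z).sub (hasDerivAt_id z)
    have hd2 : HasFDerivAt (fun y => G (l0, y)) (fderiv ℂ G (l0, z) ∘L .inr ℂ ℂ ℂ) z := by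
      have := (hca.differentiableAt (by simp)).hasFDerivAt
      exact this.comp z (hasFDerivAt_prodMk_right l0 z)
    have := hd2.unique hd1.hasFDerivAt
    rw [this]
    refine ⟨ContinuousLinearEquiv.unitsEquivAut ℂ (Units.mk0 _ (sub_ne_zero.2 hw)), ?_⟩
    ext
    simp
  refine ⟨hca.implicitFunction (by simp) hinv, hca.implicitFunction_apply_self _ _, ?_, ?_, ?_⟩
  · have h1 := (hca.contDiffAt_implicitFunction (by simp) hinv).eventually (by simp)
    filter_upwards [h1] with l hl using hl.differentiableAt (by simp)
  · filter_upwards [hca.eventually_apply_implicitFunction (by simp) hinv] with l hl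
    rw [hG0] at hl
    exact sub_eq_zero.1 hl
  · filter_upwards [hca.eventually_apply_eq_iff_implicitFunction (by simp) hinv] with v hv hv2
    rw [hG0] at hv
    exact (hv.1 (sub_eq_zero.2 hv2)).symm

lemma minPer_iff {f : ℂ → ℂ} {n : ℕ} (hn : 0 < n) {z : ℂ} :
    Function.minimalPeriod f z = n ↔ f^[n] z = z ∧ ∀ k, 0 < k → k < n → f^[k] z ≠ z := by
  constructor
  · intro h
    have h1 := Function.isPeriodicPt_minimalPeriod f z
    rw [h] at h1
    refine ⟨h1, fun k hk hkn hk2 => ?_⟩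
    have := Function.IsPeriodicPt.minimalPeriod_le hk (show Function.IsPeriodicPt f k z from hk2)
    omega
  · rintro ⟨h1, h2⟩
    have hle := Function.IsPeriodicPt.minimalPeriod_le hn (show Function.IsPeriodicPt f n z from h1)
    have hpos := Function.IsPeriodicPt.minimalPeriod_pos hn (show Function.IsPeriodicPt f n z from h1)
    by_contra hne
    exact h2 _ hpos (by omega) (Function.isPeriodicPt_minimalPeriod f z)

lemma Att.persist {d n : ℕ} {l0 z : ℂ} (h : Att d n l0 z) :
    ∃ ψ : ℂ → ℂ, ψ l0 = z ∧ (∀ᶠ l in 𝓝 l0, DifferentiableAt ℂ ψ l) ∧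
      (∀ᶠ l in 𝓝 l0, Att d n l (ψ l)) ∧
      (∀ᶠ v in 𝓝 (l0, z), (fc d v.1)^[n] v.2 = v.2 → v.2 = ψ v.1) := by
  obtain ⟨ψ, h1, h2, h3, h4⟩ := ift h.per h.ne_one
  refine ⟨ψ, h1, h2, ?_, h4⟩
  have hc : ContinuousAt (fun l => (l, ψ l)) l0 :=
    continuousAt_id.prodMk h2.self_of_nhds.continuousAt
  have hm := (minPer_iff h.1).1 h.2.1
  have e1 : ∀ᶠ l in 𝓝 l0, ∀ k ∈ Finset.range n, 0 < k → (fc d l)^[k] (ψ l) ≠ ψ l := by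
    rw [Finset.eventually_all]
    intro k hk
    by_cases hk0 : 0 < k
    · have c1 : ContinuousAt (fun l => (fc d l)^[k] (ψ l) - ψ l) l0 :=
        (ContinuousAt.comp (f := fun l => (l, ψ l)) (g := fun p : ℂ × ℂ => (fc d p.1)^[k] p.2)
          (continuous_iter d k).continuousAt hc).sub h2.self_of_nhds.continuousAt
      have := c1.eventually_ne (y := 0)
        (by rw [h1]; exact sub_ne_zero.2 (hm.2 k hk0 (Finset.mem_range.1 hk)))
      filter_upwards [this] with l hl _ using sub_ne_zero.1 hl
    · exact Eventually.of_forall fun _ h => absurd h hk0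
  have e2 : ∀ᶠ l in 𝓝 l0, ‖mul d n l (ψ l)‖ < 1 := by
    have c1 : ContinuousAt (fun l => ‖mul d n l (ψ l)‖) l0 :=
      (ContinuousAt.comp (f := fun l => (l, ψ l)) (g := fun p : ℂ × ℂ => mul d n p.1 p.2)
          (continuous_mul' d n).continuousAt hc).norm
    exact c1.eventually_lt_const (by simp only [h1]; exact h.2.2)
  filter_upwards [e1, e2, h3] with l a1 a2 a3
  exact ⟨h.1, (minPer_iff h.1).2 ⟨a3, fun k hk hkn => a1 k (Finset.mem_range.2 hkn) hk⟩, a2⟩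

lemma mul_eq_zero_F {d n : ℕ} {l z : ℂ} (hz : (fc d l)^[n] z = z) (h : mul d n l z = 0)
    (hd : 2 ≤ d) : (fc d l)^[n] 0 = 0 ∧ ∃ i, i < n ∧ (fc d l)^[i] z = 0 := by
  unfold mul at h
  rw [Finset.prod_eq_zero_iff] at h
  obtain ⟨i, hi, h⟩ := h
  have hd0 : (d : ℂ) ≠ 0 := by exact_mod_cast (by omega : d ≠ 0)
  have h2 : (fc d l)^[i] z = 0 := by
    rcases mul_eq_zero.1 h with h | h
    · exact absurd h hd0
    · exact pow_eq_zero_iff (by omega) |>.1 h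
  refine ⟨?_, i, Finset.mem_range.1 hi, h2⟩
  rw [← h2, ← Function.iterate_add_apply, add_comm, Function.iterate_add_apply, hz]

lemma Att.unique {d n1 n2 : ℕ} (hd : 2 ≤ d) {lam z1 z2 : ℂ} (h1 : Att d n1 lam z1)
    (h2 : Att d n2 lam z2) : ∃ i, (fc d lam)^[i] z2 = z1 := by
  obtain ⟨ψ1, a1, a2, a3, -⟩ := h1.persist
  obtain ⟨ψ2, b1, b2, b3, -⟩ := h2.persist
  have ev : ∀ᶠ l in 𝓝[≠] lam, ∃ i ∈ Finset.range n2, (fc d l)^[i] (ψ2 l) = ψ1 l := by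
    filter_upwards [nhdsWithin_le_nhds a3, nhdsWithin_le_nhds b3, F_ne_eventually hd h1.1 lam,
      F_ne_eventually hd h2.1 lam] with l c1 c2 c3 c4
    obtain ⟨i, hi⟩ := c1.unique_nz hd c2 (fun h => c3 (mul_eq_zero_F c1.per h hd).1)
      (fun h => c4 (mul_eq_zero_F c2.per h hd).1)
    have := (mem_Zc c2.1 c2.per).2 ⟨i, hi⟩
    simpa [Zc] using this
  by_contra hcon
  push Not at hcon
  have ev2 : ∀ᶠ l in 𝓝[≠] lam, ∀ i ∈ Finset.range n2, (fc d l)^[i] (ψ2 l) ≠ ψ1 l := by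
    rw [Finset.eventually_all]
    intro i _
    have hc : ContinuousAt (fun l => (l, ψ2 l)) lam :=
      continuousAt_id.prodMk b2.self_of_nhds.continuousAt
    have c1 : ContinuousAt (fun l => (fc d l)^[i] (ψ2 l) - ψ1 l) lam :=
        (ContinuousAt.comp (f := fun l => (l, ψ2 l)) (g := fun p : ℂ × ℂ => (fc d p.1)^[i] p.2)
          (continuous_iter d i).continuousAt hc).sub a2.self_of_nhds.continuousAt
    have := c1.eventually_ne (y := 0) (by rw [a1, b1]; exact sub_ne_zero.2 (hcon i))
    filter_upwards [nhdsWithin_le_nhds this] with l hl using sub_ne_zero.1 hl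
  obtain ⟨l, ⟨i, hi, he⟩, h'⟩ := (ev.and ev2).exists
  exact h' i hi he

lemma Att.unique_period {d n1 n2 : ℕ} (hd : 2 ≤ d) {lam z1 z2 : ℂ} (h1 : Att d n1 lam z1)
    (h2 : Att d n2 lam z2) : n1 = n2 := by
  obtain ⟨i, hi⟩ := h1.unique hd h2
  have := (h2.orbit i).2.1
  rw [hi, h1.2.1] at this
  exact this

end S17

namespace S17

open MeasureTheory Real Polynomial Filter Topology

def U (d n : ℕ) : Set ℂ := {l | ∃ z, Att d n l z}

noncomputable def kap (d n : ℕ) : ℝ := (d : ℝ) ^ ((n : ℝ) / (d - 1))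

noncomputable def cprod (d n : ℕ) (l z : ℂ) : ℂ := ∏ j ∈ Finset.range n, (fc d l)^[j] z

open Classical in
noncomputable def S (d n : ℕ) (l : ℂ) : ℂ :=
  if h : ∃ z, Att d n l z then (kap d n : ℂ) * cprod d n l h.choose else 0

lemma kap_pos {d : ℕ} (hd : 2 ≤ d) (n : ℕ) : 0 < kap d n := by
  unfold kap; have : 0 < (d : ℝ) := by exact_mod_cast (by omega : 0 < d)
  positivity

lemma kap_pow {d : ℕ} (hd : 2 ≤ d) (n : ℕ) : kap d n ^ (d - 1) = (d : ℝ) ^ n := by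
  unfold kap
  have h0 : (0 : ℝ) ≤ d := by positivity
  have h1 : ((d - 1 : ℕ) : ℝ) = d - 1 := by rw [Nat.cast_sub (by omega)]; simp
  have h2 : (d : ℝ) - 1 ≠ 0 := by
    have : (2 : ℝ) ≤ d := by exact_mod_cast hd
    linarith
  rw [← Real.rpow_natCast, ← Real.rpow_mul h0, h1, div_mul_cancel₀ _ h2, Real.rpow_natCast]

lemma cprod_shift {d n : ℕ} {l z : ℂ} (hn : 0 < n) (hz : (fc d l)^[n] z = z) :
    cprod d n l (fc d l z) = cprod d n l z := by
  unfold cprod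
  obtain ⟨m, rfl⟩ : ∃ m, n = m + 1 := ⟨n - 1, by omega⟩
  rw [Finset.prod_range_succ, Finset.prod_range_succ']
  simp only [← Function.iterate_succ_apply, Nat.succ_eq_add_one, hz, Function.iterate_zero, id]

lemma cprod_shift_iter {d n : ℕ} {l z : ℂ} (h : Att d n l z) (i : ℕ) :
    cprod d n l ((fc d l)^[i] z) = cprod d n l z := by
  induction i with
  | zero => rfl
  | succ i ih => rw [Function.iterate_succ_apply', cprod_shift h.1 (h.orbit i).per, ih]

lemma S_eq {d n : ℕ} (hd : 2 ≤ d) {l z : ℂ} (h : Att d n l z) :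
    S d n l = kap d n * cprod d n l z := by
  have he : ∃ z, Att d n l z := ⟨z, h⟩
  unfold S
  rw [dif_pos he]
  obtain ⟨i, hi⟩ := he.choose_spec.unique hd h
  rw [← hi, cprod_shift_iter h]

lemma mul_eq_cprod (d n : ℕ) (l z : ℂ) : mul d n l z = d ^ n * cprod d n l z ^ (d - 1) := by
  unfold mul cprod
  rw [Finset.prod_mul_distrib, Finset.prod_const, Finset.card_range, Finset.prod_pow]

lemma S_norm {d n : ℕ} (hd : 2 ≤ d) {l z : ℂ} (h : Att d n l z) :
    ‖S d n l‖ ^ (d - 1) = ‖mul d n l z‖ := by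
  rw [S_eq hd h, mul_eq_cprod, norm_mul, mul_pow, Complex.norm_real, Real.norm_of_nonneg (kap_pos hd n).le,
    kap_pow hd, norm_mul, norm_pow, norm_pow]
  simp

lemma S_norm_lt {d n : ℕ} (hd : 2 ≤ d) {l : ℂ} (h : l ∈ U d n) : ‖S d n l‖ < 1 := by
  obtain ⟨z, hz⟩ := h
  have := hz.2.2
  rw [← S_norm hd hz] at this
  by_contra hc
  exact absurd this (not_lt.2 (one_le_pow₀ (not_lt.1 hc)))

lemma U_open (d n : ℕ) : IsOpen (U d n) := by
  rw [isOpen_iff_mem_nhds]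
  rintro l ⟨z, hz⟩
  obtain ⟨ψ, -, -, h, -⟩ := hz.persist
  filter_upwards [h] with l' hl' using ⟨_, hl'⟩

noncomputable def dz (d : ℕ) (l z : ℂ) (p : ℂ) : ℕ → ℂ
  | 0 => p
  | i + 1 => d * ((fc d l)^[i] z) ^ (d - 1) * dz d l z p i + 1

lemma dz_hasDerivAt {d : ℕ} {l : ℂ} {ψ : ℂ → ℂ} {p : ℂ} (h : HasDerivAt ψ p l) (i : ℕ) :
    HasDerivAt (fun l => (fc d l)^[i] (ψ l)) (dz d l (ψ l) p i) l := by
  induction i with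
  | zero => simpa [dz] using h
  | succ i ih =>
    simp only [Function.iterate_succ_apply']
    unfold fc at ih ⊢
    exact (ih.pow d).add (hasDerivAt_id l)

lemma dz_sum {d n : ℕ} (hd : 2 ≤ d) {l z p : ℂ} (hw : mul d n l z ≠ 0) (hw1 : mul d n l z ≠ 1)
    (hp : dz d l z p n = p) :
    ∑ i ∈ Finset.range n, ((d - 1) / (fc d l)^[i] z) * dz d l z p i =
      ∑ i ∈ Finset.range n, beta d l n z i := by
  have h1 : ∀ i ∈ Finset.range n, ((d - 1) / (fc d l)^[i] z) * dz d l z p i =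
      (beta d l n z i * dz d l z p i - beta d l n z (i + 1) * dz d l z p (i + 1)) +
        beta d l n z (i + 1) := by
    intro i hi
    have hi := Finset.mem_range.1 hi
    have hne : (d : ℂ) * ((fc d l)^[i] z) ^ (d - 1) ≠ 0 := by
      have := mul_ne_of_ne hw (Nat.succ_le_of_lt hi)
      rw [Nat.succ_eq_add_one, mul_succ'] at this
      exact right_ne_zero_of_mul this
    have hb := beta_succ hd hw hi
    rw [eq_div_iff hne] at hb
    rw [dz]
    linear_combination dz d l z p i * hb
  rw [Finset.sum_congr rfl h1, Finset.sum_add_distrib, Finset.sum_range_sub', sum_shift]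
  · rw [beta_per hw hw1, hp, dz]; ring
  · exact beta_per hw hw1

lemma dz_zero (d : ℕ) (l p : ℂ) (hd : 2 ≤ d) (i : ℕ) : dz d l 0 p (i + 1) = dF d l (i + 1) := by
  induction i with
  | zero => simp [dz, dF, zero_pow (show d - 1 ≠ 0 by omega)]
  | succ i ih => rw [dz, ih]; rfl

lemma S_deriv {d n : ℕ} (hd : 2 ≤ d) {l0 : ℂ} (h : l0 ∈ U d n) :
    ∃ s' : ℂ, s' ≠ 0 ∧ HasDerivAt (S d n) s' l0 := by
  obtain ⟨z0, hz0⟩ := h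
  obtain ⟨z, hz, hcase⟩ : ∃ z, Att d n l0 z ∧ (mul d n l0 z ≠ 0 ∨ z = 0) := by
    by_cases hm : mul d n l0 z0 = 0
    · obtain ⟨-, i, -, hi⟩ := mul_eq_zero_F hz0.per hm hd
      refine ⟨_, hz0.orbit i, Or.inr hi⟩
    · exact ⟨z0, hz0, Or.inl hm⟩
  clear hz0
  obtain ⟨ψ, h1, h2, h3, -⟩ := hz.persist
  obtain ⟨p, hp⟩ : ∃ p, HasDerivAt ψ p l0 := ⟨_, h2.self_of_nhds.hasDerivAt⟩
  have hdn : dz d l0 z p n = p := by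
    have := dz_hasDerivAt (d := d) hp n
    rw [h1] at this
    refine this.unique (hp.congr_of_eventuallyEq ?_)
    filter_upwards [h3] with l hl using hl.per
  have hk : (kap d n : ℂ) ≠ 0 := by exact_mod_cast (kap_pos hd n).ne'
  have hS : HasDerivAt (S d n) (kap d n * ∑ i ∈ Finset.range n,
      (∏ j ∈ (Finset.range n).erase i, (fc d l0)^[j] z) • dz d l0 z p i) l0 := by
    have hprod : HasDerivAt (fun l => kap d n * ∏ j ∈ Finset.range n, (fc d l)^[j] (ψ l))
      (kap d n * ∑ i ∈ Finset.range n,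
      (∏ j ∈ (Finset.range n).erase i, (fc d l0)^[j] (ψ l0)) • dz d l0 (ψ l0) p i) l0 :=
      (HasDerivAt.fun_finset_prod fun i _ => dz_hasDerivAt hp i).const_mul _
    rw [h1] at hprod
    refine hprod.congr_of_eventuallyEq ?_
    filter_upwards [h3] with l hl
    rw [S_eq hd hl, cprod]
  refine ⟨_, mul_ne_zero hk ?_, hS⟩
  rcases hcase with hm | hm
  · have hne : ∀ i ∈ Finset.range n, (fc d l0)^[i] z ≠ 0 := fun i hi =>
      iter_ne_of_ne hd hm (Finset.mem_range.1 hi)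
    have hd1 : (d : ℂ) - 1 ≠ 0 := by
      rw [sub_ne_zero]; exact_mod_cast (by omega : d ≠ 1)
    have e : ∑ i ∈ Finset.range n, (∏ j ∈ (Finset.range n).erase i, (fc d l0)^[j] z) • dz d l0 z p i =
        cprod d n l0 z / (d - 1) * ∑ i ∈ Finset.range n, beta d l0 n z i := by
      rw [← dz_sum hd hm hz.ne_one hdn, Finset.mul_sum]
      refine Finset.sum_congr rfl fun i hi => ?_
      have := hne i hi
      rw [cprod, ← Finset.mul_prod_erase _ _ hi, smul_eq_mul]
      field_simp
    rw [e]
    refine mul_ne_zero (div_ne_zero ?_ hd1) (hz.beta_sum_ne hd hm)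
    exact Finset.prod_ne_zero_iff.2 hne
  · subst hm
    obtain ⟨m, rfl⟩ : ∃ m, n = m + 1 := ⟨n - 1, by have := hz.1; omega⟩
    rw [Finset.sum_eq_single 0]
    · rw [smul_eq_mul]
      refine mul_ne_zero ?_ ?_
      · rw [Finset.prod_ne_zero_iff]
        intro i hi
        rw [Finset.mem_erase, Finset.mem_range] at hi
        exact ((minPer_iff hz.1).1 hz.2.1).2 i (Nat.pos_of_ne_zero hi.1) hi.2
      · rw [dz_zero _ _ _ hd] at hdn
        rw [dz, ← hdn]
        exact gleason hd hz.1 hz.per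
    · intro i hi hi0
      rw [Finset.prod_eq_zero (i := 0), zero_smul]
      · rw [Finset.mem_erase]; exact ⟨hi0.symm, Finset.mem_range.2 hz.1⟩
      · simp
    · intro h0; exact absurd (Finset.mem_range.2 hz.1) h0

end S17

namespace S17

open MeasureTheory Real Polynomial Filter Topology

lemma Att.bound {d n : ℕ} (hd : 2 ≤ d) {l z : ℂ} (h : Att d n l z) : ‖l‖ < 4 ∧ ‖z‖ ≤ 3 := by
  -- the maximal modulus on the cycle
  have hne : (Zc d n l z).Nonempty := ⟨z, (mem_Zc h.1 h.per).2 ⟨0, rfl⟩⟩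
  obtain ⟨x, hx, hmax⟩ := Finset.exists_max_image (Zc d n l z) (fun x => ‖x‖) hne
  have hcl : ∀ y ∈ Zc d n l z, fc d l y ∈ Zc d n l z := by
    intro a ha
    rw [mem_Zc h.1 h.per] at ha ⊢
    obtain ⟨i, rfl⟩ := ha
    exact ⟨i + 1, Function.iterate_succ_apply' _ _ _⟩
  set M := ‖x‖ with hM
  have hM0 : 0 ≤ M := norm_nonneg _
  have h1 : M ^ d ≤ ‖l‖ + M := by
    have e : x ^ d = fc d l x - l := by unfold fc; ring
    rw [hM, ← norm_pow, e]
    have := hmax _ (hcl x hx)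
    have := norm_sub_le (fc d l x) l
    linarith
  have hl : ‖l‖ < 4 := by
    by_contra hc
    push Not at hc
    have hM2 : M ≤ ‖l‖ - 1 := by
      by_contra hM2
      push Not at hM2
      have : M ^ 2 ≤ M ^ d := pow_le_pow_right₀ (by linarith) hd
      nlinarith
    have hge : ∀ y ∈ Zc d n l z, 1 ≤ ‖y‖ := by
      intro y hy
      have e : l = fc d l y - y ^ d := by unfold fc; ring
      have h2 := norm_sub_le (fc d l y) (y ^ d)
      rw [← e, norm_pow] at h2
      have h3 := hmax _ (hcl y hy)
      by_contra hlt
      have : ‖y‖ ^ d < 1 := pow_lt_one₀ (norm_nonneg _) (not_le.1 hlt) (by omega)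
      linarith
    have := h.2.2
    unfold mul at this
    rw [norm_prod] at this
    have h5 : 1 ≤ ∏ i ∈ Finset.range n, ‖(d : ℂ) * ((fc d l)^[i] z) ^ (d - 1)‖ := by
      rw [← Finset.prod_const_one (s := Finset.range n)]
      refine Finset.prod_le_prod (fun _ _ => zero_le_one) ?_
      intro i _
      rw [norm_mul, norm_pow]
      have a1 : 1 ≤ ‖(fc d l)^[i] z‖ ^ (d - 1) :=
        one_le_pow₀ (hge _ ((mem_Zc h.1 h.per).2 ⟨i, rfl⟩))
      have a2 : (1 : ℝ) ≤ ‖(d : ℂ)‖ := by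
        simp only [RCLike.norm_natCast]; exact_mod_cast (by omega : 1 ≤ d)
      nlinarith
    linarith
  refine ⟨hl, ?_⟩
  have hz := hmax z ((mem_Zc h.1 h.per).2 ⟨0, rfl⟩)
  by_contra hc
  push Not at hc
  have : M ^ 2 ≤ M ^ d := pow_le_pow_right₀ (by linarith) hd
  nlinarith

lemma att_of_per {d n : ℕ} (hn : 0 < n) {l z : ℂ} (h : (fc d l)^[n] z = z) (hm : ‖mul d n l z‖ < 1) :
    Att d (Function.minimalPeriod (fc d l) z) l z := by
  have hp : Function.IsPeriodicPt (fc d l) n z := h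
  have hpos := hp.minimalPeriod_pos hn
  refine ⟨hpos, rfl, ?_⟩
  obtain ⟨k, hk⟩ := hp.minimalPeriod_dvd
  rw [hk, mul_mul_period _ _ _ _ _ (Function.isPeriodicPt_minimalPeriod _ _), norm_pow] at hm
  by_contra hc
  exact absurd hm (not_lt.2 (one_le_pow₀ (not_lt.1 hc)))

lemma local_period {d n : ℕ} (hn : 0 < n) {l0 z : ℂ} (h : (fc d l0)^[n] z = z)
    (hm : ‖mul d n l0 z‖ < 1) :
    ∀ᶠ v in 𝓝 (l0, z), (fc d v.1)^[n] v.2 = v.2 →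
      Att d (Function.minimalPeriod (fc d l0) z) v.1 v.2 := by
  have hA := att_of_per hn h hm
  set k := Function.minimalPeriod (fc d l0) z with hk
  have hdvd : k ∣ n := Function.IsPeriodicPt.minimalPeriod_dvd h
  obtain ⟨ψ, a1, a2, a3, a4⟩ := hA.persist
  obtain ⟨φ, b1, b2, b3, b4⟩ := ift h (fun h1 => by rw [h1] at hm; simp at hm)
  -- φ and ψ agree near l0
  have hc : ContinuousAt (fun l => (l, ψ l)) l0 :=
    continuousAt_id.prodMk a2.self_of_nhds.continuousAt
  have hc' : Tendsto (fun l => (l, ψ l)) (𝓝 l0) (𝓝 (l0, z)) := by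
    have := hc.tendsto; rwa [a1] at this
  have e1 : ∀ᶠ l in 𝓝 l0, φ l = ψ l := by
    filter_upwards [hc'.eventually b4, a3] with l hl hl2
    symm
    apply hl
    obtain ⟨j, rfl⟩ := hdvd
    exact Function.IsPeriodicPt.mul_const (show Function.IsPeriodicPt (fc d l) k (ψ l) from hl2.per) j
  have hfst : Tendsto (fun v : ℂ × ℂ => v.1) (𝓝 (l0, z)) (𝓝 l0) := continuous_fst.tendsto _
  filter_upwards [b4, hfst.eventually e1, hfst.eventually a3] with v c1 c2 c3 hv
  rw [c1 hv, c2]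
  exact c3

lemma U_compact {d n : ℕ} (hd : 2 ≤ d) (hn : 0 < n) {t : ℝ} (ht0 : 0 ≤ t) (ht : t < 1) :
    IsCompact {l | l ∈ U d n ∧ ‖S d n l‖ ≤ t} := by
  set K : Set (ℂ × ℂ) := {v | Att d n v.1 v.2 ∧ ‖mul d n v.1 v.2‖ ≤ t ^ (d - 1)} with hK
  have htp : t ^ (d - 1) < 1 := pow_lt_one₀ ht0 ht (by omega)
  have hKc : IsClosed K := by
    rw [← isOpen_compl_iff, isOpen_iff_mem_nhds]
    rintro ⟨l, z⟩ hlz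
    by_cases h1 : (fc d l)^[n] z = z
    · by_cases h2 : ‖mul d n l z‖ ≤ t ^ (d - 1)
      · have hloc := local_period hn h1 (h2.trans_lt htp)
        have hne : Function.minimalPeriod (fc d l) z ≠ n := by
          intro h
          exact hlz ⟨⟨hn, h, h2.trans_lt htp⟩, h2⟩
        filter_upwards [hloc] with v hv hvK
        have := (hv hvK.1.per).2.1
        rw [hvK.1.2.1] at this
        exact hne this.symm
      · have : ∀ᶠ v in 𝓝 (l, z), t ^ (d - 1) < ‖mul d n v.1 v.2‖ :=
          (continuous_mul' d n).norm.continuousAt.eventually_const_lt (not_le.1 h2)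
        filter_upwards [this] with v hv hvK
        exact absurd hvK.2 (not_le.2 hv)
    · have : ∀ᶠ v in 𝓝 (l, z), (fc d v.1)^[n] v.2 - v.2 ≠ 0 :=
        ((continuous_iter d n).sub continuous_snd).continuousAt.eventually_ne (sub_ne_zero.2 h1)
      filter_upwards [this] with v hv hvK
      exact hv (sub_eq_zero.2 hvK.1.per)
  have hKcomp : IsCompact K := by
    refine ((isCompact_closedBall (0 : ℂ) 4).prod (isCompact_closedBall (0 : ℂ) 3)).of_isClosed_subset
      hKc ?_
    rintro ⟨l, z⟩ ⟨h, -⟩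
    have := h.bound hd
    simp only [Set.mem_prod, Metric.mem_closedBall, dist_zero_right]
    exact ⟨this.1.le, this.2⟩
  have hlt : ∀ {l z : ℂ}, Att d n l z → (‖S d n l‖ ≤ t ↔ ‖mul d n l z‖ ≤ t ^ (d - 1)) := by
    intro l z h
    rw [← S_norm hd h, pow_le_pow_iff_left₀ (norm_nonneg _) ht0 (by omega)]
  convert hKcomp.image continuous_fst using 1
  ext l
  constructor
  · rintro ⟨⟨z, hz⟩, h2⟩
    exact ⟨(l, z), ⟨hz, (hlt hz).1 h2⟩, rfl⟩
  · rintro ⟨⟨l', z⟩, ⟨hz, h2⟩, rfl⟩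
    exact ⟨⟨z, hz⟩, (hlt hz).2 h2⟩

lemma frontier_no_att {d n k : ℕ} (hd : 2 ≤ d) {l : ℂ} (h : l ∈ closure (U d n)) (h' : l ∉ U d n) :
    l ∉ U d k := by
  intro hk
  obtain ⟨l', h1, h2⟩ := mem_closure_iff.1 h _ (U_open d k) hk
  obtain ⟨z1, hz1⟩ := h1
  obtain ⟨z2, hz2⟩ := h2
  have := hz1.unique_period hd hz2
  subst this
  exact h' hk

lemma U_bdd {d n : ℕ} (hd : 2 ≤ d) : U d n ⊆ Metric.ball 0 4 := by
  rintro l ⟨z, hz⟩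
  simpa using (hz.bound hd).1

lemma U_F_zero {d k m : ℕ} (hd : 2 ≤ d) (hm : 0 < m) {l : ℂ} (hl : l ∈ U d k)
    (h : (fc d l)^[m] 0 = 0) : k ∣ m ∧ S d k l = 0 := by
  have h0 : mul d m l 0 = 0 := by
    obtain ⟨j, rfl⟩ : ∃ j, m = j + 1 := ⟨m - 1, by omega⟩
    rw [mul, Finset.prod_range_succ']
    simp [zero_pow (show d - 1 ≠ 0 by omega)]
  have hA := att_of_per hm h (by rw [h0]; simp)
  obtain ⟨z, hz⟩ := hl
  have := hz.unique_period hd hA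
  refine ⟨this ▸ Function.IsPeriodicPt.minimalPeriod_dvd h, ?_⟩
  rw [← this] at hA
  rw [S_eq hd hA, cprod, Finset.prod_eq_zero (Finset.mem_range.2 hz.1), mul_zero]
  rfl

lemma U_S_zero {d k m : ℕ} (hd : 2 ≤ d) {l : ℂ} (hl : l ∈ U d k) (hkm : k ∣ m)
    (h : S d k l = 0) : (fc d l)^[m] 0 = 0 := by
  obtain ⟨z, hz⟩ := hl
  have h1 : mul d k l z = 0 := by
    rw [← norm_eq_zero, ← S_norm hd hz, h, norm_zero, zero_pow (by omega)]
  have h2 := (mul_eq_zero_F hz.per h1 hd).1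
  obtain ⟨j, rfl⟩ := hkm
  exact Function.IsPeriodicPt.mul_const (show Function.IsPeriodicPt (fc d l) k 0 from h2) j

end S17

namespace S17

open MeasureTheory Real Polynomial Filter Topology

lemma circ_aux {h : ℂ → ℂ} {x : ℂ} {r : ℝ} (hr : 0 < r)
    (hh : DiffContOnCl ℂ h (Metric.ball x r)) :
    ENNReal.ofReal (2 * π) * ‖h x‖ₑ ≤ ∫⁻ θ in Set.Ioo (-π) π, ‖h (circleMap x r θ)‖ₑ := by
  have h1 : circleAverage h x r = h x := by
    apply DiffContOnCl.circleAverage; rwa [abs_of_pos hr]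
  have h2 : (∫ θ in (0:ℝ)..2 * π, h (circleMap x r θ)) = (2 * π : ℝ) • h x := by
    rw [← h1, circleAverage_def, smul_smul, mul_inv_cancel₀ (by positivity), one_smul]
  have h3 : (∫ θ in (-π)..π, h (circleMap x r θ)) = (2 * π : ℝ) • h x := by
    have hp : Function.Periodic (fun θ => h (circleMap x r θ)) (2 * π) :=
      fun θ => by simp only [periodic_circleMap x r θ]
    have := hp.intervalIntegral_add_eq (-π) 0
    rw [show -π + 2 * π = π by ring, zero_add, h2] at this
    exact this
  have h4 : (ENNReal.ofReal (2 * π)) * ‖h x‖ₑ = ‖(2 * π : ℝ) • h x‖ₑ := by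
    rw [enorm_smul, Real.enorm_of_nonneg (by positivity)]
  rw [h4, ← h3, intervalIntegral.integral_of_le (by linarith [pi_pos]), integral_Ioc_eq_integral_Ioo]
  exact enorm_integral_le_lintegral_enorm _

lemma polar_circle (x : ℂ) (p : ℝ × ℝ) : x + Complex.polarCoord.symm p = circleMap x p.1 p.2 := by
  rw [Complex.polarCoord_symm_apply, circleMap, Complex.exp_mul_I]
  push_cast; rfl

lemma submean {h : ℂ → ℂ} {x : ℂ} (hh : DifferentiableOn ℂ h (Metric.ball x (1/2))) :
    ENNReal.ofReal (π / 8) * ‖h x‖ₑ ≤ ∫⁻ y in Metric.ball x (1/2), ‖h y‖ₑ := by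
  have hm : Measurable ((Metric.ball x (1/2)).indicator (fun y => ‖h y‖ₑ)) := by
    have : ContinuousOn (fun y => ‖h y‖ₑ) (Metric.ball x (1/2)) := hh.continuousOn.enorm
    classical
    rw [← Set.piecewise_eq_indicator]
    exact this.measurable_piecewise continuousOn_const Metric.isOpen_ball.measurableSet
  set g := (Metric.ball x (1/2)).indicator (fun y => ‖h y‖ₑ) with hg
  rw [← lintegral_indicator Metric.isOpen_ball.measurableSet, ← hg,
    ← lintegral_add_left_eq_self g x, ← Complex.lintegral_comp_polarCoord_symm]
  have hmp : Measurable (fun p : ℝ × ℝ => ENNReal.ofReal p.1 • g (x + Complex.polarCoord.symm p)) := by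
    simp only [polar_circle, smul_eq_mul]
    refine Measurable.mul (by fun_prop) (hm.comp ?_)
    unfold circleMap
    fun_prop
  rw [show polarCoord.target = Set.Ioi (0:ℝ) ×ˢ Set.Ioo (-π) π from rfl, Measure.volume_eq_prod,
    setLIntegral_prod _ hmp.aemeasurable]
  calc ENNReal.ofReal (π / 8) * ‖h x‖ₑ
      = ∫⁻ r in Set.Ioo (1/4 : ℝ) (1/2), ENNReal.ofReal (1/4) * (ENNReal.ofReal (2 * π) * ‖h x‖ₑ) := by
        rw [lintegral_const, Measure.restrict_apply MeasurableSet.univ, Set.univ_inter,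
          Real.volume_Ioo, ← mul_assoc, mul_right_comm, ← ENNReal.ofReal_mul (by norm_num),
          ← ENNReal.ofReal_mul (by positivity)]
        congr 2; ring
    _ ≤ ∫⁻ r in Set.Ioo (1/4 : ℝ) (1/2), ∫⁻ θ in Set.Ioo (-π) π,
          ENNReal.ofReal r • g (x + Complex.polarCoord.symm (r, θ)) := by
        apply setLIntegral_mono' measurableSet_Ioo
        rintro r ⟨h1, h2⟩
        have hr : 0 < r := by linarith
        have e : ∀ θ : ℝ, g (x + Complex.polarCoord.symm (r, θ)) = ‖h (circleMap x r θ)‖ₑ := by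
          intro θ
          rw [polar_circle, hg, Set.indicator_of_mem]
          simp only [Metric.mem_ball, dist_eq_norm, circleMap_sub_center, norm_circleMap_zero]
          rwa [abs_of_pos hr]
        simp only [e, smul_eq_mul]
        rw [lintegral_const_mul' _ _ ENNReal.ofReal_ne_top]
        gcongr
        refine circ_aux hr (DifferentiableOn.diffContOnCl (hh.mono ?_))
        rw [closure_ball _ hr.ne']
        exact Metric.closedBall_subset_ball h2
    _ ≤ _ := by
        apply lintegral_mono_set
        intro r hr; exact lt_trans (by norm_num) hr.1

lemma log_int : ∫⁻ y in Metric.ball (0:ℂ) 1, ENNReal.ofReal (Real.log (1 / ‖y‖)) ≤ ENNReal.ofReal (2 * π) := by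
  rw [← lintegral_indicator Metric.isOpen_ball.measurableSet, ← Complex.lintegral_comp_polarCoord_symm]
  rw [show polarCoord.target = Set.Ioi (0:ℝ) ×ˢ Set.Ioo (-π) π from rfl]
  calc _ ≤ ∫⁻ p in Set.Ioi (0:ℝ) ×ˢ Set.Ioo (-π) π, (Set.Ioo (0:ℝ) 1 ×ˢ Set.Ioo (-π) π).indicator (fun _ => (1:ENNReal)) p := by
        apply setLIntegral_mono' (measurableSet_Ioi.prod measurableSet_Ioo)
        rintro ⟨r, θ⟩ ⟨hr, hθ⟩
        have hr' : 0 < r := hr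
        by_cases h1 : r < 1
        · rw [Set.indicator_of_mem, Set.indicator_of_mem]
          · have : ‖Complex.polarCoord.symm (r, θ)‖ = r := by
              rw [Complex.norm_polarCoord_symm]; exact abs_of_pos hr'
            rw [this, smul_eq_mul, ← ENNReal.ofReal_mul hr'.le, ← ENNReal.ofReal_one]
            apply ENNReal.ofReal_le_ofReal
            have := Real.log_le_sub_one_of_pos (show 0 < 1 / r by positivity)
            calc r * Real.log (1 / r) ≤ r * (1 / r - 1) := by gcongr
              _ = 1 - r := by field_simp
              _ ≤ 1 := by linarith
          · exact ⟨⟨hr', h1⟩, hθ⟩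
          · rw [mem_ball_zero_iff, Complex.norm_polarCoord_symm]; rwa [abs_of_pos hr']
        · rw [Set.indicator_of_notMem]
          · simp
          · rw [mem_ball_zero_iff, Complex.norm_polarCoord_symm]; rwa [abs_of_pos hr']
    _ ≤ ∫⁻ p, (Set.Ioo (0:ℝ) 1 ×ˢ Set.Ioo (-π) π).indicator (fun _ => (1:ENNReal)) p :=
        setLIntegral_le_lintegral _ _
    _ = ENNReal.ofReal (2 * π) := by
        rw [lintegral_indicator (measurableSet_Ioo.prod measurableSet_Ioo), setLIntegral_one,
          Measure.volume_eq_prod, Measure.prod_prod, Real.volume_Ioo, Real.volume_Ioo]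
        rw [show π - -π = 2 * π by ring]; simp

/-- weighted area bound on the disc -/
lemma disc_log {h : ℂ → ℂ} (hh : DifferentiableOn ℂ h (Metric.ball 0 1)) :
    ∫⁻ x in Metric.ball (0:ℂ) 1, ENNReal.ofReal (‖h x‖ ^ 2) * ENNReal.ofReal (Real.log (1 / ‖x‖)) ≤
      ENNReal.ofReal 17 * ∫⁻ x in Metric.ball (0:ℂ) 1, ENNReal.ofReal (‖h x‖ ^ 2) := by
  set I := ∫⁻ x in Metric.ball (0:ℂ) 1, ENNReal.ofReal (‖h x‖ ^ 2) with hI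
  have e2 : ∀ a : ℂ, ENNReal.ofReal (‖a‖ ^ 2) = ‖a ^ 2‖ₑ := by
    intro a; rw [← norm_pow, ofReal_norm]
  have key : ∀ x ∈ Metric.ball (0:ℂ) (1/2), ENNReal.ofReal (‖h x‖ ^ 2) ≤ ENNReal.ofReal (8 / π) * I := by
    intro x hx
    have hsub : Metric.ball x (1/2) ⊆ Metric.ball (0:ℂ) 1 := by
      intro y hy
      rw [Metric.mem_ball] at *
      linarith [dist_triangle y x 0]
    have := submean (h := fun y => h y ^ 2) (x := x) ((hh.pow 2).mono hsub)
    have h2 : ENNReal.ofReal (π / 8) * ‖h x ^ 2‖ₑ ≤ I := by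
      refine this.trans ?_
      rw [hI]; simp only [e2]
      exact lintegral_mono_set hsub
    calc ENNReal.ofReal (‖h x‖ ^ 2) = ENNReal.ofReal (8 / π) * (ENNReal.ofReal (π / 8) * ‖h x ^ 2‖ₑ) := by
          rw [e2, ← mul_assoc, ← ENNReal.ofReal_mul (by positivity)]
          rw [show 8 / π * (π / 8) = 1 by field_simp]; simp
      _ ≤ _ := by gcongr
  have hae : ∀ x ∈ Metric.ball (0:ℂ) 1, ENNReal.ofReal (‖h x‖ ^ 2) * ENNReal.ofReal (Real.log (1 / ‖x‖)) ≤
      (ENNReal.ofReal (8 / π) * I) * ENNReal.ofReal (Real.log (1 / ‖x‖)) + ENNReal.ofReal (‖h x‖ ^ 2) := by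
    intro x hx
    by_cases h1 : x ∈ Metric.ball (0:ℂ) (1/2)
    · exact le_add_right (by gcongr; exact key x h1)
    · refine le_add_left ?_
      have h2 : (1/2 : ℝ) ≤ ‖x‖ := by simpa using h1
      have : Real.log (1 / ‖x‖) ≤ 1 := by
        have h3 : 1 / ‖x‖ ≤ 2 := by rw [div_le_iff₀ (by linarith)]; linarith
        have := Real.log_le_sub_one_of_pos (show 0 < 1 / ‖x‖ by positivity)
        linarith
      calc _ ≤ ENNReal.ofReal (‖h x‖ ^ 2) * 1 := by
            gcongr; rw [← ENNReal.ofReal_one]; exact ENNReal.ofReal_le_ofReal this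
        _ = _ := mul_one _
  have hmeas : Measurable (fun x : ℂ => (ENNReal.ofReal (8 / π) * I) * ENNReal.ofReal (Real.log (1 / ‖x‖))) := by
    refine measurable_const.mul ?_
    exact (Real.measurable_log.comp (measurable_const.div measurable_norm)).ennreal_ofReal
  calc _ ≤ ∫⁻ x in Metric.ball (0:ℂ) 1, ((ENNReal.ofReal (8 / π) * I) * ENNReal.ofReal (Real.log (1 / ‖x‖)) + ENNReal.ofReal (‖h x‖ ^ 2)) :=
        setLIntegral_mono' Metric.isOpen_ball.measurableSet hae
    _ = (ENNReal.ofReal (8 / π) * I) * (∫⁻ x in Metric.ball (0:ℂ) 1, ENNReal.ofReal (Real.log (1 / ‖x‖))) + I := by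
        rw [lintegral_add_left hmeas, lintegral_const_mul]
        exact (Real.measurable_log.comp (measurable_const.div measurable_norm)).ennreal_ofReal
    _ ≤ (ENNReal.ofReal (8 / π) * I) * ENNReal.ofReal (2 * π) + I := by gcongr; exact log_int
    _ = ENNReal.ofReal 17 * I := by
        rw [mul_right_comm, ← ENNReal.ofReal_mul (by positivity), show 8 / π * (2 * π) = 16 by field_simp; norm_num]
        rw [show (17:ℝ) = 16 + 1 by norm_num, ENNReal.ofReal_add (by norm_num) (by norm_num), add_mul]
        simp
end S17

namespace S17

open MeasureTheory Real Polynomial Filter Topology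

section cover
variable {W : Set ℂ} {s : ℂ → ℂ}

def proj (hs : ∀ l ∈ W, ‖s l‖ < 1) : W → Metric.ball (0:ℂ) 1 :=
  fun l => ⟨s l, by simpa using hs l l.2⟩

lemma proj_cont (hs : ∀ l ∈ W, ‖s l‖ < 1) (hder : ∀ l ∈ W, ∃ s' : ℂ, s' ≠ 0 ∧ HasDerivAt s s' l) :
    Continuous (proj hs) := by
  apply Continuous.subtype_mk
  have : ContinuousOn s W := fun l hl => by
    obtain ⟨s', -, h⟩ := hder l hl
    exact h.continuousAt.continuousWithinAt
  exact continuousOn_iff_continuous_domRestrict.mp this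

lemma s_strict (hW : IsOpen W) (hder : ∀ l ∈ W, ∃ s' : ℂ, s' ≠ 0 ∧ HasDerivAt s s' l) {l : ℂ} (hl : l ∈ W) :
    ∃ s' : ℂ, s' ≠ 0 ∧ HasStrictDerivAt s s' l := by
  obtain ⟨s', h0, h⟩ := hder l hl
  refine ⟨s', h0, ?_⟩
  have hd : DifferentiableOn ℂ s W := fun x hx => by
    obtain ⟨s', -, h⟩ := hder x hx
    exact h.differentiableAt.differentiableWithinAt
  have := (hd.analyticAt (hW.mem_nhds hl)).hasStrictDerivAt
  rwa [h.deriv] at this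

lemma proj_locHomeo (hW : IsOpen W) (hs : ∀ l ∈ W, ‖s l‖ < 1)
    (hder : ∀ l ∈ W, ∃ s' : ℂ, s' ≠ 0 ∧ HasDerivAt s s' l) : IsLocalHomeomorph (proj hs) := by
  have h1 : IsLocalHomeomorphOn s W := by
    intro l hl
    obtain ⟨s', h0, h⟩ := s_strict hW hder hl
    exact ⟨_, (h.hasStrictFDerivAt_equiv h0).mem_toOpenPartialHomeomorph_source, by simp⟩
  have h2 : IsLocalHomeomorph (Subtype.val : Metric.ball (0:ℂ) 1 → ℂ) :=
    Metric.isOpen_ball.isOpenEmbedding_subtypeVal.isLocalHomeomorph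
  have h3 : IsLocalHomeomorph (Subtype.val : W → ℂ) :=
    hW.isOpenEmbedding_subtypeVal.isLocalHomeomorph
  refine IsLocalHomeomorph.of_comp (g := Subtype.val) ?_ h2 (proj_cont hs hder)
  have : IsLocalHomeomorphOn (s ∘ (Subtype.val : W → ℂ)) Set.univ :=
    h1.comp h3.isLocalHomeomorphOn (fun x _ => x.2)
  exact isLocalHomeomorph_iff_isLocalHomeomorphOn_univ.2 this

lemma proj_cover (hW : IsOpen W) (hs : ∀ l ∈ W, ‖s l‖ < 1)
    (hder : ∀ l ∈ W, ∃ s' : ℂ, s' ≠ 0 ∧ HasDerivAt s s' l)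
    (hc : ∀ t : ℝ, 0 ≤ t → t < 1 → IsCompact {l | l ∈ W ∧ ‖s l‖ ≤ t}) :
    IsCoveringMap (proj hs) ∧ ∀ x, ((proj hs) ⁻¹' {x}).Finite := by
  have hlh := proj_locHomeo hW hs hder
  have hprop : IsProperMap (proj hs) := by
    rw [isProperMap_iff_isCompact_preimage]
    refine ⟨hlh.continuous, fun K hK => ?_⟩
    obtain ⟨t, ht0, ht1, ht⟩ : ∃ t : ℝ, 0 ≤ t ∧ t < 1 ∧ ∀ x ∈ K, ‖(x:ℂ)‖ ≤ t := by
      rcases K.eq_empty_or_nonempty with rfl | hne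
      · exact ⟨0, le_rfl, one_pos, by simp⟩
      · obtain ⟨x, hx, hmax⟩ := hK.exists_isMaxOn hne
          (f := fun x : Metric.ball (0:ℂ) 1 => ‖(x:ℂ)‖) (by fun_prop)
        exact ⟨‖(x:ℂ)‖, norm_nonneg _, mem_ball_zero_iff.1 x.2, fun y hy => hmax hy⟩
    have h1 : IsCompact ((Subtype.val : W → ℂ) ⁻¹' {l | l ∈ W ∧ ‖s l‖ ≤ t}) := by
      refine Topology.IsInducing.subtypeVal.isCompact_preimage' (hc t ht0 ht1) ?_
      intro l hl; simpa using hl.1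
    refine h1.of_isClosed_subset (hK.isClosed.preimage hlh.continuous) ?_
    intro l hl
    exact ⟨l.2, ht _ hl⟩
  have hfin : ∀ x, ((proj hs) ⁻¹' {x}).Finite := by
    intro x
    have hcp : IsCompact ((proj hs) ⁻¹' {x}) := hprop.isCompact_preimage isCompact_singleton
    refine hcp.finite ?_
    refine (hlh.isLocalHomeomorphOn).isDiscrete_of_image (s := (proj hs) ⁻¹' {x}) ?_ |> fun h => h
    have : (proj hs '' (proj hs ⁻¹' {x})).Subsingleton :=
      Set.subsingleton_singleton.anti (Set.image_preimage_subset _ _)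
    exact this.isDiscrete
  refine ⟨?_, hfin⟩
  rw [isCoveringMap_iff_isCoveringMapOn_univ]
  exact hprop.isClosedMap.isCoveringMapOn_of_isLocalHomeomorphOn (fun x _ => hfin x)
    hlh.isLocalHomeomorphOn

/-- a section of `s` over the unit disc -/
structure Sec (W : Set ℂ) (s : ℂ → ℂ) (φ : ℂ → ℂ) : Prop where
  cont : ContinuousOn φ (Metric.ball 0 1)
  mem : ∀ x ∈ Metric.ball (0:ℂ) 1, φ x ∈ W
  inv : ∀ x ∈ Metric.ball (0:ℂ) 1, s (φ x) = x

lemma Sec.injOn {φ : ℂ → ℂ} (h : Sec W s φ) : Set.InjOn φ (Metric.ball 0 1) := by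
  intro x hx y hy hxy
  rw [← h.inv x hx, hxy, h.inv y hy]

lemma Sec.diff {φ : ℂ → ℂ} (h : Sec W s φ)
    (hder : ∀ l ∈ W, ∃ s' : ℂ, s' ≠ 0 ∧ HasDerivAt s s' l) : DifferentiableOn ℂ φ (Metric.ball 0 1) := by
  intro x hx
  obtain ⟨s', h0, h1⟩ := hder _ (h.mem x hx)
  have hn := Metric.isOpen_ball.mem_nhds hx
  refine (HasDerivAt.of_local_left_inverse (h.cont.continuousAt hn) h1 h0
    ?_).differentiableAt.differentiableWithinAt
  filter_upwards [hn] with y hy using h.inv y hy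

lemma exists_sec (hW : IsOpen W) (hs : ∀ l ∈ W, ‖s l‖ < 1)
    (hder : ∀ l ∈ W, ∃ s' : ℂ, s' ≠ 0 ∧ HasDerivAt s s' l)
    (hc : ∀ t : ℝ, 0 ≤ t → t < 1 → IsCompact {l | l ∈ W ∧ ‖s l‖ ≤ t}) {l0 : ℂ} (hl0 : l0 ∈ W) :
    ∃ φ : ℂ → ℂ, Sec W s φ ∧ φ (s l0) = l0 := by
  have cov := (proj_cover hW hs hder hc).1
  have : ContractibleSpace (Metric.ball (0:ℂ) 1) := Metric.contractibleSpace_ball one_pos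
  have : LocallyPathConnectedSpace (Metric.ball (0:ℂ) 1) := Metric.isOpen_ball.locallyPathConnectedSpace
  obtain ⟨F, ⟨h1, h2⟩, -⟩ := cov.existsUnique_continuousMap_lifts (ContinuousMap.id _)
    (proj hs ⟨l0, hl0⟩) ⟨l0, hl0⟩ rfl
  classical
  refine ⟨fun x => if hx : x ∈ Metric.ball (0:ℂ) 1 then F ⟨x, hx⟩ else 0, ⟨?_, ?_, ?_⟩, ?_⟩
  · rw [continuousOn_iff_continuous_domRestrict]
    have : (Metric.ball (0:ℂ) 1).domRestrict (fun x => if hx : x ∈ Metric.ball (0:ℂ) 1 then (F ⟨x, hx⟩ : ℂ) else 0)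
        = fun x => (F x : ℂ) := by
      ext x
      simp only [Set.domRestrict_apply]
      rw [dif_pos x.2]
    rw [this]
    exact continuous_subtype_val.comp F.continuous
  · intro x hx
    rw [dif_pos hx]; exact (F ⟨x, hx⟩).2
  · intro x hx
    rw [dif_pos hx]
    have := congrFun h2 ⟨x, hx⟩
    exact congrArg Subtype.val this
  · have : s l0 ∈ Metric.ball (0:ℂ) 1 := by simpa using hs l0 hl0
    simp only
    rw [dif_pos this]
    exact congrArg Subtype.val h1

lemma Sec.eqOn (hW : IsOpen W) (hs : ∀ l ∈ W, ‖s l‖ < 1)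
    (hder : ∀ l ∈ W, ∃ s' : ℂ, s' ≠ 0 ∧ HasDerivAt s s' l)
    (hc : ∀ t : ℝ, 0 ≤ t → t < 1 → IsCompact {l | l ∈ W ∧ ‖s l‖ ≤ t}) {φ ψ : ℂ → ℂ}
    (h1 : Sec W s φ) (h2 : Sec W s ψ) {x : ℂ} (hx : x ∈ Metric.ball (0:ℂ) 1) (hxx : φ x = ψ x) :
    Set.EqOn φ ψ (Metric.ball 0 1) := by
  have cov := (proj_cover hW hs hder hc).1
  have : ContractibleSpace (Metric.ball (0:ℂ) 1) := Metric.contractibleSpace_ball one_pos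
  let F : Metric.ball (0:ℂ) 1 → W := fun y => ⟨φ y, h1.mem y y.2⟩
  let G : Metric.ball (0:ℂ) 1 → W := fun y => ⟨ψ y, h2.mem y y.2⟩
  have hF : Continuous F := (continuousOn_iff_continuous_domRestrict.mp h1.cont).subtype_mk _
  have hG : Continuous G := (continuousOn_iff_continuous_domRestrict.mp h2.cont).subtype_mk _
  have := cov.eq_of_comp_eq hF hG (by
    ext y
    change s (φ y) = s (ψ y)
    rw [h1.inv y y.2, h2.inv y y.2]) ⟨x, hx⟩ (Subtype.ext hxx)
  intro y hy
  exact congrArg Subtype.val (congrFun this ⟨y, hy⟩)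

lemma Sec.area {φ : ℂ → ℂ} (h : Sec W s φ)
    (hder : ∀ l ∈ W, ∃ s' : ℂ, s' ≠ 0 ∧ HasDerivAt s s' l) :
    ∫⁻ l in φ '' Metric.ball 0 1, ENNReal.ofReal (Real.log (1 / ‖s l‖)) ≤
      ENNReal.ofReal 17 * volume (φ '' Metric.ball 0 1) := by
  have hd := h.diff hder
  have hda : ∀ x ∈ Metric.ball (0:ℂ) 1, HasDerivAt φ (deriv φ x) x := fun x hx =>
    (hd.differentiableAt (Metric.isOpen_ball.mem_nhds hx)).hasDerivAt
  have e1 := lintegral_cov Metric.isOpen_ball.measurableSet hda h.injOn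
    (fun l => ENNReal.ofReal (Real.log (1 / ‖s l‖)))
  have e2 := lintegral_cov Metric.isOpen_ball.measurableSet hda h.injOn (fun _ => 1)
  rw [setLIntegral_one] at e2
  rw [e1, e2]
  have := disc_log (hd.deriv Metric.isOpen_ball)
  simp only [mul_one]
  refine le_trans (le_of_eq ?_) this
  apply setLIntegral_congr_fun Metric.isOpen_ball.measurableSet
  intro x hx
  simp only [h.inv x hx]

lemma cover_area (hW : IsOpen W) (hs : ∀ l ∈ W, ‖s l‖ < 1)
    (hder : ∀ l ∈ W, ∃ s' : ℂ, s' ≠ 0 ∧ HasDerivAt s s' l)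
    (hc : ∀ t : ℝ, 0 ≤ t → t < 1 → IsCompact {l | l ∈ W ∧ ‖s l‖ ≤ t}) :
    ∫⁻ l in W, ENNReal.ofReal (Real.log (1 / ‖s l‖)) ≤ ENNReal.ofReal 17 * volume W := by
  have h00 : (0:ℂ) ∈ Metric.ball (0:ℂ) 1 := by simp
  have hfin : {l | l ∈ W ∧ s l = 0}.Finite := by
    have := ((proj_cover hW hs hder hc).2 ⟨0, h00⟩).image Subtype.val
    refine this.subset ?_
    rintro l ⟨hl, h0⟩
    exact ⟨⟨l, hl⟩, Subtype.ext h0, rfl⟩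
  have hex : ∀ a : ℂ, ∃ φ : ℂ → ℂ, a ∈ {l | l ∈ W ∧ s l = 0} → Sec W s φ ∧ φ 0 = a := by
    intro a
    by_cases ha : a ∈ {l | l ∈ W ∧ s l = 0}
    · obtain ⟨φ, h1, h2⟩ := exists_sec hW hs hder hc ha.1
      rw [ha.2] at h2
      exact ⟨φ, fun _ => ⟨h1, h2⟩⟩
    · exact ⟨0, fun h => absurd h ha⟩
  choose φ hφ using hex
  set Z := hfin.toFinset with hZ
  have hZm : ∀ a ∈ Z, Sec W s (φ a) ∧ φ a 0 = a := fun a ha => hφ a (hfin.mem_toFinset.1 ha)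
  have hWeq : W = ⋃ a ∈ Z, φ a '' Metric.ball 0 1 := by
    apply Set.Subset.antisymm
    · intro l hl
      obtain ⟨ψ, h1, h2⟩ := exists_sec hW hs hder hc hl
      have hsl : s l ∈ Metric.ball (0:ℂ) 1 := by simpa using hs l hl
      have ha : ψ 0 ∈ Z := hfin.mem_toFinset.2 ⟨h1.mem 0 h00, h1.inv 0 h00⟩
      have heq := Sec.eqOn hW hs hder hc (hZm _ ha).1 h1 h00 (hZm _ ha).2
      simp only [Set.mem_iUnion]
      exact ⟨ψ 0, ha, s l, hsl, by rw [heq hsl, h2]⟩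
    · simp only [Set.iUnion_subset_iff]
      rintro a ha _ ⟨x, hx, rfl⟩
      exact (hZm a ha).1.mem x hx
  have hdisj : (Z : Set ℂ).PairwiseDisjoint (fun a => φ a '' Metric.ball 0 1) := by
    intro a ha b hb hab
    rw [Function.onFun, Set.disjoint_left]
    rintro _ ⟨x, hx, rfl⟩ ⟨y, hy, hxy⟩
    apply hab
    have hA := hZm a ha
    have hB := hZm b hb
    have : y = x := by rw [← hA.1.inv x hx, ← hxy, hB.1.inv y hy]
    subst this
    rw [← hA.2, ← hB.2]
    exact (Sec.eqOn hW hs hder hc hB.1 hA.1 hx hxy h00).symm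
  have hmeas : ∀ a ∈ Z, MeasurableSet (φ a '' Metric.ball 0 1) := fun a ha =>
    Metric.isOpen_ball.measurableSet.image_of_continuousOn_injOn (hZm a ha).1.cont (hZm a ha).1.injOn
  rw [hWeq, lintegral_biUnion_finset hdisj hmeas, measure_biUnion_finset hdisj hmeas, Finset.mul_sum]
  exact Finset.sum_le_sum fun a ha => (hZm a ha).1.area hder

end cover

/-- the total logarithmic mass over the period-n components is bounded independently of n -/
lemma U_area {d n : ℕ} (hd : 2 ≤ d) (hn : 0 < n) :
    ∫⁻ l in U d n, ENNReal.ofReal (Real.log (1 / ‖S d n l‖)) ≤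
      ENNReal.ofReal 17 * volume (Metric.ball (0:ℂ) 4) := by
  refine (cover_area (U_open d n) (fun l hl => S_norm_lt hd hl) (fun l hl => S_deriv hd hl)
    (fun t h0 h1 => U_compact hd hn h0 h1)).trans ?_
  gcongr
  exact U_bdd hd
end S17

namespace S17

open MeasureTheory Real Polynomial Filter Topology

/-- critical orbit -/
noncomputable def FF (d m : ℕ) (l : ℂ) : ℂ := (fc d l)^[m] 0

lemma FF_succ (d m : ℕ) (l : ℂ) : FF d (m + 1) l = FF d m l ^ d + l := by
  unfold FF; rw [Function.iterate_succ_apply']; rfl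

lemma FF_one {d : ℕ} (hd : 2 ≤ d) (l : ℂ) : FF d 1 l = l := by
  unfold FF fc; simp [show d ≠ 0 by omega]

noncomputable def BB (d : ℕ) : ℝ := (2:ℝ) ^ ((1:ℝ) / ((d - 1 : ℕ) : ℝ))

lemma BB_pow {d : ℕ} (hd : 2 ≤ d) : BB d ^ (d - 1) = 2 := by
  unfold BB
  rw [← Real.rpow_natCast, ← Real.rpow_mul (by norm_num), one_div, inv_mul_cancel₀, Real.rpow_one]
  have : d - 1 ≠ 0 := by omega
  exact_mod_cast this

lemma BB_ge {d : ℕ} : 1 ≤ BB d := by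
  unfold BB
  exact Real.one_le_rpow (by norm_num) (by positivity)

lemma esc_step {d : ℕ} (hd : 2 ≤ d) {l z : ℂ} (h1 : BB d < ‖z‖) (h2 : ‖l‖ ≤ ‖z‖) : ‖z‖ ≤ ‖z ^ d + l‖ := by
  have h3 : ‖z‖ ^ d - ‖l‖ ≤ ‖z ^ d + l‖ := by
    have := norm_sub_norm_le (z ^ d) (-l)
    rwa [norm_neg, norm_pow, sub_neg_eq_add] at this
  have h4 : 2 ≤ ‖z‖ ^ (d - 1) := by
    rw [← BB_pow hd]; exact pow_le_pow_left₀ (le_trans zero_le_one BB_ge) h1.le _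
  have h5 : ‖z‖ ^ d = ‖z‖ ^ (d - 1) * ‖z‖ := by rw [← pow_succ]; congr 1; omega
  nlinarith [norm_nonneg z]

lemma esc_iter {d : ℕ} (hd : 2 ≤ d) {l : ℂ} {j : ℕ} (h1 : BB d < ‖FF d j l‖) (h2 : ‖l‖ ≤ ‖FF d j l‖) (k : ℕ) :
    ‖FF d j l‖ ≤ ‖FF d (j + k) l‖ := by
  induction k with
  | zero => exact le_rfl
  | succ k ih =>
    rw [← add_assoc, FF_succ]
    exact ih.trans (esc_step hd (h1.trans_le ih) (h2.trans ih))

lemma FF_bound {d : ℕ} (hd : 2 ≤ d) {l : ℂ} {m : ℕ} (hm : ‖FF d m l‖ ≤ 1) {j : ℕ} (hj : 1 ≤ j) (hjm : j ≤ m) :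
    ‖FF d j l‖ ≤ BB d := by
  by_contra hc
  push Not at hc
  by_cases hl : ‖l‖ ≤ BB d
  · have := esc_iter hd hc (hl.trans hc.le) (m - j)
    rw [show j + (m - j) = m by omega] at this
    linarith [BB_ge (d := d)]
  · push Not at hl
    have := esc_iter hd (j := 1) (l := l) (by rwa [FF_one hd]) (by rw [FF_one hd]) (m - 1)
    rw [show 1 + (m - 1) = m by omega, FF_one hd] at this
    linarith [BB_ge (d := d)]

lemma pow_sub_bound {d : ℕ} {a b : ℂ} {M : ℝ} (ha : ‖a‖ ≤ M) (hb : ‖b‖ ≤ M) :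
    ‖a ^ d - b ^ d‖ ≤ d * M ^ (d - 1) * ‖a - b‖ := by
  have hM : 0 ≤ M := (norm_nonneg _).trans ha
  rw [← (Commute.all a b).geom_sum₂_mul d, norm_mul]
  gcongr
  refine (norm_sum_le _ _).trans ?_
  calc _ ≤ ∑ i ∈ Finset.range d, M ^ (d - 1) := by
        apply Finset.sum_le_sum
        intro i hi
        rw [Finset.mem_range] at hi
        rw [norm_mul, norm_pow, norm_pow]
        calc ‖a‖ ^ i * ‖b‖ ^ (d - 1 - i) ≤ M ^ i * M ^ (d - 1 - i) := by gcongr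
          _ = M ^ (d - 1) := by rw [← pow_add]; congr 1; omega
    _ = _ := by simp

lemma BB_exp {d : ℕ} (hd : 2 ≤ d) {r : ℝ} (hr : 0 ≤ r) : (BB d + r) ^ (d - 1) ≤ 2 * Real.exp ((d - 1 : ℕ) * r) := by
  have h1 : BB d + r ≤ BB d * Real.exp r := by
    have := Real.add_one_le_exp r
    nlinarith [BB_ge (d := d)]
  calc (BB d + r) ^ (d - 1) ≤ (BB d * Real.exp r) ^ (d - 1) := by
        have := BB_ge (d := d)
        gcongr
    _ = _ := by rw [mul_pow, BB_pow hd, ← Real.exp_nat_mul]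

/-- distortion along the critical orbit -/
lemma mul_small {d : ℕ} (hd : 2 ≤ d) {l : ℂ} {m : ℕ} (hm : 1 ≤ m) (hF : ‖FF d m l‖ ≤ 1) {ρ : ℝ} (hρ0 : 0 ≤ ρ)
    (hρ1 : ρ ≤ 1) (hρ : ρ ^ (d - 1) * (2 * d) ^ m = 1 / (4 * d)) {z : ℂ} (hz : ‖z‖ ≤ ρ) :
    ‖mul d m l z‖ ≤ 1 / 2 := by
  have hdR : (2:ℝ) ≤ d := by exact_mod_cast hd
  have hd1 : ((d - 1 : ℕ) : ℝ) = d - 1 := by rw [Nat.cast_sub (by omega)]; simp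
  set ε := ρ ^ (d - 1) with hε
  have hε0 : 0 ≤ ε := by positivity
  set r : ℕ → ℝ := fun i => ‖(fc d l)^[i + 1] z - FF d (i + 1) l‖ with hr
  have hr0 : ∀ i, 0 ≤ r i := fun i => norm_nonneg _
  set Sg : ℕ → ℝ := fun i => ∑ k ∈ Finset.range i, r k with hSg
  have hfac : ∀ i, i < m → d * ‖(fc d l)^[i + 1] z‖ ^ (d - 1) ≤ 2 * d * Real.exp ((d - 1 : ℕ) * r i) ∧
      d * (BB d + r i) ^ (d - 1) ≤ 2 * d * Real.exp ((d - 1 : ℕ) * r i) := by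
    intro i hi
    have h1 : ‖(fc d l)^[i + 1] z‖ ≤ BB d + r i := by
      have h2 := FF_bound hd hF (j := i + 1) (by omega) (by omega)
      have h3 := norm_sub_norm_le ((fc d l)^[i + 1] z) (FF d (i + 1) l)
      simp only [hr]; linarith
    have h4 := BB_exp hd (hr0 i)
    have h5 : ‖(fc d l)^[i + 1] z‖ ^ (d - 1) ≤ (BB d + r i) ^ (d - 1) := by gcongr
    constructor <;> nlinarith
  have hrec : ∀ i, i < m → r (i + 1) ≤ 2 * d * Real.exp ((d - 1 : ℕ) * r i) * r i := by
    intro i hi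
    refine le_trans ?_ (mul_le_mul_of_nonneg_right (hfac i hi).2 (hr0 i))
    have h2 := FF_bound hd hF (j := i + 1) (by omega) (by omega)
    have h3 := norm_sub_norm_le ((fc d l)^[i + 1] z) (FF d (i + 1) l)
    have := pow_sub_bound (d := d) (a := (fc d l)^[i + 1] z) (b := FF d (i + 1) l) (M := BB d + r i)
      (by simp only [hr]; linarith) (by linarith [hr0 i])
    refine le_trans (le_of_eq ?_) this
    simp only [hr]
    rw [Function.iterate_succ_apply', FF_succ d (i + 1)]
    unfold fc; congr 1; ring
  have hP : ∀ i, i ≤ m → r i ≤ ε * (2 * d) ^ i * Real.exp ((d - 1 : ℕ) * Sg i) := by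
    intro i
    induction i with
    | zero =>
      intro _
      have e1 : r 0 = ‖z‖ ^ d := by
        simp only [hr]
        rw [zero_add, FF_one hd, Function.iterate_one, fc, add_sub_cancel_right, norm_pow]
      rw [e1]
      simp only [hSg, Finset.range_zero, Finset.sum_empty, mul_zero, Real.exp_zero, pow_zero, mul_one]
      rw [hε]
      calc ‖z‖ ^ d = ‖z‖ ^ (d - 1) * ‖z‖ := by rw [← pow_succ]; congr 1; omega
        _ ≤ ρ ^ (d - 1) * 1 := by gcongr; linarith
        _ = _ := mul_one _
    | succ i ih =>
      intro hi
      have h1 := ih (by omega)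
      have h2 := hrec i (by omega)
      calc r (i + 1) ≤ 2 * d * Real.exp ((d - 1 : ℕ) * r i) * r i := h2
        _ ≤ 2 * d * Real.exp ((d - 1 : ℕ) * r i) * (ε * (2 * d) ^ i * Real.exp ((d - 1 : ℕ) * Sg i)) := by gcongr
        _ = ε * (2 * d) ^ (i + 1) * (Real.exp ((d - 1 : ℕ) * Sg i) * Real.exp ((d - 1 : ℕ) * r i)) := by ring
        _ = _ := by
          rw [← Real.exp_add, ← mul_add]
          simp only [hSg, Finset.sum_range_succ]
  have hexp : ∀ i, i ≤ m → Sg i ≤ 2 * ε * (2 * d) ^ i → Real.exp ((d - 1 : ℕ) * Sg i) ≤ 2 := by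
    intro i hi h
    have h1 : Sg i ≤ 1 / (2 * d) := by
      calc Sg i ≤ 2 * ε * (2 * d) ^ i := h
        _ ≤ 2 * ε * (2 * d) ^ m := by
          have : (1:ℝ) ≤ 2 * d := by linarith
          gcongr
        _ = 2 * (1 / (4 * d)) := by rw [← hρ]; ring
        _ = _ := by field_simp; norm_num
    have h2 : ((d - 1 : ℕ) : ℝ) * Sg i ≤ 1 / 2 := by
      rw [hd1]
      calc ((d:ℝ) - 1) * Sg i ≤ (d - 1) * (1 / (2 * d)) := by
            have : (0:ℝ) ≤ d - 1 := by linarith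
            gcongr
        _ ≤ d * (1 / (2 * d)) := by gcongr; linarith
        _ = 1 / 2 := by field_simp
    have h3 : Real.exp (1/2) ≤ 2 := by
      have := Real.exp_bound_div_one_sub_of_interval (x := 1/2) (by norm_num) (by norm_num)
      linarith
    exact (Real.exp_le_exp.2 h2).trans h3
  have hQ : ∀ i, i ≤ m → Sg i ≤ 2 * ε * (2 * d) ^ i := by
    intro i
    induction i with
    | zero => intro _; simp [hSg, hε0]
    | succ i ih =>
      intro hi
      have h1 := ih (by omega)
      have h2 := hP i (by omega)
      have h3 := hexp i (by omega) h1
      have h4 : Sg (i + 1) = Sg i + r i := by simp only [hSg, Finset.sum_range_succ]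
      have h5 : r i ≤ ε * (2 * d) ^ i * 2 := h2.trans (by gcongr)
      rw [h4, pow_succ]
      have : 0 ≤ ε * (2 * d) ^ i := by positivity
      nlinarith
  obtain ⟨k, rfl⟩ : ∃ k, m = k + 1 := ⟨m - 1, by omega⟩
  unfold mul
  rw [Finset.prod_range_succ', norm_mul, norm_prod]
  have h1 : ∏ i ∈ Finset.range k, ‖(d:ℂ) * ((fc d l)^[i + 1] z) ^ (d - 1)‖ ≤
      (2 * d) ^ k * Real.exp ((d - 1 : ℕ) * Sg k) := by
    calc _ ≤ ∏ i ∈ Finset.range k, 2 * d * Real.exp ((d - 1 : ℕ) * r i) := by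
          apply Finset.prod_le_prod
          · intros; positivity
          · intro i hi
            rw [Finset.mem_range] at hi
            have := (hfac i (by omega)).1
            simpa [norm_mul, norm_pow] using this
      _ = _ := by
          rw [Finset.prod_mul_distrib, Finset.prod_const, Finset.card_range, ← Real.exp_sum, Finset.mul_sum]
  have h2 : Real.exp ((d - 1 : ℕ) * Sg k) ≤ 2 := hexp k (by omega) (hQ k (by omega))
  have h3 : ‖(d:ℂ) * ((fc d l)^[0] z) ^ (d - 1)‖ ≤ d * ε := by
    simp only [Function.iterate_zero, id, norm_mul, norm_pow, Complex.norm_natCast, hε]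
    gcongr
  calc _ ≤ ((2 * d) ^ k * 2) * (d * ε) := by
        gcongr
        exact h1.trans (by gcongr)
    _ = ε * (2 * d) ^ (k + 1) := by ring
    _ = 1 / (4 * d) := hρ
    _ ≤ 1 / 2 := by
        rw [div_le_div_iff₀ (by positivity) (by norm_num)]; linarith

lemma przy_aux {d : ℕ} (hd : 2 ≤ d) {l : ℂ} {m : ℕ} (hm : 1 ≤ m) {ρ : ℝ} (hρ0 : 0 < ρ)
    (hρ1 : ρ ≤ 1) (hρ : ρ ^ (d - 1) * (2 * d) ^ m = 1 / (4 * d)) (hF : ‖FF d m l‖ ≤ ρ / 2) :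
    ∃ k, l ∈ U d k := by
  have hF1 : ‖FF d m l‖ ≤ 1 := by linarith
  have hsm : ∀ z ∈ Metric.closedBall (0:ℂ) ρ, ‖mul d m l z‖ ≤ 1 / 2 := fun z hz =>
    mul_small hd hm hF1 hρ0.le hρ1 hρ (by simpa using hz)
  have hlip : LipschitzOnWith (1/2) ((fc d l)^[m]) (Metric.closedBall (0:ℂ) ρ) := by
    apply (convex_closedBall (0:ℂ) ρ).lipschitzOnWith_of_nnnorm_hasDerivWithin_le
      (f' := fun z => mul d m l z)
    · intro z _
      exact (iter_hasDerivAt d m l z).hasDerivWithinAt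
    · intro z hz
      have := hsm z hz
      rw [← NNReal.coe_le_coe]; simpa using this
  have hmaps : Set.MapsTo ((fc d l)^[m]) (Metric.closedBall (0:ℂ) ρ) (Metric.closedBall (0:ℂ) ρ) := by
    intro z hz
    have h0 : (0:ℂ) ∈ Metric.closedBall (0:ℂ) ρ := by simp [hρ0.le]
    have h1 := hlip.dist_le_mul z hz 0 h0
    rw [mem_closedBall_zero_iff] at hz ⊢
    rw [dist_eq_norm, dist_eq_norm, sub_zero] at h1
    have h2 : (fc d l)^[m] z = ((fc d l)^[m] z - (fc d l)^[m] 0) + FF d m l := by unfold FF; ring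
    rw [h2]
    refine (norm_add_le _ _).trans ?_
    have h3 : ((1/2 : NNReal) : ℝ) = 1/2 := by norm_num
    rw [h3] at h1
    linarith
  have hK : ContractingWith (1/2) (hmaps.restrict _ _ _) :=
    ⟨by
      rw [← NNReal.coe_lt_coe]; norm_num, hlip.mapsToRestrict hmaps⟩
  obtain ⟨z, hz, hfix, -⟩ := hK.exists_fixedPoint' Metric.isClosed_closedBall.isComplete hmaps
    (x := 0) (by simp [hρ0.le]) (edist_ne_top _ _)
  refine ⟨_, z, att_of_per (n := m) (by omega) hfix ?_⟩
  exact (hsm z hz).trans_lt (by norm_num)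

/-- Przytycki type lower bound -/
lemma przy {d : ℕ} (hd : 2 ≤ d) {l : ℂ} {m : ℕ} (hm : 1 ≤ m) (hno : ∀ k, l ∉ U d k) :
    FF d m l ≠ 0 ∧ -(m * Real.log (2 * d)) - Real.log (4 * d) - (d - 1) * Real.log 2 ≤ (d - 1) * Real.log ‖FF d m l‖ := by
  have hdR : (2:ℝ) ≤ d := by exact_mod_cast hd
  have hd1 : ((d - 1 : ℕ) : ℝ) = d - 1 := by rw [Nat.cast_sub (by omega)]; simp
  set q : ℝ := 1 / (4 * d) / (2 * d) ^ m with hq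
  have hq0 : 0 < q := by positivity
  have hq1 : q ≤ 1 := by
    rw [hq, div_div, div_le_one (by positivity)]
    have : (1:ℝ) ≤ (2 * d) ^ m := one_le_pow₀ (by linarith)
    nlinarith
  set ρ : ℝ := q ^ ((1:ℝ) / ((d - 1 : ℕ) : ℝ)) with hρ
  have hρ0 : 0 < ρ := by positivity
  have hρ1 : ρ ≤ 1 := Real.rpow_le_one hq0.le hq1 (by positivity)
  have hρp : ρ ^ (d - 1) = q := by
    rw [hρ, ← Real.rpow_natCast, ← Real.rpow_mul hq0.le, one_div, inv_mul_cancel₀, Real.rpow_one]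
    rw [hd1]; linarith
  have hlt : ρ / 2 < ‖FF d m l‖ := by
    by_contra hc
    obtain ⟨k, hk⟩ := przy_aux hd hm hρ0 hρ1 (by rw [hρp, hq]; field_simp) (not_lt.1 hc)
    exact hno k hk
  refine ⟨fun h => ?_, ?_⟩
  · rw [h, norm_zero] at hlt; linarith
  · have h1 : Real.log (ρ / 2) ≤ Real.log ‖FF d m l‖ := Real.log_le_log (by positivity) hlt.le
    rw [Real.log_div hρ0.ne' (by norm_num)] at h1
    have h2 : (d - 1) * Real.log ρ = Real.log q := by
      rw [← hρp, Real.log_pow, hd1]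
    have h3 : Real.log q = -Real.log (4 * d) - m * Real.log (2 * d) := by
      rw [hq, Real.log_div (by positivity) (by positivity), Real.log_pow, one_div, Real.log_inv]
    nlinarith
end S17

namespace S17

open MeasureTheory Real Polynomial Filter Topology

noncomputable def ell (d m : ℕ) (l : ℂ) : ℝ := (1 / 2) * Real.log (1 + ‖FF d m l‖ ^ 2)

noncomputable def C0 (d : ℕ) : ℝ := Real.log (4 * 17 ^ d)

lemma C0_nonneg (d : ℕ) : 0 ≤ C0 d := by
  unfold C0
  apply Real.log_nonneg
  have : (1:ℝ) ≤ 17 ^ d := one_le_pow₀ (by norm_num)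
  linarith

lemma l_le {d : ℕ} (hd : 2 ≤ d) (l : ℂ) {m : ℕ} (hm : 1 ≤ m) : ‖l‖ ≤ max 2 ‖FF d m l‖ := by
  by_cases h : ‖l‖ ≤ 2
  · exact le_max_of_le_left h
  · push Not at h
    have hB : BB d ≤ 2 := by
      unfold BB
      calc (2:ℝ) ^ ((1:ℝ) / ((d - 1 : ℕ) : ℝ)) ≤ 2 ^ (1:ℝ) := by
            apply Real.rpow_le_rpow_of_exponent_le (by norm_num)
            have : (1:ℝ) ≤ ((d - 1 : ℕ) : ℝ) := by exact_mod_cast (by omega : 1 ≤ d - 1)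
            rw [div_le_one (by linarith)]; exact this
        _ = 2 := by norm_num
    have := esc_iter hd (j := 1) (l := l) (by rw [FF_one hd]; linarith) (by rw [FF_one hd]) (m - 1)
    rw [show 1 + (m - 1) = m by omega, FF_one hd] at this
    exact le_max_of_le_right this

lemma ell_step {d : ℕ} (hd : 2 ≤ d) (l : ℂ) {m : ℕ} (hm : 1 ≤ m) :
    |ell d (m + 1) l - d * ell d m l| ≤ C0 d := by
  unfold ell C0
  set x := ‖FF d m l‖ with hx
  set y := ‖FF d (m + 1) l‖ with hy
  have hx0 : 0 ≤ x := norm_nonneg _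
  have hy0 : 0 ≤ y := norm_nonneg _
  have hl := l_le hd l hm
  rw [← hx] at hl
  have hup : y ≤ x ^ d + max 2 x := by
    rw [hy, FF_succ]
    refine (norm_add_le _ _).trans ?_
    rw [norm_pow]; linarith
  have hlo : x ^ d - max 2 x ≤ y := by
    have := norm_sub_norm_le (FF d m l ^ d) (-l)
    rw [norm_neg, norm_pow, sub_neg_eq_add, ← FF_succ] at this
    linarith
  have h17 : (17:ℝ) ≤ 17 ^ d := by
    calc (17:ℝ) = 17 ^ 1 := by norm_num
      _ ≤ 17 ^ d := pow_le_pow_right₀ (by norm_num) (by omega)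
  have hA : 1 + y ^ 2 ≤ (4 * 17 ^ d) * (1 + x ^ 2) ^ d := by
    set M := max 1 x with hM
    have hM1 : 1 ≤ M := le_max_left _ _
    have hMd : M ≤ M ^ d := by
      calc M = M ^ 1 := (pow_one _).symm
        _ ≤ M ^ d := pow_le_pow_right₀ hM1 (by omega)
    have h1 : y ≤ 3 * M ^ d := by
      have : x ^ d ≤ M ^ d := by gcongr; exact le_max_right _ _
      have h2 : max 2 x ≤ 2 * M := by
        apply max_le (by linarith); have : x ≤ M := le_max_right _ _; linarith
      linarith
    have h2 : M ^ 2 ≤ 1 + x ^ 2 := by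
      rcases max_cases 1 x with ⟨h, _⟩ | ⟨h, _⟩ <;> rw [hM, h] <;> nlinarith
    have h3 : (M ^ d) ^ 2 ≤ (1 + x ^ 2) ^ d := by
      rw [← pow_mul, mul_comm d 2, pow_mul]; gcongr
    have h4 : 1 ≤ M ^ d := one_le_pow₀ hM1
    have h5 : 1 + y ^ 2 ≤ 17 * (M ^ d) ^ 2 := by nlinarith
    have h6 : 0 ≤ (1 + x ^ 2) ^ d := by positivity
    nlinarith
  have hB : (1 + x ^ 2) ^ d ≤ (4 * 17 ^ d) * (1 + y ^ 2) := by
    by_cases h4 : x ≤ 4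
    · have : (1 + x ^ 2) ^ d ≤ 17 ^ d := by gcongr; nlinarith
      nlinarith [sq_nonneg y]
    · push Not at h4
      have e : max 2 x = x := max_eq_right (by linarith)
      rw [e] at hlo
      have h5 : x ^ d ≥ 4 * x := by
        have : x ^ 2 ≤ x ^ d := pow_le_pow_right₀ (by linarith) hd
        nlinarith
      have h6 : x ^ d ≤ 2 * y := by linarith
      have h7 : (1 + x ^ 2) ^ d ≤ 17 ^ d * (x ^ d) ^ 2 := by
        rw [← pow_mul, mul_comm d 2, pow_mul, ← mul_pow]; gcongr; nlinarith
      have h8 : (x ^ d) ^ 2 ≤ 4 * y ^ 2 := by nlinarith [pow_nonneg hx0 d]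
      nlinarith
  have e1 : Real.log ((1 + x ^ 2) ^ d) = d * Real.log (1 + x ^ 2) := Real.log_pow _ _
  have l1 := Real.log_le_log (by positivity) hA
  have l2 := Real.log_le_log (by positivity) hB
  rw [Real.log_mul (by positivity) (by positivity), e1] at l1
  rw [Real.log_mul (by positivity) (by positivity), e1] at l2
  have := C0_nonneg d
  unfold C0 at this
  rw [abs_le]
  constructor <;> linarith

lemma ell_iter {d : ℕ} (hd : 2 ≤ d) (l : ℂ) {m : ℕ} (hm : 1 ≤ m) (j : ℕ) :
    |ell d (m + j) l - d ^ j * ell d m l| ≤ C0 d * (d ^ j - 1) := by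
  have hdR : (2:ℝ) ≤ d := by exact_mod_cast hd
  induction j with
  | zero => simp
  | succ j ih =>
    have h1 := ell_step hd l (m := m + j) (by omega)
    rw [abs_le] at *
    rw [← add_assoc, pow_succ]
    have := C0_nonneg d
    constructor <;> nlinarith

variable {gI : ℂ → ℝ}

def IsG (d : ℕ) (gI : ℂ → ℝ) : Prop := ∀ lam : ℂ, Filter.Tendsto
      (fun k : ℕ => (1 / 2) * Real.log (1 + ‖(fc d lam)^[k] 0‖ ^ 2) / (d : ℝ) ^ (k - 1))
      Filter.atTop (nhds (gI lam))

lemma g_lim {d : ℕ} (hd : 2 ≤ d) (hg : IsG d gI) (l : ℂ) {m : ℕ} (hm : 1 ≤ m) :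
    Tendsto (fun j : ℕ => ell d (m + j) l / (d:ℝ) ^ j) atTop (𝓝 ((d:ℝ) ^ (m - 1) * gI l)) := by
  have hdR : (2:ℝ) ≤ d := by exact_mod_cast hd
  have h1 := ((hg l).comp (tendsto_add_atTop_nat m)).const_mul ((d:ℝ) ^ (m - 1))
  refine h1.congr fun j => ?_
  simp only [Function.comp]
  rw [show j + m - 1 = (m - 1) + j by omega, pow_add]
  unfold ell FF
  rw [add_comm m j]
  field_simp

lemma ell_g {d : ℕ} (hd : 2 ≤ d) (hg : IsG d gI) (l : ℂ) {m : ℕ} (hm : 1 ≤ m) :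
    |ell d m l - d ^ (m - 1) * gI l| ≤ C0 d := by
  have hdR : (2:ℝ) ≤ d := by exact_mod_cast hd
  have h1 := (tendsto_const_nhds (x := ell d m l)).sub (g_lim hd hg l hm)
  refine le_of_tendsto h1.abs (Eventually.of_forall fun j => ?_)
  have h2 := ell_iter hd l hm j
  have hp : (0:ℝ) < d ^ j := by positivity
  have : ell d m l - ell d (m + j) l / d ^ j = -((ell d (m + j) l - d ^ j * ell d m l) / d ^ j) := by
    field_simp; ring
  rw [this, abs_neg, abs_div, abs_of_pos hp, div_le_iff₀ hp]
  have := C0_nonneg d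
  nlinarith

lemma ell_nonneg (d m : ℕ) (l : ℂ) : 0 ≤ ell d m l := by
  unfold ell
  have := Real.log_nonneg (show (1:ℝ) ≤ 1 + ‖FF d m l‖ ^ 2 by nlinarith [sq_nonneg ‖FF d m l‖])
  linarith

lemma g_nonneg {d : ℕ} (hg : IsG d gI) (l : ℂ) : 0 ≤ gI l := by
  refine ge_of_tendsto (hg l) (Eventually.of_forall fun j => ?_)
  exact div_nonneg (ell_nonneg d j l) (by positivity)

noncomputable def uu (d : ℕ) (gI : ℂ → ℝ) (m : ℕ) (l : ℂ) : ℝ := Real.log ‖FF d m l‖ - d ^ (m - 1) * gI l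

lemma log_le_ell (d m : ℕ) (l : ℂ) : Real.log ‖FF d m l‖ ≤ ell d m l := by
  rcases (norm_nonneg (FF d m l)).eq_or_lt with h | h
  · rw [← h, Real.log_zero]; exact ell_nonneg d m l
  · have : Real.log (‖FF d m l‖ ^ 2) ≤ Real.log (1 + ‖FF d m l‖ ^ 2) :=
      Real.log_le_log (by positivity) (by linarith)
    rw [Real.log_pow] at this
    unfold ell; push_cast at this; linarith

lemma ell_le_log {d m : ℕ} {l : ℂ} (h0 : FF d m l ≠ 0) : min 0 (Real.log ‖FF d m l‖) - 1 ≤ Real.log ‖FF d m l‖ - ell d m l := by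
  have h := norm_pos_iff.2 h0
  unfold ell
  rcases le_total ‖FF d m l‖ 1 with h1 | h1
  · have : Real.log (1 + ‖FF d m l‖ ^ 2) ≤ Real.log 2 := Real.log_le_log (by positivity) (by nlinarith)
    have := Real.log_two_lt_d9
    have := min_le_right 0 (Real.log ‖FF d m l‖)
    linarith
  · have : Real.log (1 + ‖FF d m l‖ ^ 2) ≤ Real.log (2 * ‖FF d m l‖ ^ 2) := Real.log_le_log (by positivity) (by nlinarith)
    rw [Real.log_mul (by norm_num) (by positivity), Real.log_pow] at this
    have := Real.log_two_lt_d9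
    have := min_le_left 0 (Real.log ‖FF d m l‖)
    push_cast at *; linarith

lemma uu_le {d : ℕ} (hd : 2 ≤ d) (hg : IsG d gI) (l : ℂ) {m : ℕ} (hm : 1 ≤ m) : uu d gI m l ≤ C0 d := by
  have h1 := abs_le.1 (ell_g hd hg l hm)
  have h2 := log_le_ell d m l
  unfold uu; linarith

lemma le_uu {d : ℕ} (hd : 2 ≤ d) (hg : IsG d gI) {l : ℂ} {m : ℕ} (hm : 1 ≤ m) (h0 : FF d m l ≠ 0) :
    min 0 (Real.log ‖FF d m l‖) - 1 - C0 d ≤ uu d gI m l := by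
  have h1 := abs_le.1 (ell_g hd hg l hm)
  have h2 := ell_le_log h0
  unfold uu; linarith

end S17

namespace S17

open MeasureTheory Real Polynomial Filter Topology

lemma FF_diff (d m : ℕ) : Differentiable ℂ (FF d m) := fun l =>
  (F_hasDerivAt d m l).differentiableAt

lemma FF_cont (d m : ℕ) : Continuous (FF d m) := (FF_diff d m).continuous

lemma S_diffOn {d k : ℕ} (hd : 2 ≤ d) : DifferentiableOn ℂ (S d k) (U d k) := fun l hl => by
  obtain ⟨s', -, h⟩ := S_deriv hd hl
  exact h.differentiableAt.differentiableWithinAt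

lemma exists_N {d k m : ℕ} (hd : 2 ≤ d) (hm : 0 < m) :
    ∃ N : ℂ → ℂ, DifferentiableOn ℂ N (U d k) ∧ (∀ l ∈ U d k, N l ≠ 0) ∧
      ∀ l ∈ U d k, S d k l ≠ 0 → ‖FF d m l‖ = ‖N l‖ * ‖S d k l‖ ^ (if k ∣ m then 1 else 0) := by
  by_cases hkm : k ∣ m
  · classical
    refine ⟨fun l => if S d k l = 0 then deriv (FF d m) l / deriv (S d k) l else FF d m l / S d k l, ?_, ?_, ?_⟩
    · intro l hl
      apply DifferentiableAt.differentiableWithinAt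
      have hUn := (U_open d k).mem_nhds hl
      by_cases h0 : S d k l = 0
      · obtain ⟨s', hs', hS⟩ := S_deriv hd hl
        have hF0 : FF d m l = 0 := U_S_zero hd hl hkm h0
        have d1 : DifferentiableAt ℂ (dslope (S d k) l) l :=
          ((Complex.differentiableOn_dslope hUn).2 (S_diffOn hd)).differentiableAt hUn
        have d2 : DifferentiableAt ℂ (dslope (FF d m) l) l :=
          ((Complex.differentiableOn_dslope univ_mem).2 (FF_diff d m).differentiableOn).differentiableAt univ_mem
        have hne : dslope (S d k) l l ≠ 0 := by rw [dslope_same, hS.deriv]; exact hs'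
        refine (d2.div d1 hne).congr_of_eventuallyEq ?_
        filter_upwards [d1.continuousAt.eventually_ne hne] with x hx
        by_cases hxl : x = l
        · subst hxl; simp [h0, dslope_same]
        · have e1 : dslope (S d k) l x = S d k x / (x - l) := by
            rw [dslope_of_ne _ hxl, slope_def_field, h0, sub_zero]
          have e2 : dslope (FF d m) l x = FF d m x / (x - l) := by
            rw [dslope_of_ne _ hxl, slope_def_field, hF0, sub_zero]
          have hx0 : S d k x ≠ 0 := by
            intro h; rw [e1, h, zero_div] at hx; exact hx rfl
          have : x - l ≠ 0 := sub_ne_zero.2 hxl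
          rw [if_neg hx0, Pi.div_apply, e1, e2]
          field_simp
      · have hdS : DifferentiableAt ℂ (S d k) l := (S_diffOn hd).differentiableAt hUn
        refine (((FF_diff d m) l).div hdS h0).congr_of_eventuallyEq ?_
        filter_upwards [hdS.continuousAt.eventually_ne h0] with x hx
        rw [if_neg hx]; rfl
    · intro l hl
      by_cases h0 : S d k l = 0
      · simp only [h0, if_true]
        obtain ⟨s', hs', hS⟩ := S_deriv hd hl
        have hF0 : FF d m l = 0 := U_S_zero hd hl hkm h0
        have : deriv (FF d m) l = dF d l m := (F_hasDerivAt d m l).deriv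
        rw [this, hS.deriv]
        exact div_ne_zero (gleason hd hm hF0) hs'
      · simp only [h0, if_false]
        exact div_ne_zero (fun h => h0 (U_F_zero hd hm hl h).2) h0
    · intro l hl h0
      simp only [h0, if_false, hkm, if_true, pow_one, norm_div]
      rw [div_mul_cancel₀ _ (norm_ne_zero_iff.2 h0)]
  · refine ⟨FF d m, (FF_diff d m).differentiableOn, fun l hl h => hkm (U_F_zero hd hm hl h).1, fun l hl h0 => ?_⟩
    simp [hkm]

lemma maxp_aux {d k : ℕ} (hd : 2 ≤ d) (hk : 0 < k) {H : ℂ → ℂ} (hH : DifferentiableOn ℂ H (U d k)) {M t : ℝ}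
    (ht : t < 1) (h : ∀ l ∈ U d k, t < ‖S d k l‖ → ‖H l‖ ≤ M) : ∀ l ∈ U d k, ‖H l‖ ≤ M := by
  intro l hl
  obtain ⟨t', ht1, ht2⟩ := exists_between (max_lt ht (S_norm_lt hd hl))
  have hta := (le_max_left _ _).trans_lt ht1
  have htb := (le_max_right _ _).trans_lt ht1
  have ht0 : 0 ≤ t' := (norm_nonneg _).trans htb.le
  set V : Set ℂ := {x | x ∈ U d k ∧ ‖S d k x‖ < t'} with hV
  have hcp := U_compact hd hk ht0 ht2
  have hVsub : closure V ⊆ {x | x ∈ U d k ∧ ‖S d k x‖ ≤ t'} :=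
    closure_minimal (fun x hx => ⟨hx.1, hx.2.le⟩) hcp.isClosed
  have hVo : IsOpen V := by
    have := (S_diffOn (k := k) hd).continuousOn.norm.isOpen_inter_preimage (U_open d k) (isOpen_Iio (a := t'))
    exact this
  have hVb : Bornology.IsBounded V := hcp.isBounded.subset (fun x hx => ⟨hx.1, hx.2.le⟩)
  refine Complex.norm_le_of_forall_mem_frontier_norm_le hVb
    (DifferentiableOn.diffContOnCl (hH.mono fun x hx => (hVsub hx).1)) ?_ (subset_closure (⟨hl, htb⟩ : l ∈ V))
  intro x hx
  rw [hVo.frontier_eq] at hx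
  have h1 := hVsub hx.1
  have h2 : ¬ ‖S d k x‖ < t' := fun h => hx.2 ⟨h1.1, h⟩
  exact h x h1.1 (by linarith)

lemma maxp {d k : ℕ} (hd : 2 ≤ d) (hk : 0 < k) {H A B : ℂ → ℂ} (hH : DifferentiableOn ℂ H (U d k))
    (hA : Continuous A) (hB : Continuous B) (a : ℕ) {M : ℝ} (hM : 0 ≤ M)
    (hle : ∀ l ∈ U d k, S d k l ≠ 0 → ‖H l‖ * ‖B l‖ * ‖S d k l‖ ^ a ≤ ‖A l‖)
    (hbd : ∀ l ∈ closure (U d k), l ∉ U d k → B l ≠ 0 ∧ ‖A l‖ ≤ M * ‖B l‖) :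
    ∀ l ∈ U d k, ‖H l‖ ≤ M := by
  have key : ∀ ε : ℝ, 0 < ε → ∀ l ∈ U d k, ‖H l‖ ≤ (1 + ε) * (M + ε) := by
    intro ε hε
    -- bad set
    set K : Set ℂ := closure (U d k) ∩ {l | (M + ε) * ‖B l‖ ≤ ‖A l‖} with hK
    have hKc : IsCompact K := by
      have hb : Bornology.IsBounded (closure (U d k)) :=
        (Metric.isBounded_ball.subset (U_bdd hd)).closure
      refine (Metric.isCompact_of_isClosed_isBounded isClosed_closure hb).inter_right ?_
      exact isClosed_le (by fun_prop) (by fun_prop)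
    have hKU : K ⊆ U d k := by
      rintro l ⟨h1, h2⟩
      by_contra hc
      obtain ⟨h3, h4⟩ := hbd l h1 hc
      have h2' : (M + ε) * ‖B l‖ ≤ ‖A l‖ := h2
      have := norm_pos_iff.2 h3
      nlinarith
    obtain ⟨t0, ht0, ht0'⟩ : ∃ t0 : ℝ, t0 < 1 ∧ ∀ l ∈ K, ‖S d k l‖ ≤ t0 := by
      rcases K.eq_empty_or_nonempty with he | hne
      · exact ⟨0, one_pos, by simp [he]⟩
      · obtain ⟨x, hx, hmax⟩ := hKc.exists_isMaxOn hne
          (f := fun x => ‖S d k x‖) (((S_diffOn hd).continuousOn.mono hKU).norm)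
        exact ⟨_, S_norm_lt hd (hKU hx), fun y hy => hmax hy⟩
    obtain ⟨t1, ht1, ht1', ht10⟩ : ∃ t1 : ℝ, t1 < 1 ∧ 1 ≤ (1 + ε) * t1 ^ a ∧ 0 < t1 := by
      have hc : Tendsto (fun t : ℝ => (1 + ε) * t ^ a) (𝓝[<] 1) (𝓝 ((1 + ε) * 1 ^ a)) :=
        (Continuous.tendsto (by fun_prop) _).mono_left nhdsWithin_le_nhds
      have h1 : ∀ᶠ t in 𝓝[<] (1:ℝ), 1 < (1 + ε) * t ^ a := hc.eventually (lt_mem_nhds (by simp [hε]))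
      have h2 : ∀ᶠ t in 𝓝[<] (1:ℝ), 0 < t := nhdsWithin_le_nhds (lt_mem_nhds one_pos)
      obtain ⟨t, ⟨ha, hb⟩, hc⟩ := ((h1.and h2).and self_mem_nhdsWithin).exists
      exact ⟨t, hc, ha.le, hb⟩
    apply maxp_aux hd hk hH (max_lt ht0 ht1)
    intro l hl htl
    have hta := (le_max_left _ _).trans_lt htl
    have htb := (le_max_right _ _).trans_lt htl
    have hS0 : S d k l ≠ 0 := norm_pos_iff.1 (ht10.trans htb)
    have h1 := hle l hl hS0
    have h2 : ‖A l‖ < (M + ε) * ‖B l‖ := by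
      by_contra hc
      exact absurd (ht0' l ⟨subset_closure hl, not_lt.1 hc⟩) (not_le.2 hta)
    have hBpos : 0 < ‖B l‖ := by
      by_contra hc
      have : ‖B l‖ = 0 := le_antisymm (not_lt.1 hc) (norm_nonneg _)
      rw [this, mul_zero] at h2
      exact absurd (norm_nonneg (A l)) (not_le.2 h2)
    have h3 : 1 ≤ (1 + ε) * ‖S d k l‖ ^ a := ht1'.trans (by gcongr)
    have h4 : ‖H l‖ * ‖B l‖ ≤ (1 + ε) * ((M + ε) * ‖B l‖) := by
      calc ‖H l‖ * ‖B l‖ = ‖H l‖ * ‖B l‖ * 1 := (mul_one _).symm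
        _ ≤ ‖H l‖ * ‖B l‖ * ((1 + ε) * ‖S d k l‖ ^ a) := by gcongr
        _ = (1 + ε) * (‖H l‖ * ‖B l‖ * ‖S d k l‖ ^ a) := by ring
        _ ≤ _ := mul_le_mul_of_nonneg_left (h1.trans h2.le) (by positivity)
    rw [← mul_assoc] at h4
    exact le_of_mul_le_mul_right h4 hBpos
  intro l hl
  have hc : Tendsto (fun ε : ℝ => (1 + ε) * (M + ε)) (𝓝[>] 0) (𝓝 ((1 + 0) * (M + 0))) :=
    (Continuous.tendsto (by fun_prop) _).mono_left nhdsWithin_le_nhds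
  rw [add_zero, add_zero, one_mul] at hc
  refine ge_of_tendsto hc ?_
  filter_upwards [self_mem_nhdsWithin] with ε hε using key ε hε l hl

end S17

namespace S17

open MeasureTheory Real Polynomial Filter Topology

noncomputable def ee (d m : ℕ) : ℝ :=
  (m * Real.log (2 * d) + Real.log (4 * d) + (d - 1) * Real.log 2) / (d - 1)

lemma ee_nonneg {d : ℕ} (hd : 2 ≤ d) (m : ℕ) : 0 ≤ ee d m := by
  have hd' : (2:ℝ) ≤ d := by exact_mod_cast hd
  have h1 : 0 ≤ Real.log (2 * d) := Real.log_nonneg (by linarith)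
  have h2 : 0 ≤ Real.log (4 * d) := Real.log_nonneg (by linarith)
  have h3 : 0 ≤ Real.log 2 := Real.log_nonneg (by norm_num)
  have h4 : (0:ℝ) ≤ d - 1 := by linarith
  unfold ee
  positivity

lemma off_log {d m : ℕ} (hd : 2 ≤ d) (hm : 1 ≤ m) {l : ℂ} (hno : ∀ k, l ∉ U d k) :
    FF d m l ≠ 0 ∧ -ee d m ≤ Real.log ‖FF d m l‖ := by
  have hd' : (2:ℝ) ≤ d := by exact_mod_cast hd
  obtain ⟨h1, h2⟩ := przy hd hm hno
  refine ⟨h1, ?_⟩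
  unfold ee
  rw [neg_le, le_div_iff₀ (by linarith)]
  nlinarith

lemma off_ell {d m : ℕ} (hd : 2 ≤ d) (hm : 1 ≤ m) {l : ℂ} (hno : ∀ k, l ∉ U d k) :
    ell d m l ≤ Real.log ‖FF d m l‖ + 1 + ee d m := by
  obtain ⟨h1, h2⟩ := off_log hd hm hno
  have h3 := ell_le_log (d := d) (m := m) (l := l) h1
  have h4 : -ee d m ≤ min 0 (Real.log ‖FF d m l‖) := le_min (by linarith [ee_nonneg hd m]) h2
  linarith

lemma ell_D {d m : ℕ} (hd : 2 ≤ d) (hm : 1 ≤ m) (l : ℂ) (j : ℕ) :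
    |ell d (m + j) l - (d:ℝ) ^ j * ell d m l| ≤ (d:ℝ) ^ j * C0 d := by
  refine (ell_iter hd l hm j).trans ?_
  have := C0_nonneg d
  nlinarith

lemma norm_le_exp_mul {x y M : ℝ} (hy : 0 < y) (hx : 0 ≤ x) (h : 0 < x → Real.log x ≤ M + Real.log y) :
    x ≤ Real.exp M * y := by
  rcases hx.eq_or_lt with h0 | h0
  · rw [← h0]; positivity
  · rw [← Real.exp_log h0]
    calc Real.exp (Real.log x) ≤ Real.exp (M + Real.log y) := Real.exp_le_exp.2 (h h0)
      _ = _ := by rw [Real.exp_add, Real.exp_log hy]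

/-- `log |F_m|` with the zero of `S` removed -/
noncomputable def xx (d k m : ℕ) (l : ℂ) : ℝ :=
  Real.log ‖FF d m l‖ - (if k ∣ m then 1 else 0) * Real.log ‖S d k l‖

lemma pw {s : ℝ} (h0 : 0 ≤ s) (h1 : s ≤ 1) {a b : ℕ} (h : a ≤ b) : s ^ b ≤ s ^ a :=
  pow_le_pow_of_le_one h0 h1 h

lemma xx_bounds {d k m : ℕ} (hd : 2 ≤ d) (hk : 0 < k) (hm : 1 ≤ m) (j : ℕ) {l : ℂ}
    (hl : l ∈ U d k) (hS : S d k l ≠ 0) :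
    (d:ℝ) ^ j * xx d k m l - xx d k (m + j) l ≤ (d:ℝ) ^ j * C0 d + 1 + ee d (m + j) ∧
    xx d k (m + j) l - (d:ℝ) ^ j * xx d k m l ≤ (d:ℝ) ^ j * (C0 d + 1 + ee d m) ∧
    -ee d (m + j) ≤ xx d k (m + j) l := by
  obtain ⟨N, hN, hN0, hNF⟩ := exists_N (k := k) hd (show 0 < m by omega)
  obtain ⟨Q, hQ, hQ0, hQF⟩ := exists_N (k := k) hd (show 0 < m + j by omega)
  set D := d ^ j with hD
  have hDr : ((D:ℕ):ℝ) = (d:ℝ) ^ j := by rw [hD]; push_cast; rfl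
  have hD1 : 1 ≤ D := Nat.one_le_pow _ _ (by omega)
  have xN : ∀ x ∈ U d k, S d k x ≠ 0 → xx d k m x = Real.log ‖N x‖ := by
    intro x hx hs
    unfold xx
    rw [hNF x hx hs, Real.log_mul (norm_ne_zero_iff.2 (hN0 x hx)) (pow_ne_zero _ (norm_ne_zero_iff.2 hs)), Real.log_pow]
    push_cast; ring
  have xQ : ∀ x ∈ U d k, S d k x ≠ 0 → xx d k (m + j) x = Real.log ‖Q x‖ := by
    intro x hx hs
    unfold xx
    rw [hQF x hx hs, Real.log_mul (norm_ne_zero_iff.2 (hQ0 x hx)) (pow_ne_zero _ (norm_ne_zero_iff.2 hs)), Real.log_pow]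
    push_cast; ring
  rw [xN l hl hS, xQ l hl hS, ← hDr]
  have hno : ∀ x ∈ closure (U d k), x ∉ U d k → ∀ i, x ∉ U d i := fun x hx hx' i =>
    frontier_no_att hd hx hx'
  have hn0 := norm_pos_iff.2 (hN0 l hl)
  have hq0 := norm_pos_iff.2 (hQ0 l hl)
  refine ⟨?_, ?_, ?_⟩
  · have := maxp hd hk (H := fun x => N x ^ D / Q x) (A := fun x => FF d m x ^ D) (B := FF d (m + j))
      ((hN.pow D).div hQ hQ0) ((FF_cont d m).pow D) (FF_cont d (m + j)) D
      (M := Real.exp ((D:ℝ) * C0 d + 1 + ee d (m + j))) (Real.exp_pos _).le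
      (by
        intro x hx hs
        rw [norm_div, norm_pow, norm_pow, hNF x hx hs, hQF x hx hs]
        have hs1 := (S_norm_lt hd hx).le
        have hs0 := norm_nonneg (S d k x)
        have hq := norm_pos_iff.2 (hQ0 x hx)
        have e : ‖N x‖ ^ D / ‖Q x‖ * (‖Q x‖ * ‖S d k x‖ ^ (if k ∣ m + j then 1 else 0)) * ‖S d k x‖ ^ D
          = ‖N x‖ ^ D * ‖S d k x‖ ^ ((if k ∣ m + j then 1 else 0) + D) := by
          rw [pow_add]; field_simp
        rw [e, mul_pow, ← pow_mul]
        refine mul_le_mul_of_nonneg_left (pw hs0 hs1 ?_) (by positivity)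
        split_ifs <;> omega)
      (by
        intro x hx hx'
        have ho := hno x hx hx'
        have h1 := off_log hd (show 1 ≤ m + j by omega) ho
        refine ⟨h1.1, ?_⟩
        rw [norm_pow]
        apply norm_le_exp_mul (norm_pos_iff.2 h1.1) (by positivity)
        intro _
        rw [Real.log_pow]
        have h2 := off_ell hd (show 1 ≤ m + j by omega) ho
        have h3 := (abs_le.1 (ell_D hd hm x j)).1
        have h4 := mul_le_mul_of_nonneg_left (log_le_ell d m x) (Nat.cast_nonneg (α := ℝ) D)
        rw [← hDr] at h3
        linarith) l hl
    rw [norm_div, norm_pow, ← Real.log_le_iff_le_exp (by positivity), Real.log_div (by positivity) hq0.ne', Real.log_pow] at this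
    exact this
  · have := maxp hd hk (H := fun x => Q x / N x ^ D) (B := fun x => FF d m x ^ D) (A := FF d (m + j))
      (hQ.div (hN.pow D) (fun x hx => pow_ne_zero _ (hN0 x hx))) (FF_cont d (m + j)) ((FF_cont d m).pow D) 1
      (M := Real.exp ((D:ℝ) * (C0 d + 1 + ee d m))) (Real.exp_pos _).le
      (by
        intro x hx hs
        rw [norm_div, norm_pow, norm_pow, hNF x hx hs, hQF x hx hs]
        have hs1 := (S_norm_lt hd hx).le
        have hs0 := norm_nonneg (S d k x)
        have hq := norm_pos_iff.2 (hN0 x hx)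
        have e : ‖Q x‖ / ‖N x‖ ^ D * (‖N x‖ * ‖S d k x‖ ^ (if k ∣ m then 1 else 0)) ^ D * ‖S d k x‖ ^ 1
          = ‖Q x‖ * ‖S d k x‖ ^ ((if k ∣ m then 1 else 0) * D + 1) := by
          rw [pow_add, pow_mul, mul_pow]; field_simp
        rw [e]
        refine mul_le_mul_of_nonneg_left (pw hs0 hs1 ?_) (by positivity)
        split_ifs <;> omega)
      (by
        intro x hx hx'
        have ho := hno x hx hx'
        have h1 := off_log hd hm ho
        refine ⟨pow_ne_zero _ h1.1, ?_⟩
        rw [norm_pow]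
        apply norm_le_exp_mul (pow_pos (norm_pos_iff.2 h1.1) _) (by positivity)
        intro _
        rw [Real.log_pow]
        have h2 := off_ell hd hm ho
        have h3 := (abs_le.1 (ell_D hd hm x j)).2
        have h4 := mul_le_mul_of_nonneg_left h2 (Nat.cast_nonneg (α := ℝ) D)
        have h5 := log_le_ell d (m + j) x
        rw [← hDr] at h3
        linarith) l hl
    rw [norm_div, norm_pow, ← Real.log_le_iff_le_exp (by positivity), Real.log_div hq0.ne' (by positivity), Real.log_pow] at this
    exact this
  · have := maxp hd hk (H := fun x => (Q x)⁻¹) (B := FF d (m + j)) (A := fun _ => 1)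
      (hQ.inv hQ0) continuous_const (FF_cont d (m + j)) 0
      (M := Real.exp (ee d (m + j))) (Real.exp_pos _).le
      (by
        intro x hx hs
        rw [norm_inv, norm_one, hQF x hx hs]
        have hs1 := (S_norm_lt hd hx).le
        have hs0 := norm_nonneg (S d k x)
        have hq := norm_pos_iff.2 (hQ0 x hx)
        rw [pow_zero, mul_one, inv_mul_cancel_left₀ hq.ne']
        exact pow_le_one₀ hs0 hs1)
      (by
        intro x hx hx'
        have ho := hno x hx hx'
        have h1 := off_log hd (show 1 ≤ m + j by omega) ho
        refine ⟨h1.1, ?_⟩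
        apply norm_le_exp_mul (norm_pos_iff.2 h1.1) (by positivity)
        intro _
        rw [norm_one, Real.log_one]
        linarith [h1.2]) l hl
    rw [norm_inv, ← Real.log_le_iff_le_exp (by positivity), Real.log_inv] at this
    linarith

lemma ee_lim {d m : ℕ} (hd : 2 ≤ d) (c : ℝ) :
    Tendsto (fun j : ℕ => (c + ee d (m + j)) / (d:ℝ) ^ j) atTop (𝓝 0) := by
  have hd' : (1:ℝ) < d := by exact_mod_cast (by omega : 1 < d)
  have h0 := tendsto_pow_const_div_const_pow_of_one_lt 0 hd'
  have h1 := tendsto_pow_const_div_const_pow_of_one_lt 1 hd'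
  have h := (h1.const_mul (Real.log (2 * d) / (d - 1))).add (h0.const_mul (c + ee d m))
  rw [mul_zero, mul_zero, add_zero] at h
  refine h.congr fun j => ?_
  have : (d:ℝ) - 1 ≠ 0 := by linarith
  unfold ee
  push_cast
  field_simp
  ring

lemma xx_lim {d k m : ℕ} (hd : 2 ≤ d) (hk : 0 < k) {gI : ℂ → ℝ} (hg : IsG d gI) (hm : 1 ≤ m) {l : ℂ}
    (hl : l ∈ U d k) (hS : S d k l ≠ 0) :
    Tendsto (fun j => xx d k (m + j) l / (d:ℝ) ^ j) atTop (𝓝 ((d:ℝ) ^ (m - 1) * gI l)) := by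
  have hd' : (1:ℝ) < d := by exact_mod_cast (by omega : 1 < d)
  have hgl := g_lim hd hg l hm
  have hs : Real.log ‖S d k l‖ ≤ 0 := Real.log_nonpos (norm_nonneg _) (S_norm_lt hd hl).le
  have h1 := hgl.sub (ee_lim (m := m) hd (1 - Real.log ‖S d k l‖))
  have h2 := hgl.add (ee_lim (m := m) hd (- Real.log ‖S d k l‖))
  rw [sub_zero] at h1
  rw [add_zero] at h2
  refine tendsto_of_tendsto_of_tendsto_of_le_of_le h1 h2 ?_ ?_
  · intro j
    have hp : (0:ℝ) < (d:ℝ) ^ j := by positivity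
    simp only
    rw [← sub_div]
    gcongr
    have h3 := (xx_bounds hd hk hm j hl hS).2.2
    have hF : FF d (m + j) l ≠ 0 := fun h => hS (U_F_zero hd (by omega) hl h).2
    have h4 := ell_le_log (d := d) (m := m + j) (l := l) hF
    have he := ee_nonneg hd (m + j)
    unfold xx at h3 ⊢
    rcases min_choice 0 (Real.log ‖FF d (m + j) l‖) with h5 | h5 <;> rw [h5] at h4 <;>
    split_ifs at h3 ⊢ <;> linarith
  · intro j
    have hp : (0:ℝ) < (d:ℝ) ^ j := by positivity
    simp only
    rw [← add_div]
    gcongr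
    have h4 := log_le_ell d (m + j) l
    have he := ee_nonneg hd (m + j)
    unfold xx
    split_ifs <;> linarith

lemma U_uu {d k m : ℕ} (hd : 2 ≤ d) (hk : 0 < k) {gI : ℂ → ℝ} (hg : IsG d gI) (hm : 1 ≤ m) {l : ℂ}
    (hl : l ∈ U d k) (hS : S d k l ≠ 0) :
    |uu d gI m l - (if k ∣ m then 1 else 0) * Real.log ‖S d k l‖| ≤ C0 d + 1 + ee d m := by
  have hd' : (1:ℝ) < d := by exact_mod_cast (by omega : 1 < d)
  have e : uu d gI m l - (if k ∣ m then 1 else 0) * Real.log ‖S d k l‖ = xx d k m l - (d:ℝ) ^ (m - 1) * gI l := by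
    unfold uu xx; ring
  rw [e]
  have hL := xx_lim hd hk hg hm hl hS
  have hE := ee_lim (m := m) hd 1
  rw [abs_le]
  constructor
  · have : (d:ℝ) ^ (m - 1) * gI l ≤ xx d k m l + (C0 d + 1 + ee d m) := by
      refine le_of_tendsto hL (Eventually.of_forall fun j => ?_)
      have hp : (0:ℝ) < (d:ℝ) ^ j := by positivity
      rw [div_le_iff₀ hp]
      linarith [(xx_bounds hd hk hm j hl hS).2.1]
    linarith
  · have h2 := (hL.add hE).add_const (C0 d)
    have : xx d k m l ≤ (d:ℝ) ^ (m - 1) * gI l + 0 + C0 d := by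
      refine ge_of_tendsto h2 (Eventually.of_forall fun j => ?_)
      have hp : (0:ℝ) < (d:ℝ) ^ j := by positivity
      rw [← add_div, ← sub_le_iff_le_add, le_div_iff₀ hp]
      linarith [(xx_bounds hd hk hm j hl hS).1]
    linarith [ee_nonneg hd m]

lemma off_uu {d m : ℕ} (hd : 2 ≤ d) {gI : ℂ → ℝ} (hg : IsG d gI) (hm : 1 ≤ m) {l : ℂ}
    (hno : ∀ k, l ∉ U d k) : |uu d gI m l| ≤ C0 d + 1 + ee d m := by
  obtain ⟨h1, h2⟩ := off_log hd hm hno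
  have h3 := uu_le hd hg l hm
  have h4 := le_uu hd hg hm h1
  have h5 : -ee d m ≤ min 0 (Real.log ‖FF d m l‖) := le_min (by linarith [ee_nonneg hd m]) h2
  rw [abs_le]
  constructor <;> linarith [ee_nonneg hd m]

end S17

namespace S17

open MeasureTheory Real Polynomial Filter Topology

lemma moeb_sum {n k : ℕ} (hn : 0 < n) :
    (∑ m ∈ n.divisors, (ArithmeticFunction.moebius (n / m) : ℝ) * (if k ∣ m then 1 else 0)) =
      if n = k then 1 else 0 := by
  have h := (ArithmeticFunction.sum_eq_iff_sum_mul_moebius_eq (R := ℝ)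
    (f := fun n => if n = k then 1 else 0) (g := fun n => if k ∣ n then 1 else 0)).1 (by
      intro m hm
      rw [Finset.sum_ite_eq']
      simp [hm.ne']) n hn
  rw [← h, Nat.sum_divisorsAntidiagonal' (f := fun a b => (ArithmeticFunction.moebius a : ℝ) * (if k ∣ b then 1 else 0))]

noncomputable def IT (d : ℕ) (l : ℂ) : ℕ → ℂ[X]
  | 0 => X
  | (m + 1) => (IT d l m) ^ d + C l

lemma IT_eval (d : ℕ) (l : ℂ) (m : ℕ) (z : ℂ) : (IT d l m).eval z = (fc d l)^[m] z := by
  induction m with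
  | zero => simp [IT]
  | succ m ih => simp [IT, ih, Function.iterate_succ_apply', fc]

lemma IT_monic {d : ℕ} (hd : 2 ≤ d) (l : ℂ) (m : ℕ) : (IT d l m).Monic ∧ (IT d l m).natDegree = d ^ m := by
  induction m with
  | zero => simp [IT, monic_X]
  | succ m ih =>
    have h1 : ((IT d l m) ^ d).Monic := ih.1.pow d
    have h2 : ((IT d l m) ^ d).natDegree = d ^ (m + 1) := by
      rw [ih.1.natDegree_pow, ih.2, pow_succ, mul_comm]
    have h3 : 0 < d ^ (m + 1) := by positivity
    refine ⟨?_, ?_⟩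
    · apply h1.add_of_left
      refine degree_C_le.trans_lt ?_
      rw [← natDegree_pos_iff_degree_pos, h2]; exact h3
    · simp only [IT]; rw [natDegree_add_C, h2]

noncomputable def PP (d : ℕ) (l : ℂ) (m : ℕ) : ℂ[X] := IT d l m - X

lemma PP_eval (d : ℕ) (l : ℂ) (m : ℕ) (z : ℂ) : (PP d l m).eval z = (fc d l)^[m] z - z := by
  simp [PP, IT_eval]

lemma PP_monic {d m : ℕ} (hd : 2 ≤ d) (l : ℂ) (hm : 0 < m) : (PP d l m).Monic ∧ (PP d l m).natDegree = d ^ m := by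
  obtain ⟨h1, h2⟩ := IT_monic hd l m
  have h3 : 1 < d ^ m := Nat.one_lt_pow hm.ne' (by omega)
  have h4 : (X : ℂ[X]).degree < (IT d l m).degree := by
    rw [degree_X, degree_eq_natDegree h1.ne_zero, h2]; exact_mod_cast h3
  refine ⟨h1.sub_of_left h4, ?_⟩
  unfold PP
  rw [natDegree_sub_eq_left_of_natDegree_lt, h2]
  rw [natDegree_X, h2]; exact h3

lemma PP_deriv (d m : ℕ) (l z : ℂ) : (PP d l m).derivative.eval z = mul d m l z - 1 := by
  have h1 : HasDerivAt (fun z => (PP d l m).eval z) (mul d m l z - 1) z := by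
    have := (iter_hasDerivAt d m l z).sub (hasDerivAt_id z)
    refine this.congr_of_eventuallyEq (Eventually.of_forall fun x => ?_)
    simp [PP_eval]
  exact ((PP d l m).hasDerivAt z).unique h1

lemma PP_count {d m k : ℕ} (hd : 2 ≤ d) {l z : ℂ} (hm : 0 < m) (h : Att d k l z) :
    (PP d l m).roots.count z = if k ∣ m then 1 else 0 := by
  rw [count_roots]
  have hne := (PP_monic hd l hm).1.ne_zero
  split_ifs with hkm
  · obtain ⟨q, rfl⟩ := hkm
    have hq : q ≠ 0 := by rintro rfl; simp at hm
    have hr : (PP d l (k * q)).IsRoot z := by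
      rw [IsRoot.def, PP_eval, sub_eq_zero]
      have : Function.IsPeriodicPt (fc d l) k z := h.per
      exact this.mul_const q
    have h1 := (rootMultiplicity_pos hne).2 hr
    have h2 : ¬ 1 < (PP d l (k * q)).rootMultiplicity z := by
      rw [one_lt_rootMultiplicity_iff_isRoot hne]
      rintro ⟨-, h3⟩
      rw [IsRoot.def, PP_deriv, sub_eq_zero, mul_mul_period _ _ _ _ _ h.per] at h3
      have h4 : ‖mul d k l z ^ q‖ < 1 := by
        rw [norm_pow]; exact pow_lt_one₀ (norm_nonneg _) h.2.2 hq
      rw [h3, norm_one] at h4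
      exact lt_irrefl _ h4
    omega
  · apply rootMultiplicity_eq_zero
    intro hr
    rw [IsRoot.def, PP_eval, sub_eq_zero] at hr
    apply hkm
    rw [← h.2.1]
    exact Function.IsPeriodicPt.minimalPeriod_dvd hr

lemma norm_eval_roots {P : ℂ[X]} (hP : P.Monic) (z : ℂ) :
    ‖P.eval z‖ = (P.roots.map fun w => ‖z - w‖).prod := by
  have h := (IsAlgClosed.splits P).eval_eq_prod_roots_of_monic hP z
  rw [h]
  have := map_multiset_prod (normHom : ℂ →*₀ ℝ) (P.roots.map fun x => z - x)
  rw [Multiset.map_map] at this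
  exact this

lemma resultant_swap {P Q : ℂ[X]} (hP : P.Monic) (hQ : Q.Monic) :
    (P.roots.map fun z => ‖Q.eval z‖).prod = (Q.roots.map fun w => ‖P.eval w‖).prod := by
  simp_rw [norm_eval_roots hP, norm_eval_roots hQ]
  rw [Multiset.prod_map_prod_map]
  simp_rw [norm_sub_rev]

lemma prod_root_iter {d m : ℕ} (hd : 2 ≤ d) (l : ℂ) (hm : 0 < m) (j : ℕ) :
    ((PP d l m).roots.map fun z => ‖(fc d l)^[j] z‖).prod = ‖FF d m l‖ := by
  have hlt : ∀ j < m, ((PP d l m).roots.map fun z => ‖(fc d l)^[j] z‖).prod = ‖FF d m l‖ := by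
    intro j hj
    have h := resultant_swap (PP_monic hd l hm).1 (IT_monic hd l j).1
    simp_rw [IT_eval] at h
    rw [h]
    have h2 : ((IT d l j).roots.map fun w => ‖(PP d l m).eval w‖)
        = (IT d l j).roots.map fun w => ‖(fc d l)^[m - j] 0 - w‖ := by
      refine Multiset.map_congr rfl fun w hw => ?_
      have hw' := (mem_roots (IT_monic hd l j).1.ne_zero).1 hw
      rw [IsRoot.def, IT_eval] at hw'
      rw [PP_eval, show m = (m - j) + j by omega, Function.iterate_add_apply, hw']
      simp
    rw [h2, ← norm_eval_roots (IT_monic hd l j).1, IT_eval, ← Function.iterate_add_apply]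
    rw [show j + (m - j) = m by omega]; rfl
  rw [← hlt (j % m) (Nat.mod_lt _ hm)]
  congr 1
  refine Multiset.map_congr rfl fun z hz => ?_
  have hz' := (mem_roots (PP_monic hd l hm).1.ne_zero).1 hz
  rw [IsRoot.def, PP_eval, sub_eq_zero] at hz'
  have : Function.IsPeriodicPt (fc d l) m z := hz'
  rw [this.iterate_mod_apply]

end S17

namespace S17

open MeasureTheory Real Polynomial Filter Topology

lemma log_mprod (s : Multiset ℂ) (h : ℂ → ℝ) (hne : ∀ z ∈ s, h z ≠ 0) :
    Real.log (s.map h).prod = (s.map fun z => Real.log (h z)).sum := by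
  induction s using Multiset.induction with
  | empty => simp
  | cons a s ih =>
    have h1 : ∀ z ∈ s, h z ≠ 0 := fun z hz => hne z (Multiset.mem_cons_of_mem hz)
    have h2 : (s.map h).prod ≠ 0 := by
      intro h0
      rw [Multiset.prod_eq_zero_iff, Multiset.mem_map] at h0
      obtain ⟨z, hz, hz0⟩ := h0
      exact h1 z hz hz0
    rw [Multiset.map_cons, Multiset.prod_cons, Multiset.map_cons, Multiset.sum_cons,
      Real.log_mul (hne a (Multiset.mem_cons_self a s)) h2, ih h1]

lemma root_iter_ne {d m : ℕ} (hd : 2 ≤ d) {l : ℂ} (hm : 0 < m) (hF : FF d m l ≠ 0) (j : ℕ) :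
    ∀ z ∈ (PP d l m).roots, (fc d l)^[j] z ≠ 0 := by
  intro z hz h0
  have h := prod_root_iter hd l hm j
  rw [Multiset.prod_eq_zero (Multiset.mem_map.2 ⟨z, hz, by rw [h0, norm_zero]⟩)] at h
  exact hF (norm_eq_zero.1 h.symm)

lemma log_mul_eq {d n : ℕ} (hd : 2 ≤ d) {l z : ℂ} (h : ∀ j, (fc d l)^[j] z ≠ 0) :
    mul d n l z ≠ 0 ∧
    Real.log ‖mul d n l z‖ = ∑ j ∈ Finset.range n, (Real.log d + (d - 1) * Real.log ‖(fc d l)^[j] z‖) := by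
  have hd0 : (d:ℂ) ≠ 0 := by exact_mod_cast (by omega : d ≠ 0)
  have hne : ∀ j ∈ Finset.range n, (d:ℂ) * ((fc d l)^[j] z) ^ (d - 1) ≠ 0 := fun j _ =>
    mul_ne_zero hd0 (pow_ne_zero _ (h j))
  refine ⟨Finset.prod_ne_zero_iff.2 hne, ?_⟩
  unfold mul
  rw [norm_prod, Real.log_prod (fun j hj => norm_ne_zero_iff.2 (hne j hj))]
  refine Finset.sum_congr rfl fun j _ => ?_
  rw [norm_mul, norm_pow, Real.log_mul (norm_ne_zero_iff.2 hd0) (pow_ne_zero _ (norm_ne_zero_iff.2 (h j))),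
    Real.log_pow, Complex.norm_natCast, Nat.cast_sub (by omega)]
  simp

lemma log_sum {d n m : ℕ} (hd : 2 ≤ d) {l : ℂ} (hm : 0 < m) (hF : FF d m l ≠ 0) :
    ((PP d l m).roots.map fun z => Real.log ‖mul d n l z‖).sum
      = n * ((d:ℝ) ^ m * Real.log d + (d - 1) * Real.log ‖FF d m l‖) := by
  have h1 : ((PP d l m).roots.map fun z => Real.log ‖mul d n l z‖)
      = (PP d l m).roots.map fun z => ∑ j ∈ Finset.range n, (Real.log d + (d - 1) * Real.log ‖(fc d l)^[j] z‖) :=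
    Multiset.map_congr rfl fun z hz => (log_mul_eq hd fun j => root_iter_ne hd hm hF j z hz).2
  rw [h1, Multiset.sum_map_sum]
  have h2 : ∀ j ∈ Finset.range n,
      ((PP d l m).roots.map fun z => (Real.log d + (d - 1) * Real.log ‖(fc d l)^[j] z‖)).sum
      = (d:ℝ) ^ m * Real.log d + (d - 1) * Real.log ‖FF d m l‖ := by
    intro j _
    rw [Multiset.sum_map_add, Multiset.sum_map_mul_left, ← prod_root_iter hd l hm j,
      log_mprod _ _ (fun z hz => norm_ne_zero_iff.2 (root_iter_ne hd hm hF j z hz))]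
    congr 1
    rw [Multiset.map_const', Multiset.sum_replicate, IsAlgClosed.card_roots_eq_natDegree, (PP_monic hd l hm).2, nsmul_eq_mul]
    push_cast; rfl
  rw [Finset.sum_congr rfl h2, Finset.sum_const, Finset.card_range, nsmul_eq_mul]

lemma sum_roots_prod {ι : Type*} (s : Finset ι) (P : ι → ℂ[X]) (hP : ∀ i ∈ s, P i ≠ 0) (h : ℂ → ℝ) :
    ((∏ i ∈ s, P i).roots.map h).sum = ∑ i ∈ s, ((P i).roots.map h).sum := by
  classical
  induction s using Finset.induction with
  | empty => simp
  | insert a s ha ih =>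
    have h1 : ∀ i ∈ s, P i ≠ 0 := fun i hi => hP i (Finset.mem_insert_of_mem hi)
    rw [Finset.prod_insert ha, Finset.sum_insert ha, roots_mul
      (mul_ne_zero (hP a (Finset.mem_insert_self a s)) (Finset.prod_ne_zero_iff.2 h1)), Multiset.map_add,
      Multiset.sum_add, ih h1]

/-- sums over roots of the dynatomic polynomial -/
lemma phi_sum {d n : ℕ} (hd : 2 ≤ d) (l : ℂ) {φ : ℂ[X]} (hφ : φ.Monic)
    (hid : ∀ z : ℂ, (∏ m ∈ n.divisors.filter fun m => ArithmeticFunction.moebius (n / m) = 1,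
            ((fc d l)^[m] z - z)) = φ.eval z *
            ∏ m ∈ n.divisors.filter fun m => ArithmeticFunction.moebius (n / m) = -1,
              ((fc d l)^[m] z - z)) (h : ℂ → ℝ) :
    (φ.roots.map h).sum = ∑ m ∈ n.divisors,
      (ArithmeticFunction.moebius (n / m) : ℝ) * ((PP d l m).roots.map h).sum := by
  have hid' : (∏ m ∈ n.divisors.filter fun m => ArithmeticFunction.moebius (n / m) = 1, PP d l m)
      = φ * ∏ m ∈ n.divisors.filter fun m => ArithmeticFunction.moebius (n / m) = -1, PP d l m := by
    apply Polynomial.funext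
    intro z
    rw [eval_mul, eval_prod, eval_prod]
    simp_rw [PP_eval]
    exact hid z
  have hne : ∀ m ∈ n.divisors, PP d l m ≠ 0 := fun m hm =>
    (PP_monic hd l (Nat.pos_of_mem_divisors hm)).1.ne_zero
  have h1 := congrArg (fun p : ℂ[X] => (p.roots.map h).sum) hid'
  have hne2 : ∀ m ∈ n.divisors.filter fun m => ArithmeticFunction.moebius (n / m) = -1, PP d l m ≠ 0 :=
    fun m hm => hne m (Finset.mem_filter.1 hm).1
  rw [roots_mul (mul_ne_zero hφ.ne_zero (Finset.prod_ne_zero_iff.2 hne2)), Multiset.map_add, Multiset.sum_add,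
    sum_roots_prod _ _ (fun m hm => hne m (Finset.mem_filter.1 hm).1), sum_roots_prod _ _ hne2] at h1
  rw [eq_sub_of_add_eq h1.symm, Finset.sum_filter, Finset.sum_filter, ← Finset.sum_sub_distrib]
  refine Finset.sum_congr rfl fun m _ => ?_
  rcases ArithmeticFunction.moebius_eq_or (n / m) with h0 | h0 | h0 <;> rw [h0] <;> simp

lemma msum_finset (s : Multiset ℂ) (Z : Finset ℂ) (c : ℂ → ℝ) (hc : ∀ x ∈ s, x ∉ Z → c x = 0) :
    (s.map c).sum = ∑ x ∈ Z, (s.count x : ℝ) * c x := by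
  induction s using Multiset.induction with
  | empty => simp
  | cons a s ih =>
    rw [Multiset.map_cons, Multiset.sum_cons, ih fun x hx => hc x (Multiset.mem_cons_of_mem hx)]
    simp_rw [Multiset.count_cons]
    push_cast
    simp_rw [add_mul]
    rw [Finset.sum_add_distrib, add_comm]
    congr 1
    simp only [ite_mul, one_mul, zero_mul]
    rw [Finset.sum_ite_eq']
    split_ifs with h
    · rfl
    · exact hc a (Multiset.mem_cons_self a s) h

/-- the truncation correction -/
noncomputable def cc (d n : ℕ) (r : ℝ) (l z : ℂ) : ℝ :=
  Real.log (max r ‖mul d n l z‖) - Real.log ‖mul d n l z‖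

lemma cc_zero {d n : ℕ} {r : ℝ} (hr : r ≤ 1) {l z : ℂ} (h : ¬ ‖mul d n l z‖ < 1) : cc d n r l z = 0 := by
  unfold cc
  rw [max_eq_right (hr.trans (not_lt.1 h)), sub_self]

lemma cc_bd {d n : ℕ} {r : ℝ} (hr : r ≤ 1) {l z : ℂ} (h : ‖mul d n l z‖ < 1) (h0 : mul d n l z ≠ 0) :
    0 ≤ cc d n r l z ∧ cc d n r l z ≤ - Real.log ‖mul d n l z‖ := by
  have hp := norm_pos_iff.2 h0
  unfold cc
  constructor
  · rw [sub_nonneg]; exact Real.log_le_log hp (le_max_right _ _)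
  · have : Real.log (max r ‖mul d n l z‖) ≤ 0 := Real.log_nonpos (hp.le.trans (le_max_right _ _)) (max_le hr h.le)
    linarith

lemma cc_supp {d n m : ℕ} (hd : 2 ≤ d) (hn : 0 < n) {r : ℝ} (hr : r ≤ 1) {l z : ℂ} (hm : m ∈ n.divisors)
    (hz : z ∈ (PP d l m).roots) (hc : cc d n r l z ≠ 0) : ∃ k, Att d k l z := by
  have hm0 := Nat.pos_of_mem_divisors hm
  have h1 : ‖mul d n l z‖ < 1 := by
    by_contra h; exact hc (cc_zero hr h)
  have hz' := (mem_roots (PP_monic hd l hm0).1.ne_zero).1 hz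
  rw [IsRoot.def, PP_eval, sub_eq_zero] at hz'
  obtain ⟨q, rfl⟩ := Nat.dvd_of_mem_divisors hm
  have hp : Function.IsPeriodicPt (fc d l) m z := hz'
  exact ⟨_, att_of_per hn (hp.mul_const q) h1⟩

lemma cc_off {d n : ℕ} (hd : 2 ≤ d) (hn : 0 < n) {r : ℝ} (hr : r ≤ 1) {l : ℂ} (hno : ∀ k, l ∉ U d k) {m : ℕ}
    (hm : m ∈ n.divisors) : ((PP d l m).roots.map (cc d n r l)).sum = 0 := by
  apply Multiset.sum_eq_zero
  intro x hx
  obtain ⟨z, hz, rfl⟩ := Multiset.mem_map.1 hx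
  by_contra hc
  obtain ⟨k, hk⟩ := cc_supp hd hn hr hm hz hc
  exact hno k ⟨z, hk⟩

lemma cc_on {d n k : ℕ} (hd : 2 ≤ d) (hn : 0 < n) {r : ℝ} (hr : r ≤ 1) {l z : ℂ} (hz : Att d k l z) {m : ℕ}
    (hm : m ∈ n.divisors) : ((PP d l m).roots.map (cc d n r l)).sum
      = (if k ∣ m then 1 else 0) * ∑ x ∈ Zc d k l z, cc d n r l x := by
  rw [msum_finset _ (Zc d k l z)]
  · rw [Finset.mul_sum]
    refine Finset.sum_congr rfl fun x hx => ?_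
    obtain ⟨i, rfl⟩ := (mem_Zc hz.1 hz.per).1 hx
    rw [PP_count hd (Nat.pos_of_mem_divisors hm) (hz.orbit i)]
    split_ifs <;> simp
  · intro x hx hxZ
    by_contra hc
    obtain ⟨k', hk'⟩ := cc_supp hd hn hr hm hx hc
    exact hxZ ((mem_Zc hz.1 hz.per).2 (hk'.unique hd hz))

lemma cc_total {d n : ℕ} (hd : 2 ≤ d) {r : ℝ} (hr : r ≤ 1) {l z : ℂ} (hz : Att d n l z)
    (hS : S d n l ≠ 0) : 0 ≤ ∑ x ∈ Zc d n l z, cc d n r l x ∧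
      ∑ x ∈ Zc d n l z, cc d n r l x ≤ n * (- ((d - 1) * Real.log ‖S d n l‖)) := by
  have key : ∀ x ∈ Zc d n l z, 0 ≤ cc d n r l x ∧ cc d n r l x ≤ - ((d - 1) * Real.log ‖S d n l‖) := by
    intro x hx
    obtain ⟨i, rfl⟩ := (mem_Zc hz.1 hz.per).1 hx
    have ha := hz.orbit i
    have h1 := S_norm hd ha
    have hne : mul d n l ((fc d l)^[i] z) ≠ 0 := by
      rw [← norm_ne_zero_iff, ← h1]; exact pow_ne_zero _ (norm_ne_zero_iff.2 hS)
    have h2 := cc_bd hr ha.2.2 hne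
    rw [← h1, Real.log_pow, Nat.cast_sub (by omega), Nat.cast_one] at h2
    exact h2
  refine ⟨Finset.sum_nonneg fun x hx => (key x hx).1, ?_⟩
  refine (Finset.sum_le_card_nsmul _ _ _ fun x hx => (key x hx).2).trans ?_
  rw [nsmul_eq_mul]
  have hc : ((Zc d n l z).card : ℝ) ≤ n := by
    have := (Finset.card_image_le (s := Finset.range n) (f := fun i => (fc d l)^[i] z))
    rw [Finset.card_range] at this
    exact_mod_cast this
  have hl : Real.log ‖S d n l‖ ≤ 0 := Real.log_nonpos (norm_nonneg _) (S_norm_lt hd ⟨z, hz⟩).le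
  have hd' : (2:ℝ) ≤ d := by exact_mod_cast hd
  have : 0 ≤ - ((d - 1) * Real.log ‖S d n l‖) := by nlinarith
  gcongr

end S17

namespace S17

open MeasureTheory Real Polynomial Filter Topology

lemma fs_aux : IntegrableOn (fun y : ℝ => y / (1 + y ^ 2) ^ 2) (Set.Ioi 0) ∧
    ∫ y in Set.Ioi (0:ℝ), y / (1 + y ^ 2) ^ 2 = 1 / 2 := by
  have hd : ∀ x ∈ Set.Ici (0:ℝ), HasDerivAt (fun y : ℝ => - (1 / 2) * (1 + y ^ 2)⁻¹) (x / (1 + x ^ 2) ^ 2) x := by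
    intro x _
    have h1 : HasDerivAt (fun y : ℝ => 1 + y ^ 2) (2 * x) x := by
      simpa using (hasDerivAt_pow 2 x).const_add 1
    have hne : 1 + x ^ 2 ≠ 0 := by positivity
    have e : x / (1 + x ^ 2) ^ 2 = -(1 / 2) * (-(2 * x) / (1 + x ^ 2) ^ 2) := by ring
    rw [e]
    exact (h1.fun_inv hne).const_mul (-(1 / 2))
  have hp : ∀ x ∈ Set.Ioi (0:ℝ), 0 ≤ x / (1 + x ^ 2) ^ 2 := by
    intro x hx
    have : 0 < x := hx
    positivity
  have hl : Tendsto (fun y : ℝ => - (1 / 2) * (1 + y ^ 2)⁻¹) atTop (𝓝 (-(1 / 2) * 0)) := by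
    refine (tendsto_inv_atTop_zero.comp ?_).const_mul _
    exact tendsto_atTop_add_const_left _ _ (tendsto_pow_atTop (by norm_num))
  refine ⟨integrableOn_Ioi_deriv_of_nonneg' hd hp hl, ?_⟩
  rw [integral_Ioi_of_hasDerivAt_of_nonneg' hd hp hl]
  norm_num

lemma fs_int : Integrable (fun l : ℂ => 1 / (1 + ‖l‖ ^ 2) ^ 2) ∧ ∫ l : ℂ, 1 / (1 + ‖l‖ ^ 2) ^ 2 = π := by
  obtain ⟨h1, h2⟩ := fs_aux
  constructor
  · rw [integrable_fun_norm_addHaar (volume : Measure ℂ) (f := fun y : ℝ => 1 / (1 + y ^ 2) ^ 2)]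
    rw [Complex.finrank_real_complex]
    refine h1.congr_fun (fun y _ => ?_) measurableSet_Ioi
    simp [div_eq_mul_inv]
  · have := integral_fun_norm_addHaar (volume : Measure ℂ) (fun y : ℝ => 1 / (1 + y ^ 2) ^ 2)
    rw [this, Complex.finrank_real_complex]
    have e : ∫ y in Set.Ioi (0:ℝ), y ^ (2 - 1) • (1 / (1 + y ^ 2) ^ 2) = 1 / 2 := by
      rw [← h2]
      refine setIntegral_congr_fun measurableSet_Ioi (fun y _ => ?_)
      simp [div_eq_mul_inv]
    rw [e, Measure.real, Complex.volume_ball]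
    simp
    ring

lemma zero_null {d : ℕ} (hd : 2 ≤ d) : ∀ᵐ l : ℂ, ∀ m, 0 < m → FF d m l ≠ 0 := by
  rw [ae_all_iff]
  intro m
  by_cases hm : 0 < m
  · obtain ⟨q, rfl⟩ : ∃ q, m = q + 1 := ⟨m - 1, by omega⟩
    have hne : (FpZ d (q + 1)).map (algebraMap ℤ ℂ) ≠ 0 := ((FpZ_monic hd q).1.map _).ne_zero
    have hfin := ((FpZ d (q + 1)).map (algebraMap ℤ ℂ)).roots.toFinset.finite_toSet
    have h0 := hfin.measure_zero (volume : Measure ℂ)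
    filter_upwards [compl_mem_ae_iff.2 h0] with l hl _ h
    apply hl
    simp only [Finset.mem_coe, Multiset.mem_toFinset]
    rw [mem_roots hne, IsRoot, eval_map_algebraMap, FpZ_eval]
    exact h
  · exact Eventually.of_forall fun l h => absurd h hm

noncomputable def GG (d n : ℕ) : ℂ → ℝ := (U d n).indicator fun l => Real.log (1 / ‖S d n l‖)

lemma GG_nonneg {d n : ℕ} (hd : 2 ≤ d) (l : ℂ) : 0 ≤ GG d n l := by
  unfold GG
  apply Set.indicator_nonneg
  intro x hx
  rw [one_div, Real.log_inv]
  have := Real.log_nonpos (norm_nonneg _) (S_norm_lt hd hx).le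
  linarith

lemma GG_int {d n : ℕ} (hd : 2 ≤ d) (hn : 0 < n) : Integrable (GG d n) ∧ ∫ l, GG d n l ≤ 272 * π := by
  have hU := (U_open d n).measurableSet
  have hmeas : AEStronglyMeasurable (fun l => Real.log (1 / ‖S d n l‖)) (volume.restrict (U d n)) := by
    have h1 : AEMeasurable (S d n) (volume.restrict (U d n)) := ((S_diffOn hd).continuousOn).aemeasurable hU
    exact (Real.measurable_log.comp_aemeasurable (h1.norm.const_div 1)).aestronglyMeasurable
  have hnn : 0 ≤ᵐ[volume.restrict (U d n)] fun l => Real.log (1 / ‖S d n l‖) := by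
    refine (ae_restrict_iff' hU).2 (Eventually.of_forall fun x hx => ?_)
    have := Real.log_nonpos (norm_nonneg _) (S_norm_lt hd hx).le
    simp only [Pi.zero_apply]
    rw [one_div, Real.log_inv]; linarith
  have harea := U_area hd hn
  have hb : ENNReal.ofReal 17 * volume (Metric.ball (0:ℂ) 4) = ENNReal.ofReal (272 * π) := by
    rw [Complex.volume_ball, show (272:ℝ) * π = 17 * (4 ^ 2 * π) by ring, ENNReal.ofReal_mul (by norm_num),
      ENNReal.ofReal_mul (by norm_num), ENNReal.ofReal_pow (by norm_num)]
    congr 2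
    rw [← NNReal.coe_real_pi, ENNReal.ofReal_coe_nnreal]
  rw [hb] at harea
  have hIntg : IntegrableOn (fun l => Real.log (1 / ‖S d n l‖)) (U d n) := by
    refine ⟨hmeas, ?_⟩
    rw [hasFiniteIntegral_iff_ofReal hnn]
    exact harea.trans_lt ENNReal.ofReal_lt_top
  refine ⟨(integrable_indicator_iff hU).2 hIntg, ?_⟩
  unfold GG
  rw [integral_indicator hU, integral_eq_lintegral_of_nonneg_ae hnn hmeas]
  exact ENNReal.toReal_le_of_le_ofReal (by positivity) harea

/-- the pointwise estimate -/
lemma ptwise {d n : ℕ} (hd : 2 ≤ d) (hn : 0 < n) {gI : ℂ → ℝ} (hg : IsG d gI) {l : ℂ}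
    (hF : ∀ m, 0 < m → FF d m l ≠ 0) {φ : ℂ[X]} (hφ : φ.Monic)
    (hid : ∀ z : ℂ, (∏ m ∈ n.divisors.filter fun m => ArithmeticFunction.moebius (n / m) = 1,
            ((fc d l)^[m] z - z)) = φ.eval z *
            ∏ m ∈ n.divisors.filter fun m => ArithmeticFunction.moebius (n / m) = -1,
              ((fc d l)^[m] z - z)) {r : ℝ} (hr : r ≤ 1) :
    |(1 / (n : ℝ)) * (φ.roots.map (fun z => Real.log (max r ‖deriv ((fc d l)^[n]) z‖))).sum
            - (nu d n : ℝ) * Real.log d - ((d : ℝ) - 1) / d * (nu d n : ℝ) * gI l|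
      ≤ (∑ m ∈ n.divisors, (d - 1) * (C0 d + 1 + ee d m)) + (d - 1) * GG d n l := by
  have hd' : (2:ℝ) ≤ d := by exact_mod_cast hd
  have hn' : (0:ℝ) < n := by exact_mod_cast hn
  have e1 : (φ.roots.map (fun z => Real.log (max r ‖deriv ((fc d l)^[n]) z‖))).sum
      = (φ.roots.map fun z => Real.log ‖mul d n l z‖).sum + (φ.roots.map (cc d n r l)).sum := by
    rw [← Multiset.sum_map_add]
    congr 1
    refine Multiset.map_congr rfl fun z _ => ?_
    rw [mul_eq_deriv]; unfold cc; ring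
  have e2 : (φ.roots.map fun z => Real.log ‖mul d n l z‖).sum = n * ∑ m ∈ n.divisors,
      (ArithmeticFunction.moebius (n / m) : ℝ) * ((d:ℝ) ^ m * Real.log d + (d - 1) * Real.log ‖FF d m l‖) := by
    rw [phi_sum hd l hφ hid, Finset.mul_sum]
    refine Finset.sum_congr rfl fun m hm => ?_
    have hm0 := Nat.pos_of_mem_divisors hm
    rw [log_sum hd hm0 (hF m hm0)]; ring
  have enu : (nu d n : ℝ) = ∑ m ∈ n.divisors, (ArithmeticFunction.moebius (n / m) : ℝ) * (d:ℝ) ^ m := by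
    unfold nu; push_cast; rfl
  have e3 : (1 / (n : ℝ)) * (φ.roots.map (fun z => Real.log (max r ‖deriv ((fc d l)^[n]) z‖))).sum
            - (nu d n : ℝ) * Real.log d - ((d : ℝ) - 1) / d * (nu d n : ℝ) * gI l
      = (∑ m ∈ n.divisors, (ArithmeticFunction.moebius (n / m) : ℝ) * ((d - 1) * uu d gI m l))
        + (1 / (n:ℝ)) * (φ.roots.map (cc d n r l)).sum := by
    rw [e1, e2, mul_add, ← mul_assoc, one_div_mul_cancel hn'.ne', one_mul, enu, Finset.sum_mul, Finset.mul_sum,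
      Finset.sum_mul, add_sub_right_comm, add_sub_right_comm, ← Finset.sum_sub_distrib, ← Finset.sum_sub_distrib]
    congr 1
    refine Finset.sum_congr rfl fun m hm => ?_
    have hm0 := Nat.pos_of_mem_divisors hm
    have : (d:ℝ) ^ m = d * d ^ (m - 1) := by rw [← pow_succ']; congr 1; omega
    have hdd : (d:ℝ) ≠ 0 := by linarith
    unfold uu
    rw [this]
    field_simp
    ring
  have hmu : ∀ m, |(ArithmeticFunction.moebius (n / m) : ℝ)| ≤ 1 := by
    intro m
    rcases ArithmeticFunction.moebius_eq_or (n / m) with h0 | h0 | h0 <;> rw [h0] <;> simp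
  have hsum : ∀ v : ℕ → ℝ, (∀ m, 1 ≤ m → |v m| ≤ C0 d + 1 + ee d m) →
      |∑ m ∈ n.divisors, (ArithmeticFunction.moebius (n / m) : ℝ) * ((d - 1) * v m)| ≤
        ∑ m ∈ n.divisors, (d - 1) * (C0 d + 1 + ee d m) := by
    intro v hv
    refine (Finset.abs_sum_le_sum_abs _ _).trans (Finset.sum_le_sum fun m hm => ?_)
    have hm0 := Nat.pos_of_mem_divisors hm
    rw [abs_mul, abs_mul, abs_of_nonneg (show (0:ℝ) ≤ d - 1 by linarith)]
    have h1 := hv m hm0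
    have h2 : 0 ≤ (d - 1) * |v m| := mul_nonneg (by linarith) (abs_nonneg _)
    calc _ ≤ 1 * ((d - 1) * |v m|) := mul_le_mul_of_nonneg_right (hmu m) h2
      _ ≤ _ := by rw [one_mul]; exact mul_le_mul_of_nonneg_left h1 (by linarith)
  rw [e3]
  by_cases hno : ∀ k, l ∉ U d k
  · have hc : (φ.roots.map (cc d n r l)).sum = 0 := by
      rw [phi_sum hd l hφ hid]
      exact Finset.sum_eq_zero fun m hm => by rw [cc_off hd hn hr hno hm, mul_zero]
    rw [hc, mul_zero, add_zero]
    have := hsum _ (fun m hm => off_uu hd hg hm hno)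
    have hG := mul_nonneg (show (0:ℝ) ≤ d - 1 by linarith) (GG_nonneg (n := n) hd l)
    linarith
  · push Not at hno
    obtain ⟨k, hk⟩ := hno
    obtain ⟨z, hz⟩ := id hk
    have hS : S d k l ≠ 0 := fun h => hF k hz.1 (U_S_zero hd hk dvd_rfl h)
    have hc : (φ.roots.map (cc d n r l)).sum = (if n = k then 1 else 0) * ∑ x ∈ Zc d k l z, cc d n r l x := by
      rw [phi_sum hd l hφ hid, ← moeb_sum hn, Finset.sum_mul]
      exact Finset.sum_congr rfl fun m hm => by rw [cc_on hd hn hr hz hm, mul_assoc]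
    have hs := hsum _ (fun m hm => U_uu hd hz.1 hg hm hk hS)
    have e4 : ∑ m ∈ n.divisors, (ArithmeticFunction.moebius (n / m) : ℝ) * ((d - 1) * uu d gI m l)
        = (∑ m ∈ n.divisors, (ArithmeticFunction.moebius (n / m) : ℝ) *
            ((d - 1) * (uu d gI m l - (if k ∣ m then 1 else 0) * Real.log ‖S d k l‖)))
          + (if n = k then 1 else 0) * ((d - 1) * Real.log ‖S d k l‖) := by
      rw [← moeb_sum hn, Finset.sum_mul, ← Finset.sum_add_distrib]
      exact Finset.sum_congr rfl fun m _ => by ring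
    rw [e4, hc]
    by_cases hnk : n = k
    · subst hnk
      simp only [if_true, one_mul]
      have ht := cc_total hd hr hz hS
      have hG : GG d n l = - Real.log ‖S d n l‖ := by
        unfold GG; rw [Set.indicator_of_mem hk, one_div, Real.log_inv]
      rw [hG]
      set T := ∑ x ∈ Zc d n l z, cc d n r l x with hT
      have h1 : 0 ≤ 1 / (n:ℝ) * T := mul_nonneg (by positivity) ht.1
      have h2 : 1 / (n:ℝ) * T ≤ - ((d - 1) * Real.log ‖S d n l‖) := by
        rw [one_div, inv_mul_le_iff₀ hn']; exact ht.2
      rw [abs_le] at hs ⊢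
      constructor <;> linarith
    · simp only [hnk, if_false, zero_mul, mul_zero, add_zero]
      have hG := mul_nonneg (show (0:ℝ) ≤ d - 1 by linarith) (GG_nonneg (n := n) hd l)
      linarith

end S17

theorem statement17 (d : ℕ) (hd : 1 < d) (gI : ℂ → ℝ)
    (hgI : ∀ lam : ℂ, Filter.Tendsto
      (fun k : ℕ => (1 / 2) * Real.log (1 + ‖(fc d lam)^[k] 0‖ ^ 2) / (d : ℝ) ^ (k - 1))
      Filter.atTop (nhds (gI lam))) :
    ∃ C : ℝ, 0 < C ∧ ∀ n : ℕ, 1 < n →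
      ∀ Φ : Polynomial (Polynomial ℂ),
      (∀ lam z : ℂ,
        (∏ m ∈ n.divisors.filter fun m => ArithmeticFunction.moebius (n / m) = 1,
            ((fc d lam)^[m] z - z)) =
          (Φ.map (evalRingHom lam)).eval z *
            ∏ m ∈ n.divisors.filter fun m => ArithmeticFunction.moebius (n / m) = -1,
              ((fc d lam)^[m] z - z)) →
      (∀ lam : ℂ, (Φ.map (evalRingHom lam)).Monic) →
      (∀ lam : ℂ, ((Φ.map (evalRingHom lam)).natDegree : ℤ) = nu d n) →
      ∀ r : ℝ, 0 < r → r ≤ 1 →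
      π⁻¹ * (∫ lam : ℂ,
          |(1 / (n : ℝ)) *
              (((Φ.map (evalRingHom lam)).roots).map
                (fun z => Real.log (max r ‖deriv ((fc d lam)^[n]) z‖))).sum
            - (nu d n : ℝ) * Real.log d
            - ((d : ℝ) - 1) / d * (nu d n : ℝ) * gI lam| / (1 + ‖lam‖ ^ 2) ^ 2)
        ≤ (2 * Real.log d) * (∑ m ∈ n.divisors, (m : ℝ)) + C * n.divisors.card := by
  have hd2 : 2 ≤ d := hd
  have hd' : (2:ℝ) ≤ d := by exact_mod_cast hd
  have hg : S17.IsG d gI := hgI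
  have hC0 := S17.C0_nonneg d
  have hl4 : 0 ≤ Real.log (4 * d) := Real.log_nonneg (by linarith)
  have hl2 : 0 ≤ Real.log 2 := Real.log_nonneg (by norm_num)
  set K : ℝ := (d - 1) * (S17.C0 d + 1) + Real.log (4 * d) + (d - 1) * Real.log 2 with hK
  have hK0 : 0 ≤ K := by
    have : (0:ℝ) ≤ d - 1 := by linarith
    positivity
  refine ⟨K + 272 * (d - 1), by nlinarith, ?_⟩
  intro n hn Φ hid hmon _ r _ hr
  have hn0 : 0 < n := by omega
  set E : ℝ := ∑ m ∈ n.divisors, ((d:ℝ) - 1) * (S17.C0 d + 1 + S17.ee d m) with hE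
  have hE0 : 0 ≤ E := Finset.sum_nonneg fun m _ =>
    mul_nonneg (by linarith) (by linarith [S17.ee_nonneg hd2 m])
  obtain ⟨f1, f2⟩ := S17.fs_int
  obtain ⟨g1, g2⟩ := S17.GG_int hd2 hn0
  have hR : Integrable (fun l : ℂ => E * (1 / (1 + ‖l‖ ^ 2) ^ 2) + (d - 1) * S17.GG d n l) :=
    (f1.const_mul E).add (g1.const_mul _)
  have hI : (∫ lam : ℂ,
          |(1 / (n : ℝ)) *
              (((Φ.map (evalRingHom lam)).roots).map
                (fun z => Real.log (max r ‖deriv ((fc d lam)^[n]) z‖))).sum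
            - (nu d n : ℝ) * Real.log d
            - ((d : ℝ) - 1) / d * (nu d n : ℝ) * gI lam| / (1 + ‖lam‖ ^ 2) ^ 2)
      ≤ ∫ l : ℂ, (E * (1 / (1 + ‖l‖ ^ 2) ^ 2) + (d - 1) * S17.GG d n l) := by
    refine integral_mono_of_nonneg (Filter.Eventually.of_forall fun l => by positivity) hR ?_
    filter_upwards [S17.zero_null hd2] with l hl
    have h1 := S17.ptwise hd2 hn0 hg hl (hmon l) (hid l) hr
    have hG := mul_nonneg (show (0:ℝ) ≤ d - 1 by linarith) (S17.GG_nonneg (n := n) hd2 l)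
    have hw : (1:ℝ) ≤ (1 + ‖l‖ ^ 2) ^ 2 := one_le_pow₀ (by nlinarith [sq_nonneg ‖l‖])
    have h2 : (d - 1) * S17.GG d n l / (1 + ‖l‖ ^ 2) ^ 2 ≤ (d - 1) * S17.GG d n l := div_le_self hG hw
    refine (div_le_div_of_nonneg_right h1 (by positivity)).trans ?_
    rw [add_div, ← hE, mul_one_div]
    linarith
  rw [integral_add (f1.const_mul E) (g1.const_mul _), integral_const_mul, integral_const_mul, f2] at hI
  have hcard : (1:ℝ) ≤ n.divisors.card := by
    exact_mod_cast Finset.card_pos.2 ⟨n, Nat.mem_divisors_self n hn0.ne'⟩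
  have hEle : E ≤ 2 * Real.log d * (∑ m ∈ n.divisors, (m : ℝ)) + K * n.divisors.card := by
    have e : ∀ m ∈ n.divisors, ((d:ℝ) - 1) * (S17.C0 d + 1 + S17.ee d m) = m * Real.log (2 * d) + K := by
      intro m _
      have : (d:ℝ) - 1 ≠ 0 := by linarith
      rw [hK]; unfold S17.ee
      field_simp
      ring
    rw [hE, Finset.sum_congr rfl e, Finset.sum_add_distrib, Finset.sum_const, nsmul_eq_mul, ← Finset.sum_mul]
    have h2d : Real.log (2 * d) ≤ 2 * Real.log d := by
      rw [Real.log_mul (by norm_num) (by linarith)]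
      have := Real.log_le_log (by norm_num) hd'
      linarith
    have hs : (0:ℝ) ≤ ∑ m ∈ n.divisors, (m : ℝ) := Finset.sum_nonneg fun m _ => Nat.cast_nonneg m
    nlinarith
  have hfin : π⁻¹ * (E * π + (d - 1) * ∫ l : ℂ, S17.GG d n l) ≤ E + 272 * (d - 1) := by
    rw [inv_mul_le_iff₀ Real.pi_pos]
    have := mul_le_mul_of_nonneg_left g2 (show (0:ℝ) ≤ d - 1 by linarith)
    linarith
  refine (mul_le_mul_of_nonneg_left hI (by positivity)).trans (hfin.trans ?_)
  nlinarith
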